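/- Let N ≥ 2, q ≥ (N+2)/N, q' = q/(q-1), and let O ⊂ ℝ^{N+1} be a bounded open set. If the equation ∂_t u − Δu + u^q = 0 admits a large solution in O, then for every point (x,t) of the parabolic boundary ∂_pO one has ∫_0^1 Cap_{2,1,q'}( O^c ∩ Q_ρ(x,t) ) ρ^{−N} (dρ/ρ) = ∞. -/

import Mathlib

open MeasureTheory Metric Set
open scoped ENNReal NNReal

noncomputable section

/-- Points of `ℝ^{N+1}` are written `(x, t)` with `x ∈ ℝ^N` and `t ∈ ℝ`. -/
abbrev PSpace (N : ℕ) := EuclideanSpace ℝ (Fin N) × ℝ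

/-- The parabolic cylinder `Q_δ(x,t) = B_δ(x) × (t - δ², t]`. -/
def pQ (N : ℕ) (δ : ℝ) (z : PSpace N) : Set (PSpace N) :=
  ball z.1 δ ×ˢ Ioc (z.2 - δ ^ 2) z.2

/-- The parabolic cylinder `Q̃_r(x,t) = B_r(x) × (t - r², t + r²)`. -/
def pQt (N : ℕ) (r : ℝ) (z : PSpace N) : Set (PSpace N) :=
  ball z.1 r ×ˢ Ioo (z.2 - r ^ 2) (z.2 + r ^ 2)

/-- The parabolic boundary of an open set `O ⊆ ℝ^{N+1}`: points of the topological
boundary such that every downward cylinder `Q_δ` meets the complement of `O`. -/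
def pBoundary (N : ℕ) (O : Set (PSpace N)) : Set (PSpace N) :=
  {z ∈ frontier O | ∀ δ > 0, (pQ N δ z ∩ Oᶜ).Nonempty}

/-- Partial derivative in time. -/
def tDeriv {N : ℕ} (u : PSpace N → ℝ) (z : PSpace N) : ℝ :=
  deriv (fun s => u (z.1, s)) z.2

/-- Partial derivative in the `i`-th spatial direction. -/
def xDeriv {N : ℕ} (i : Fin N) (u : PSpace N → ℝ) (z : PSpace N) : ℝ :=
  lineDeriv ℝ (fun y => u (y, z.2)) z.1 (EuclideanSpace.single i 1)

/-- Second spatial partial derivative. -/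
def xxDeriv {N : ℕ} (i j : Fin N) (u : PSpace N → ℝ) (z : PSpace N) : ℝ :=
  xDeriv i (xDeriv j u) z

/-- Spatial Laplacian. -/
def lapl {N : ℕ} (u : PSpace N → ℝ) (z : PSpace N) : ℝ :=
  ∑ i : Fin N, xxDeriv i i u z

/-- Euclidean norm of the spatial gradient. -/
def gradNorm {N : ℕ} (u : PSpace N → ℝ) (z : PSpace N) : ℝ :=
  Real.sqrt (∑ i : Fin N, (xDeriv i u z) ^ 2)

/-- `u ∈ C^{2,1}(O)` : `u`, its first and second spatial derivatives and its time
derivative exist and are continuous in `O`. -/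
structure IsC21 {N : ℕ} (O : Set (PSpace N)) (u : PSpace N → ℝ) : Prop where
  cont : ContinuousOn u O
  diff_t : ∀ z ∈ O, DifferentiableAt ℝ (fun s => u (z.1, s)) z.2
  cont_t : ContinuousOn (tDeriv u) O
  diff_x : ∀ (i : Fin N), ∀ z ∈ O,
    LineDifferentiableAt ℝ (fun y => u (y, z.2)) z.1 (EuclideanSpace.single i 1)
  cont_x : ∀ i : Fin N, ContinuousOn (xDeriv i u) O
  diff_xx : ∀ (i j : Fin N), ∀ z ∈ O,
    LineDifferentiableAt ℝ (fun y => xDeriv j u (y, z.2)) z.1 (EuclideanSpace.single i 1)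
  cont_xx : ∀ i j : Fin N, ContinuousOn (xxDeriv i j u) O

/-- The blow-up condition `lim_{δ→0} inf_{O ∩ Q_δ(z)} u = ∞` at every point of the
parabolic boundary. -/
def BlowsUp {N : ℕ} (O : Set (PSpace N)) (u : PSpace N → ℝ) : Prop :=
  ∀ z ∈ pBoundary N O, ∀ M : ℝ, ∃ δ > (0 : ℝ), ∀ w ∈ O ∩ pQ N δ z, M ≤ u w

/-- A large solution of `∂_t u - Δu + f(u) = 0` in `O`. -/
def IsLargeSolution {N : ℕ} (O : Set (PSpace N)) (f : ℝ → ℝ) (u : PSpace N → ℝ) : Prop :=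
  IsC21 O u ∧ (∀ z ∈ O, tDeriv u z - lapl u z + f (u z) = 0) ∧ BlowsUp O u

/-- The parabolic Sobolev norm `‖φ‖_{W^{2,1}_p(ℝ^{N+1})}`. -/
def W21Norm (N : ℕ) (p : ℝ) (φ : PSpace N → ℝ) : ℝ :=
  (eLpNorm φ (ENNReal.ofReal p) volume).toReal
    + (eLpNorm (tDeriv φ) (ENNReal.ofReal p) volume).toReal
    + (eLpNorm (gradNorm φ) (ENNReal.ofReal p) volume).toReal
    + ∑ i : Fin N, ∑ j : Fin N, (eLpNorm (xxDeriv i j φ) (ENNReal.ofReal p) volume).toReal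

/-- The capacity `Cap_{2,1,p}` of a compact set `K ⊆ ℝ^{N+1}`. -/
def cap21c (N : ℕ) (p : ℝ) (K : Set (PSpace N)) : ℝ :=
  sInf { c | ∃ φ : SchwartzMap (PSpace N) ℝ,
    (∃ U, IsOpen U ∧ K ⊆ U ∧ ∀ z ∈ U, 1 ≤ φ z) ∧ c = W21Norm N p (fun z => φ z) ^ p }

/-- The capacity `Cap_{2,1,p}` of an arbitrary (Suslin) set. -/
def cap21 (N : ℕ) (p : ℝ) (E : Set (PSpace N)) : ℝ :=
  sSup { c | ∃ D, D ⊆ E ∧ IsCompact D ∧ c = cap21c N p D }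

/-- The parabolic Hausdorff capacity `PH_ρ^N(E)`. -/
def PHcap (N : ℕ) (ρ : ℝ) (E : Set (PSpace N)) : ℝ≥0∞ :=
  ⨅ (c : ℕ → PSpace N × ℝ)
    (_ : (∀ j, 0 ≤ (c j).2 ∧ (c j).2 ≤ ρ) ∧ E ⊆ ⋃ j, pQt N (c j).2 (c j).1),
    ∑' j, ENNReal.ofReal ((c j).2 ^ N)

/-- The truncated Riesz parabolic potential `I_2^R[μ]`. -/
def riesz (N : ℕ) (R : ℝ) (μ : Measure (PSpace N)) (z : PSpace N) : ℝ≥0∞ :=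
  ∫⁻ ρ in Ioo (0 : ℝ) R, μ (pQt N ρ z) / ENNReal.ofReal (ρ ^ (N + 1))

/-- The truncated fractional maximal parabolic potential `M_2^R[μ]`. -/
def maxPot (N : ℕ) (R : ℝ) (μ : Measure (PSpace N)) (z : PSpace N) : ℝ≥0∞ :=
  ⨆ (ρ : ℝ) (_ : ρ ∈ Ioo (0 : ℝ) R), μ (pQt N ρ z) / ENNReal.ofReal (ρ ^ N)

/-- The Gaussian heat kernel on `ℝ^{N+1}`. -/
def heatK (N : ℕ) (z : PSpace N) : ℝ :=
  if 0 < z.2 then (4 * Real.pi * z.2) ^ (-(N : ℝ) / 2) * Real.exp (-‖z.1‖ ^ 2 / (4 * z.2))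
  else 0

/-- The heat potential `(ℍ * μ)(x,t)` of a nonnegative measure. -/
def heatPot (N : ℕ) (μ : Measure (PSpace N)) (z : PSpace N) : ℝ≥0∞ :=
  ∫⁻ w, ENNReal.ofReal (heatK N (z.1 - w.1, z.2 - w.2)) ∂μ

/-- Exponential on `ℝ≥0∞`. -/
def expE (x : ℝ≥0∞) : ℝ≥0∞ := if x = ⊤ then ⊤ else ENNReal.ofReal (Real.exp x.toReal)

/-- Parabolic distance from a point to a set (taken over points at earlier times). -/
def pDist (N : ℕ) (z : PSpace N) (S : Set (PSpace N)) : ℝ :=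
  sInf { r | ∃ w ∈ S, w.2 ≤ z.2 ∧ r = max (dist z.1 w.1) (Real.sqrt (z.2 - w.2)) }

end

section
open Filter Topology
open scoped ContDiff

noncomputable section
namespace HeatPot
variable {N : ℕ}

/-- Smooth functions all of whose derivatives are bounded. -/
structure BddSmooth {X F : Type} [NormedAddCommGroup X] [NormedSpace ℝ X]
    [NormedAddCommGroup F] [NormedSpace ℝ F] (f : X → F) : Prop where
  smooth : ContDiff ℝ ∞ f
  bdd : ∀ k : ℕ, ∃ C, ∀ z, ‖iteratedFDeriv ℝ k f z‖ ≤ C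

section BddSmooth

variable {X F : Type} [NormedAddCommGroup X] [NormedSpace ℝ X]
  [NormedAddCommGroup F] [NormedSpace ℝ F] {f : X → F}

lemma BddSmooth.exists_norm_le (hf : BddSmooth f) : ∃ C, ∀ z, ‖f z‖ ≤ C := by
  simpa using hf.bdd 0

lemma BddSmooth.fderiv (hf : BddSmooth f) : BddSmooth (fderiv ℝ f) := by
  refine ⟨hf.smooth.fderiv_right (by simp), fun k => ?_⟩
  simpa only [norm_iteratedFDeriv_fderiv] using hf.bdd (k + 1)

lemma BddSmooth.continuous (hf : BddSmooth f) : Continuous f := hf.smooth.continuous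

lemma BddSmooth.differentiable (hf : BddSmooth f) : Differentiable ℝ f :=
  hf.smooth.differentiable (by simp)

lemma BddSmooth.fderiv_apply (hf : BddSmooth f) (v : X) :
    BddSmooth (fun z => _root_.fderiv ℝ f z v) := by
  refine ⟨hf.fderiv.smooth.clm_apply contDiff_const, fun k => ?_⟩
  obtain ⟨C, hC⟩ := hf.fderiv.bdd k
  refine ⟨‖v‖ * C, fun z => ?_⟩
  refine (norm_iteratedFDeriv_clm_apply_const (hf.fderiv.smooth.contDiffAt)
    (n := k) (by exact_mod_cast le_top)).trans ?_
  gcongr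
  exact hC z

lemma BddSmooth.add {g : X → F} (hf : BddSmooth f) (hg : BddSmooth g) :
    BddSmooth (fun z => f z + g z) := by
  refine ⟨hf.smooth.add hg.smooth, fun k => ?_⟩
  obtain ⟨C, hC⟩ := hf.bdd k
  obtain ⟨D, hD⟩ := hg.bdd k
  refine ⟨C + D, fun z => ?_⟩
  rw [fun_iteratedFDeriv_add (hf.smooth.of_le (by exact_mod_cast le_top))
    (hg.smooth.of_le (by exact_mod_cast le_top))]
  exact (norm_add_le _ _).trans (add_le_add (hC z) (hD z))

lemma BddSmooth.neg (hf : BddSmooth f) : BddSmooth (fun z => - f z) := by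
  refine ⟨hf.smooth.neg, fun k => ?_⟩
  obtain ⟨C, hC⟩ := hf.bdd k
  refine ⟨C, fun z => ?_⟩
  have : (fun z => - f z) = -f := rfl
  rw [this, iteratedFDeriv_neg_apply, norm_neg]
  exact hC z

lemma BddSmooth.zero : BddSmooth (fun _ : X => (0 : F)) := by
  refine ⟨contDiff_const, fun k => ⟨0, fun z => ?_⟩⟩
  simp

lemma BddSmooth.sum {ι : Type} (s : Finset ι) {g : ι → X → F} (hg : ∀ i ∈ s, BddSmooth (g i)) :
    BddSmooth (fun z => ∑ i ∈ s, g i z) := by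
  classical
  induction s using Finset.induction_on with
  | empty => simpa using BddSmooth.zero
  | insert a s ha ih =>
    simp only [Finset.sum_insert ha]
    exact (hg a (by simp)).add (ih fun i hi => hg i (by simp [hi]))

lemma BddSmooth.of_hasCompactSupport (hf : ContDiff ℝ ∞ f) (hc : HasCompactSupport f) :
    BddSmooth f := by
  refine ⟨hf, fun k => ?_⟩
  have h1 := hf.continuous_iteratedFDeriv (m := k) (by exact_mod_cast le_top)
  exact (hc.iteratedFDeriv k).exists_bound_of_continuous h1

lemma BddSmooth.of_schwartz (φ : SchwartzMap X F) : BddSmooth (fun z => φ z) := by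
  refine ⟨φ.smooth _, fun k => ?_⟩
  obtain ⟨C, hC⟩ := φ.decay' 0 k
  exact ⟨C, fun z => (by simpa using hC z : ‖iteratedFDeriv ℝ k φ.toFun z‖ ≤ C)⟩

end BddSmooth

variable {N : ℕ}

/-- The `i`-th unit spatial direction. -/
def eX (i : Fin N) : PSpace N := (EuclideanSpace.single i 1, 0)

/-- The unit time direction. -/
def eT (N : ℕ) : PSpace N := (0, 1)

/-- Spatial partial derivative of a differentiable function. -/
def dx (i : Fin N) (f : PSpace N → ℝ) (z : PSpace N) : ℝ := fderiv ℝ f z (eX i)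

/-- Time derivative of a differentiable function. -/
def dt (f : PSpace N → ℝ) (z : PSpace N) : ℝ := fderiv ℝ f z (eT N)

/-- The backward heat operator `∂_t + Δ`. -/
def heatL (f : PSpace N → ℝ) (z : PSpace N) : ℝ := dt f z + ∑ i, dx i (dx i f) z

lemma BddSmooth.dx {f : PSpace N → ℝ} (hf : BddSmooth f) (i : Fin N) : BddSmooth (dx i f) :=
  hf.fderiv_apply _

lemma BddSmooth.dt {f : PSpace N → ℝ} (hf : BddSmooth f) : BddSmooth (dt f) :=
  hf.fderiv_apply _

lemma BddSmooth.heatL {f : PSpace N → ℝ} (hf : BddSmooth f) : BddSmooth (heatL f) :=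
  hf.dt.add (BddSmooth.sum _ fun i _ => (hf.dx i).dx i)

/-- The normalizing constant of the Gaussian weight. -/
def gaussC (N : ℕ) : ℝ := (∫ y : EuclideanSpace ℝ (Fin N), Real.exp (-(1 / 2) * ‖y‖ ^ 2))⁻¹

/-- The standard Gaussian density. -/
def gaussD (N : ℕ) (y : EuclideanSpace ℝ (Fin N)) : ℝ :=
  gaussC N * Real.exp (-(1 / 2) * ‖y‖ ^ 2)

/-- The standard Gaussian measure. -/
def gaussM (N : ℕ) : Measure (EuclideanSpace ℝ (Fin N)) :=
  volume.withDensity fun y => ENNReal.ofReal (gaussD N y)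

/-- The exponential distribution. -/
def expM : Measure ℝ :=
  (volume.restrict (Ioi 0)).withDensity fun s => ENNReal.ofReal (Real.exp (-s))

/-- The law of the random parabolic displacement. -/
def potM (N : ℕ) : Measure (EuclideanSpace ℝ (Fin N) × ℝ) := (gaussM N).prod expM

/-- The parabolic displacement. -/
def shift (ξ : EuclideanSpace ℝ (Fin N) × ℝ) : PSpace N := (√(2 * ξ.2) • ξ.1, ξ.2)

/-- The killed backward heat potential `(1 - ∂_t - Δ)⁻¹`. -/
def pot {F : Type} [NormedAddCommGroup F] [NormedSpace ℝ F] (f : PSpace N → F) (z : PSpace N) : F :=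
  ∫ ξ, f (z + shift ξ) ∂(potM N)

lemma integrable_exp_sq :
    Integrable (fun y : EuclideanSpace ℝ (Fin N) => Real.exp (-(1 / 2) * ‖y‖ ^ 2)) := by
  have := GaussianFourier.integrable_cexp_neg_mul_sq_norm_add (V := EuclideanSpace ℝ (Fin N))
    (b := 1/2) (by norm_num) 0 0
  have h2 := this.norm
  refine h2.congr (ae_of_all _ fun y => ?_)
  simp [Complex.norm_exp]
  norm_cast

lemma gaussC_pos (N : ℕ) : 0 < gaussC N := by
  unfold gaussC
  rw [inv_pos]
  exact integral_exp_pos integrable_exp_sq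

lemma gaussD_pos (y : EuclideanSpace ℝ (Fin N)) : 0 < gaussD N y :=
  mul_pos (gaussC_pos N) (Real.exp_pos _)

lemma gaussD_le (y : EuclideanSpace ℝ (Fin N)) : gaussD N y ≤ gaussC N := by
  unfold gaussD
  have : Real.exp (-(1 / 2) * ‖y‖ ^ 2) ≤ 1 := Real.exp_le_one_iff.2 (by nlinarith [sq_nonneg ‖y‖])
  nlinarith [gaussC_pos N]

lemma contDiff_gaussD : ContDiff ℝ ∞ (gaussD N) := by
  unfold gaussD
  exact contDiff_const.mul (contDiff_const.mul (contDiff_norm_sq ℝ)).exp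

lemma integrable_gaussD : Integrable (gaussD N) := integrable_exp_sq.const_mul _

lemma integral_gaussD : ∫ y, gaussD N y = 1 := by
  unfold gaussD
  rw [integral_const_mul]
  exact inv_mul_cancel₀ (integral_exp_pos integrable_exp_sq).ne'

instance : IsProbabilityMeasure (gaussM N) := by
  constructor
  rw [gaussM, withDensity_apply _ MeasurableSet.univ, setLIntegral_univ,
    ← ofReal_integral_eq_lintegral_ofReal integrable_gaussD (ae_of_all _ fun y => (gaussD_pos y).le),
    integral_gaussD, ENNReal.ofReal_one]

instance : IsProbabilityMeasure expM := by
  constructor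
  rw [expM, withDensity_apply _ MeasurableSet.univ, setLIntegral_univ,
    ← ofReal_integral_eq_lintegral_ofReal (integrableOn_exp_neg_Ioi 0)
      (ae_of_all _ fun y => (Real.exp_pos _).le), integral_exp_neg_Ioi_zero, ENNReal.ofReal_one]

instance : IsProbabilityMeasure (potM N) := by unfold potM; infer_instance

lemma continuous_shift : Continuous (shift : EuclideanSpace ℝ (Fin N) × ℝ → PSpace N) := by
  unfold HeatPot.shift; fun_prop

lemma integral_gaussM {F : Type} [NormedAddCommGroup F] [NormedSpace ℝ F]
    (g : EuclideanSpace ℝ (Fin N) → F) : ∫ y, g y ∂(gaussM N) = ∫ y, gaussD N y • g y := by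
  unfold gaussM
  rw [integral_withDensity_eq_integral_toReal_smul
    (contDiff_gaussD.continuous.measurable.ennreal_ofReal) (by simp)]
  simp [ENNReal.toReal_ofReal (gaussD_pos _).le]

lemma integral_expM {F : Type} [NormedAddCommGroup F] [NormedSpace ℝ F]
    (g : ℝ → F) : ∫ s, g s ∂expM = ∫ s in Ioi 0, Real.exp (-s) • g s := by
  unfold expM
  rw [integral_withDensity_eq_integral_toReal_smul (by fun_prop) (by simp)]
  simp [ENNReal.toReal_ofReal (Real.exp_pos _).le]

lemma integrable_of_bdd {Ω F : Type} [TopologicalSpace Ω] [MeasurableSpace Ω] [OpensMeasurableSpace Ω]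
    [NormedAddCommGroup F] [SecondCountableTopologyEither Ω F] {μ : Measure Ω} [IsFiniteMeasure μ] {g : Ω → F}
    (hg : Continuous g) {C : ℝ} (hC : ∀ x, ‖g x‖ ≤ C) : Integrable g μ :=
  Integrable.of_bound hg.aestronglyMeasurable C (ae_of_all _ hC)

lemma BddSmooth.integrable_shift {F : Type} [NormedAddCommGroup F] [NormedSpace ℝ F]
    {f : PSpace N → F} (hf : BddSmooth f) (z : PSpace N) :
    Integrable (fun ξ => f (z + shift ξ)) (potM N) := by
  obtain ⟨C, hC⟩ := hf.exists_norm_le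
  exact integrable_of_bdd (hf.continuous.comp (continuous_const.add continuous_shift))
    (fun ξ => hC _)

lemma hasFDerivAt_pot {F : Type} [NormedAddCommGroup F] [NormedSpace ℝ F]
    {f : PSpace N → F} (hf : BddSmooth f) (z : PSpace N) :
    HasFDerivAt (pot f) (pot (fderiv ℝ f) z) z := by
  obtain ⟨C, hC⟩ := hf.fderiv.exists_norm_le
  refine hasFDerivAt_integral_of_dominated_of_fderiv_le (s := univ) (bound := fun _ => C)
    (F' := fun z ξ => fderiv ℝ f (z + shift ξ)) univ_mem
    (Eventually.of_forall fun w => (hf.integrable_shift w).aestronglyMeasurable)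
    (hf.integrable_shift z) (hf.fderiv.integrable_shift z).aestronglyMeasurable
    (ae_of_all _ fun ξ w _ => hC _) (integrable_const _) (ae_of_all _ fun ξ w _ => ?_)
  have h1 : HasFDerivAt f (fderiv ℝ f (w + shift ξ)) (w + shift ξ) :=
    (hf.differentiable _).hasFDerivAt
  simpa [Function.comp_def] using h1.comp w ((hasFDerivAt_id w).add_const (shift ξ))

lemma norm_pot_le {F : Type} [NormedAddCommGroup F] [NormedSpace ℝ F]
    {f : PSpace N → F} {C : ℝ} (hC : ∀ z, ‖f z‖ ≤ C) (z : PSpace N) : ‖pot f z‖ ≤ C := by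
  have := norm_integral_le_of_norm_le_const (μ := potM N) (f := fun ξ => f (z + shift ξ))
    (ae_of_all _ fun ξ => hC _)
  simpa [pot] using this

lemma fderiv_pot {F : Type} [NormedAddCommGroup F] [NormedSpace ℝ F]
    {f : PSpace N → F} (hf : BddSmooth f) : fderiv ℝ (pot f) = pot (fderiv ℝ f) :=
  funext fun z => (hasFDerivAt_pot hf z).fderiv

lemma contDiff_pot (n : ℕ) : ∀ {F : Type} [NormedAddCommGroup F] [NormedSpace ℝ F]
    {f : PSpace N → F}, BddSmooth f → ContDiff ℝ n (pot f) := by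
  induction n with
  | zero =>
    intro F _ _ f hf
    rw [Nat.cast_zero, contDiff_zero]
    exact continuous_iff_continuousAt.2 fun z => (hasFDerivAt_pot hf z).continuousAt
  | succ n ih =>
    intro F _ _ f hf
    rw [Nat.cast_succ, contDiff_succ_iff_fderiv]
    refine ⟨fun z => (hasFDerivAt_pot hf z).differentiableAt, by simp, ?_⟩
    rw [fderiv_pot hf]
    exact ih hf.fderiv

lemma bdd_pot (n : ℕ) : ∀ {F : Type} [NormedAddCommGroup F] [NormedSpace ℝ F]
    {f : PSpace N → F}, BddSmooth f → ∃ C, ∀ z, ‖iteratedFDeriv ℝ n (pot f) z‖ ≤ C := by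
  induction n with
  | zero =>
    intro F _ _ f hf
    obtain ⟨C, hC⟩ := hf.exists_norm_le
    exact ⟨C, fun z => by simpa using norm_pot_le hC z⟩
  | succ n ih =>
    intro F _ _ f hf
    simp only [← norm_iteratedFDeriv_fderiv]
    rw [fderiv_pot hf]
    exact ih hf.fderiv

lemma BddSmooth.pot {F : Type} [NormedAddCommGroup F] [NormedSpace ℝ F]
    {f : PSpace N → F} (hf : BddSmooth f) : BddSmooth (pot f) :=
  ⟨contDiff_infty.2 fun n => contDiff_pot n hf, fun n => bdd_pot n hf⟩

lemma fderiv_pot_apply {f : PSpace N → ℝ} (hf : BddSmooth f) (z v : PSpace N) :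
    fderiv ℝ (pot f) z v = pot (fun z => fderiv ℝ f z v) z := by
  rw [fderiv_pot hf]
  exact ContinuousLinearMap.integral_apply (hf.fderiv.integrable_shift z) v

lemma dx_pot {f : PSpace N → ℝ} (hf : BddSmooth f) (i : Fin N) : dx i (pot f) = pot (dx i f) :=
  funext fun z => fderiv_pot_apply hf z _

lemma dt_pot {f : PSpace N → ℝ} (hf : BddSmooth f) : dt (pot f) = pot (dt f) :=
  funext fun z => fderiv_pot_apply hf z _

lemma heatL_pot {f : PSpace N → ℝ} (hf : BddSmooth f) : heatL (pot f) = pot (heatL f) := by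
  funext z
  unfold heatL
  rw [dt_pot hf]
  simp_rw [dx_pot hf, dx_pot (hf.dx _)]
  unfold pot
  rw [integral_add (hf.dt.integrable_shift z)
    ((BddSmooth.sum Finset.univ fun i _ => (hf.dx i).dx i).integrable_shift z),
    integral_finsetSum _ fun i _ => ((hf.dx i).dx i).integrable_shift z]

lemma integrable_exp_sq' {b : ℝ} (hb : 0 < b) :
    Integrable (fun y : EuclideanSpace ℝ (Fin N) => Real.exp (-b * ‖y‖ ^ 2)) := by
  have := GaussianFourier.integrable_cexp_neg_mul_sq_norm_add (V := EuclideanSpace ℝ (Fin N))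
    (b := b) (by simpa using hb) 0 0
  refine this.norm.congr (ae_of_all _ fun y => ?_)
  simp [Complex.norm_exp]
  left
  norm_cast

lemma integrable_norm_sq_gaussD :
    Integrable (fun y : EuclideanSpace ℝ (Fin N) => ‖y‖ ^ 2 * gaussD N y) := by
  refine Integrable.mono' ((integrable_exp_sq' (b := 1/4) (by norm_num)).const_mul (4 * gaussC N))
    ((continuous_norm.pow 2).mul contDiff_gaussD.continuous).aestronglyMeasurable
    (ae_of_all _ fun y => ?_)
  have h1 := Real.add_one_le_exp (1 / 4 * ‖y‖ ^ 2)
  have h2 : Real.exp (-(1 / 4) * ‖y‖ ^ 2)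
      = Real.exp (1 / 4 * ‖y‖ ^ 2) * Real.exp (-(1 / 2) * ‖y‖ ^ 2) := by
    rw [← Real.exp_add]; congr 1; ring
  rw [Real.norm_of_nonneg (mul_nonneg (sq_nonneg _) (gaussD_pos y).le), gaussD, h2]
  have h3 : 0 < gaussC N * Real.exp (-(1 / 2) * ‖y‖ ^ 2) := gaussD_pos y
  nlinarith

lemma integrable_norm_sq_gaussM : Integrable (fun y => ‖y‖ ^ 2) (gaussM N) := by
  unfold gaussM
  rw [integrable_withDensity_iff_integrable_smul'
    (contDiff_gaussD.continuous.measurable.ennreal_ofReal) (by simp)]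
  refine integrable_norm_sq_gaussD.congr (ae_of_all _ fun y => ?_)
  simp [ENNReal.toReal_ofReal (gaussD_pos _).le, mul_comm]

lemma integrable_norm_gaussM : Integrable (fun y => ‖y‖) (gaussM N) := by
  refine Integrable.mono' (integrable_norm_sq_gaussM.add (integrable_const 1))
    continuous_norm.aestronglyMeasurable (ae_of_all _ fun y => ?_)
  simp only [norm_norm, Pi.add_apply]
  nlinarith [sq_nonneg (‖y‖ - 1), norm_nonneg y]

lemma fderiv_gaussD (y v : EuclideanSpace ℝ (Fin N)) :
    fderiv ℝ (gaussD N) y v = - inner ℝ y v * gaussD N y := by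
  have h1 : HasFDerivAt (fun y : EuclideanSpace ℝ (Fin N) => ‖y‖ ^ 2) (2 • innerSL ℝ y) y :=
    (hasStrictFDerivAt_norm_sq y).hasFDerivAt
  have h2 := ((h1.const_mul (-(1 / 2))).exp).const_mul (gaussC N)
  have h3 : HasFDerivAt (gaussD N) _ y := h2
  rw [h3.fderiv]
  simp [gaussD]
  ring

lemma integrable_gaussM_iff {g : EuclideanSpace ℝ (Fin N) → ℝ} :
    Integrable g (gaussM N) ↔ Integrable (fun y => gaussD N y * g y) := by
  unfold gaussM
  rw [integrable_withDensity_iff_integrable_smul'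
    (contDiff_gaussD.continuous.measurable.ennreal_ofReal) (by simp)]
  simp [ENNReal.toReal_ofReal (gaussD_pos _).le]

/-- Gaussian integration by parts. -/
lemma stein {g : EuclideanSpace ℝ (Fin N) → ℝ} (hg : ContDiff ℝ 1 g) {C D : ℝ}
    (hC : ∀ y, ‖g y‖ ≤ C) (hD : ∀ y, ‖fderiv ℝ g y‖ ≤ D) (v : EuclideanSpace ℝ (Fin N)) :
    ∫ y, fderiv ℝ g y v ∂(gaussM N) = ∫ y, inner ℝ y v * g y ∂(gaussM N) := by
  have hc : Continuous (fun y => fderiv ℝ g y v) :=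
    (hg.continuous_fderiv (by simp)).clm_apply continuous_const
  have hb : ∀ y, ‖fderiv ℝ g y v‖ ≤ D * ‖v‖ := fun y =>
    (ContinuousLinearMap.le_opNorm _ _).trans (by gcongr; exact hD y)
  have h2 : Integrable (fun y => inner ℝ y v * g y) (gaussM N) := by
    refine Integrable.mono' (integrable_norm_gaussM.const_mul (‖v‖ * C)) ?_ (ae_of_all _ fun y => ?_)
    · exact Continuous.aestronglyMeasurable (by have := hg.continuous; fun_prop)
    · rw [norm_mul]
      calc ‖inner ℝ y v‖ * ‖g y‖ ≤ (‖y‖ * ‖v‖) * C := by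
            gcongr
            · exact norm_inner_le_norm _ _
            · exact hC y
        _ = ‖v‖ * C * ‖y‖ := by ring
  have h3 := integral_mul_fderiv_eq_neg_fderiv_mul_of_integrable (𝕜 := ℝ) (f := gaussD N) (g := g)
    (v := v) (μ := volume) (by
      simp only [fderiv_gaussD]
      refine (integrable_gaussM_iff.1 h2).neg.congr (ae_of_all _ fun y => ?_)
      simp; ring)
    (integrable_gaussM_iff.1 (integrable_of_bdd hc hb))
    (integrable_gaussM_iff.1 (integrable_of_bdd hg.continuous hC))
    (fun y _ => contDiff_gaussD.differentiable (by simp) y)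
    (fun y _ => hg.differentiable (by simp) y)
  rw [integral_gaussM, integral_gaussM]
  simp only [smul_eq_mul]
  rw [h3, ← integral_neg]
  congr 1
  funext y
  rw [fderiv_gaussD]
  ring

lemma smul_prod_eq (c : ℝ) (y : EuclideanSpace ℝ (Fin N)) :
    ((c • y, 0) : PSpace N) = ∑ i, (c * y i) • eX i := by
  refine Prod.ext ?_ ?_
  · simp only [Prod.fst_sum, Prod.smul_fst, eX]
    ext j
    simp [WithLp.ofLp_sum, Finset.sum_apply, Pi.single_apply]
  · simp [Prod.snd_sum, eX]

/-- Gaussian integration by parts for a slice of a bounded smooth function. -/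
lemma stein_slice {f : PSpace N → ℝ} (hf : BddSmooth f) (z : PSpace N) (c s : ℝ) (i : Fin N) :
    c * ∫ y, dx i f (z + (c • y, s)) ∂(gaussM N) = ∫ y, y i * f (z + (c • y, s)) ∂(gaussM N) := by
  obtain ⟨C, hC⟩ := hf.exists_norm_le
  obtain ⟨D, hD⟩ := hf.fderiv.exists_norm_le
  set L : EuclideanSpace ℝ (Fin N) →L[ℝ] PSpace N :=
    c • ContinuousLinearMap.inl ℝ (EuclideanSpace ℝ (Fin N)) ℝ with hL
  have hLy : ∀ y, z + (c • y, s) = (z + (0, s)) + L y := by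
    intro y; ext <;> simp [hL]
  have hder : ∀ y, HasFDerivAt (fun y => f (z + (c • y, s)))
      ((_root_.fderiv ℝ f (z + (c • y, s))).comp L) y := by
    intro y
    have h1 : HasFDerivAt f (_root_.fderiv ℝ f (z + (c • y, s))) ((z + (0, s)) + L y) := by
      rw [← hLy]; exact (hf.differentiable _).hasFDerivAt
    simp only [hLy]
    rw [hLy] at h1
    exact h1.comp y (L.hasFDerivAt.const_add _)
  have := stein (g := fun y => f (z + (c • y, s))) (C := C) (D := D * ‖L‖)
    ((hf.smooth.of_le (by simp)).comp (by fun_prop)) (fun y => hC _) (fun y => by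
      rw [(hder y).fderiv]
      exact (ContinuousLinearMap.opNorm_comp_le _ _).trans (by gcongr; exact hD _))
    (EuclideanSpace.single i 1)
  rw [← integral_const_mul]
  refine (integral_congr_ae (ae_of_all _ fun y => ?_)).trans
    (this.trans (integral_congr_ae (ae_of_all _ fun y => ?_)))
  · beta_reduce
    rw [(hder y).fderiv]
    have : L (EuclideanSpace.single i 1) = c • eX i := by
      ext <;> simp [hL, eX]
    simp [this, dx]
  · simp [EuclideanSpace.inner_single_right]

lemma integrable_slice {f : PSpace N → ℝ} (hf : BddSmooth f) (z : PSpace N) (c s : ℝ) :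
    Integrable (fun y => f (z + (c • y, s))) (gaussM N) := by
  obtain ⟨C, hC⟩ := hf.exists_norm_le
  have := hf.continuous
  exact integrable_of_bdd (by fun_prop) (fun y => hC _)

lemma integrable_shift_slice {f : PSpace N → ℝ} (hf : BddSmooth f) (z : PSpace N) (s : ℝ) :
    Integrable (fun y => f (z + shift (y, s))) (gaussM N) :=
  integrable_slice hf z (√(2 * s)) s

lemma integrable_slice_coord {f : PSpace N → ℝ} (hf : BddSmooth f) (z : PSpace N) (c s : ℝ)
    (i : Fin N) : Integrable (fun y => y i * f (z + (c • y, s))) (gaussM N) := by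
  obtain ⟨C, hC⟩ := hf.exists_norm_le
  have hc := hf.continuous
  refine Integrable.mono' (integrable_norm_gaussM.mul_const C)
    (Continuous.aestronglyMeasurable (by fun_prop)) (ae_of_all _ fun y => ?_)
  rw [norm_mul]
  gcongr
  · exact PiLp.norm_apply_le y i
  · exact hC _

lemma integrable_shift_slice_coord {f : PSpace N → ℝ} (hf : BddSmooth f) (z : PSpace N) (s : ℝ)
    (i : Fin N) : Integrable (fun y => y i * f (z + shift (y, s))) (gaussM N) :=
  integrable_slice_coord hf z (√(2 * s)) s i

set_option maxHeartbeats 1000000 in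
/-- Gaussian averages evolve by the backward heat operator. -/
lemma hasDerivAt_slice {f : PSpace N → ℝ} (hf : BddSmooth f) (z : PSpace N) {s : ℝ} (hs : 0 < s) :
    HasDerivAt (fun s => ∫ y, f (z + shift (y, s)) ∂(gaussM N))
      (∫ y, heatL f (z + shift (y, s)) ∂(gaussM N)) s := by
  obtain ⟨D, hD⟩ := hf.fderiv.exists_norm_le
  have hcf := hf.continuous
  have hcf' := hf.fderiv.continuous
  have hD0 : 0 ≤ D := (norm_nonneg _).trans (hD z)
  have key := hasDerivAt_integral_of_dominated_loc_of_deriv_le (μ := gaussM N) (x₀ := s)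
    (s := Ioi (s / 2)) (F := fun s y => f (z + shift (y, s)))
    (F' := fun s y => fderiv ℝ f (z + shift (y, s)) ((1 / √(2 * s)) • y, 1))
    (bound := fun y => D * (1 / √s * ‖y‖ + 1)) (Ioi_mem_nhds (by linarith))
    (Eventually.of_forall fun s' => (integrable_shift_slice hf z _).aestronglyMeasurable)
    (integrable_shift_slice hf z _)
    (Continuous.aestronglyMeasurable (by
      have : Continuous fun y : EuclideanSpace ℝ (Fin N) => z + shift (y, s) := by
        unfold shift; fun_prop
      exact (hcf'.comp this).clm_apply (by fun_prop)))
    (ae_of_all _ fun y s' hs' => by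
      refine (ContinuousLinearMap.le_opNorm _ _).trans ?_
      have hs'' : s / 2 < s' := hs'
      have h1 : ‖(((1 / √(2 * s')) • y, 1) : PSpace N)‖ ≤ 1 / √s * ‖y‖ + 1 := by
        refine (Prod.norm_def _).le.trans (max_le ?_ ?_)
        · rw [norm_smul, Real.norm_of_nonneg (by positivity)]
          have : √s ≤ √(2 * s') := Real.sqrt_le_sqrt (by linarith)
          have h5 : 0 < √s := Real.sqrt_pos.2 hs
          have : 1 / √(2 * s') * ‖y‖ ≤ 1 / √s * ‖y‖ := by gcongr
          linarith
        · simp only [norm_one]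
          have : 0 ≤ 1 / √s * ‖y‖ := by positivity
          linarith
      exact mul_le_mul (hD _) h1 (norm_nonneg _) hD0)
    (((integrable_norm_gaussM.const_mul _).add (integrable_const _)).const_mul _)
    (ae_of_all _ fun y s' hs' => by
      have hs'' : s / 2 < s' := hs'
      have hs0 : 0 < s' := by linarith
      have h1 : HasDerivAt (fun s => √(2 * s)) (1 / √(2 * s')) s' := by
        have := ((hasDerivAt_id' s').const_mul 2).sqrt (by linarith)
        convert this using 1
        field_simp
      have h2 : HasDerivAt (fun s => z + shift (y, s)) (((1 / √(2 * s')) • y, 1) : PSpace N) s' :=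
        ((h1.smul_const y).prodMk (hasDerivAt_id s')).const_add z
      exact ((hf.differentiable _).hasFDerivAt (x := z + shift (y, s'))).comp_hasDerivAt s' h2)
  refine key.2.congr_deriv ?_
  have hsp : 0 < √(2 * s) := Real.sqrt_pos.2 (by linarith)
  have e1 : ∀ y : EuclideanSpace ℝ (Fin N),
      fderiv ℝ f (z + shift (y, s)) ((1 / √(2 * s)) • y, 1)
      = dt f (z + shift (y, s)) + ∑ i, (1 / √(2 * s)) * (y i * dx i f (z + shift (y, s))) := by
    intro y
    have : (((1 / √(2 * s)) • y, 1) : PSpace N) = eT N + ∑ i, ((1 / √(2 * s)) * y i) • eX i := by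
      rw [← smul_prod_eq]; simp [eT]
    rw [this, map_add, map_sum]
    simp [dt, dx, mul_assoc]
  rw [integral_congr_ae (ae_of_all _ e1)]
  unfold heatL
  symm
  rw [integral_add (integrable_shift_slice hf.dt z _) (integrable_finsetSum _ fun i _ =>
      integrable_shift_slice ((hf.dx i).dx i) z _),
    integral_add (integrable_shift_slice hf.dt z _) (integrable_finsetSum _ fun i _ =>
      ((integrable_shift_slice_coord (hf.dx i) z _ i).const_mul _)),
    integral_finsetSum _ (fun i _ => integrable_shift_slice ((hf.dx i).dx i) z _),
    integral_finsetSum _ (fun i _ => (integrable_shift_slice_coord (hf.dx i) z _ i).const_mul _)]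
  congr 1
  refine Finset.sum_congr rfl fun i _ => ?_
  rw [integral_const_mul]
  have := stein_slice (hf.dx i) z (√(2 * s)) s i
  simp only [shift]
  rw [← this]
  field_simp

lemma pot_eq_iterated {f : PSpace N → ℝ} (hf : BddSmooth f) (z : PSpace N) :
    pot f z = ∫ s in Ioi 0, Real.exp (-s) * ∫ y, f (z + shift (y, s)) ∂(gaussM N) := by
  unfold pot potM
  rw [integral_prod_symm _ (hf.integrable_shift z), integral_expM]
  rfl

set_option maxHeartbeats 1000000 in
/-- The resolvent identity. -/
lemma pot_heatL {f : PSpace N → ℝ} (hf : BddSmooth f) (z : PSpace N) :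
    pot (heatL f) z = pot f z - f z := by
  have hi : ∀ {g : PSpace N → ℝ}, BddSmooth g → IntegrableOn
      (fun s => Real.exp (-s) * ∫ y, g (z + shift (y, s)) ∂(gaussM N)) (Ioi 0) := by
    intro g hg
    obtain ⟨C, hC⟩ := hg.exists_norm_le
    refine Integrable.mono' ((integrableOn_exp_neg_Ioi 0).mul_const C) ?_ (ae_of_all _ fun s => ?_)
    · refine AEStronglyMeasurable.mul (by fun_prop) ?_
      have hc : Continuous (fun p : ℝ × EuclideanSpace ℝ (Fin N) => g (z + shift (p.2, p.1))) := by
        have := hg.continuous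
        unfold shift
        fun_prop
      exact hc.stronglyMeasurable.integral_prod_right'.aestronglyMeasurable
    · rw [norm_mul, Real.norm_of_nonneg (Real.exp_pos _).le]
      gcongr
      have := norm_integral_le_of_norm_le_const (μ := gaussM N)
        (f := fun y => g (z + shift (y, s))) (ae_of_all _ fun _ => hC _)
      simpa using this
  obtain ⟨C, hC⟩ := hf.exists_norm_le
  have hbd : ∀ s, ‖∫ y, f (z + shift (y, s)) ∂(gaussM N)‖ ≤ C := fun s => by
    have := norm_integral_le_of_norm_le_const (μ := gaussM N)
        (f := fun y => f (z + shift (y, s))) (ae_of_all _ fun _ => hC _)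
    simpa using this
  have key := integral_Ioi_of_hasDerivAt_of_tendsto (a := 0) (m := (0 : ℝ))
    (f := fun s => Real.exp (-s) * ∫ y, f (z + shift (y, s)) ∂(gaussM N))
    (f' := fun s => Real.exp (-s) * (∫ y, heatL f (z + shift (y, s)) ∂(gaussM N))
      - Real.exp (-s) * ∫ y, f (z + shift (y, s)) ∂(gaussM N)) ?_ ?_ ?_ ?_
  · rw [integral_sub (hi hf.heatL) (hi hf), ← pot_eq_iterated hf.heatL, ← pot_eq_iterated hf] at key
    have h0 : ∫ y, f (z + shift (y, 0)) ∂(gaussM N) = f z := by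
      have : ∀ y : EuclideanSpace ℝ (Fin N), z + shift (y, 0) = z := fun y => by simp [shift]
      simp [this]
    rw [h0] at key
    simp at key
    linarith
  · refine ContinuousWithinAt.mul (by fun_prop) (Continuous.continuousWithinAt ?_)
    refine continuous_of_dominated (bound := fun _ => C)
      (fun s => (integrable_shift_slice hf z _).aestronglyMeasurable)
      (fun s => ae_of_all _ fun y => hC _) (integrable_const _) (ae_of_all _ fun y => ?_)
    have := hf.continuous
    unfold shift
    fun_prop
  · intro s hs
    have h1 : HasDerivAt (fun s : ℝ => Real.exp (-s)) (-Real.exp (-s)) s := by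
      simpa using (hasDerivAt_neg s).exp
    exact (h1.fun_mul (hasDerivAt_slice hf z hs)).congr_deriv (by ring)
  · exact (hi hf.heatL).sub (hi hf)
  · have h1 : Tendsto (fun s : ℝ => Real.exp (-s) * C) atTop (𝓝 0) := by
      simpa using Real.tendsto_exp_neg_atTop_nhds_zero.mul_const C
    refine squeeze_zero_norm (fun s => ?_) h1
    rw [norm_mul, Real.norm_of_nonneg (Real.exp_pos _).le]
    gcongr
    exact hbd s

lemma heatL_pot_eq {f : PSpace N → ℝ} (hf : BddSmooth f) (z : PSpace N) :
    heatL (pot f) z = pot f z - f z := by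
  rw [heatL_pot hf, pot_heatL hf]

instance : (volume : Measure (PSpace N)).IsAddHaarMeasure :=
  inferInstanceAs
    ((volume : Measure (EuclideanSpace ℝ (Fin N))).prod (volume : Measure ℝ)).IsAddHaarMeasure

lemma pot_nonneg {f : PSpace N → ℝ} (hf : ∀ z, 0 ≤ f z) (z : PSpace N) : 0 ≤ pot f z :=
  integral_nonneg fun _ => hf _

lemma pot_add {f g : PSpace N → ℝ} (hf : BddSmooth f) (hg : BddSmooth g) (z : PSpace N) :
    pot (fun z => f z + g z) z = pot f z + pot g z :=
  integral_add (hf.integrable_shift z) (hg.integrable_shift z)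

lemma lintegral_lintegral_shift {h : PSpace N → ℝ≥0∞} (hh : Measurable h)
    (S : Set (EuclideanSpace ℝ (Fin N) × ℝ)) :
    ∫⁻ z, ∫⁻ ξ in S, h (z + shift ξ) ∂(potM N) = potM N S * ∫⁻ z, h z := by
  rw [lintegral_lintegral_swap]
  · have h1 : ∀ ξ, ∫⁻ z, h (z + shift ξ) = ∫⁻ z, h z :=
      fun ξ => lintegral_add_right_eq_self h (shift ξ)
    simp_rw [h1]
    rw [lintegral_const, Measure.restrict_apply_univ, mul_comm]
  · have := continuous_shift (N := N)
    exact (hh.comp (by fun_prop)).aemeasurable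

lemma integrable_pot {f : PSpace N → ℝ} (hf : BddSmooth f) (hi : Integrable f) :
    Integrable (pot f) := by
  refine ⟨hf.pot.continuous.aestronglyMeasurable, ?_⟩
  calc ∫⁻ z, ‖pot f z‖ₑ ≤ ∫⁻ z, ∫⁻ ξ in univ, ‖f (z + shift ξ)‖ₑ ∂(potM N) := by
        refine lintegral_mono fun z => ?_
        rw [Measure.restrict_univ]
        exact enorm_integral_le_lintegral_enorm _
    _ = ∫⁻ z, ‖f z‖ₑ := by
        rw [lintegral_lintegral_shift hf.continuous.measurable.enorm]; simp
    _ < ⊤ := hi.2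

/-- The second moment of the standard Gaussian. -/
def gaussMom (N : ℕ) : ℝ := ∫ y, ‖y‖ ^ 2 ∂(gaussM N)

lemma lintegral_inv_sqrt {T : ℝ} (hT : 0 ≤ T) :
    ∫⁻ s in Ioi (0 : ℝ), (Iio T).indicator (fun s => ENNReal.ofReal (1 / √(2 * s))) s
      ≤ ENNReal.ofReal √(2 * T) := by
  rw [lintegral_indicator measurableSet_Iio, Measure.restrict_restrict measurableSet_Iio]
  have h1 : IntervalIntegrable (fun s : ℝ => s ^ (-(1 / 2) : ℝ)) volume 0 T :=
    intervalIntegral.intervalIntegrable_rpow' (by norm_num)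
  have h2 : ∀ s ∈ Ioc 0 T, 1 / √(2 * s) = 1 / √2 * s ^ (-(1 / 2) : ℝ) := by
    intro s hs
    rw [Real.sqrt_mul (by norm_num), Real.sqrt_eq_rpow s, Real.rpow_neg hs.1.le]
    field_simp
  have h3 : IntegrableOn (fun s => 1 / √2 * s ^ (-(1 / 2) : ℝ)) (Ioc 0 T) :=
    ((intervalIntegrable_iff_integrableOn_Ioc_of_le hT).1 h1).const_mul _
  calc ∫⁻ s in Iio T ∩ Ioi 0, ENNReal.ofReal (1 / √(2 * s))
      ≤ ∫⁻ s in Ioc 0 T, ENNReal.ofReal (1 / √(2 * s)) :=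
        lintegral_mono_set fun s hs => ⟨hs.2, le_of_lt hs.1⟩
    _ = ∫⁻ s in Ioc 0 T, ENNReal.ofReal (1 / √2 * s ^ (-(1 / 2) : ℝ)) :=
        setLIntegral_congr_fun measurableSet_Ioc fun s hs => by rw [h2 s hs]
    _ = ENNReal.ofReal (∫ s in Ioc 0 T, 1 / √2 * s ^ (-(1 / 2) : ℝ)) := by
        rw [ofReal_integral_eq_lintegral_ofReal h3]
        refine (ae_restrict_iff' measurableSet_Ioc).2 (ae_of_all _ fun s hs => ?_)
        have := Real.rpow_nonneg hs.1.le (-(1 / 2))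
        positivity
    _ ≤ _ := by
        refine ENNReal.ofReal_le_ofReal (le_of_eq ?_)
        rw [← intervalIntegral.integral_of_le hT, intervalIntegral.integral_const_mul,
          integral_rpow (Or.inl (by norm_num)), Real.sqrt_mul (by norm_num), Real.sqrt_eq_rpow T]
        have h5 : √2 * √2 = 2 := Real.mul_self_sqrt (by norm_num)
        have h6 : √2 ≠ 0 := by positivity
        norm_num
        field_simp
        rw [Real.sq_sqrt (by norm_num)]

/-- Pointwise gradient bound for potentials of bounded densities. -/
lemma abs_dx_pot_le {f : PSpace N → ℝ} (hf : BddSmooth f) {lam : ℝ} (hl : 0 < lam)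
    (h0 : ∀ z, 0 ≤ f z) (h1 : ∀ z, f z ≤ lam) (i : Fin N) (z : PSpace N) :
    |dx i (pot f) z| ≤ √lam * (pot f z + gaussMom N) := by
  have hM : 0 ≤ gaussMom N := integral_nonneg fun y => by positivity
  have hV := pot_nonneg h0 z
  rw [dx_pot hf, pot_eq_iterated (hf.dx i)]
  have hfc := hf.continuous
  set m : ℝ → ℝ := fun s => ∫ y, f (z + shift (y, s)) ∂(gaussM N) with hm
  set h : EuclideanSpace ℝ (Fin N) → ℝ → ℝ≥0∞ := fun y s =>
    ENNReal.ofReal (lam * ‖y‖) *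
      (Iio (‖y‖ ^ 2 / (2 * lam))).indicator (fun s => ENNReal.ofReal (1 / √(2 * s))) s with hh
  have hmeas : Measurable (Function.uncurry h) := by
    refine Measurable.mul (by fun_prop) ?_
    have : (fun a : EuclideanSpace ℝ (Fin N) × ℝ =>
        (Iio (‖a.1‖ ^ 2 / (2 * lam))).indicator (fun s => ENNReal.ofReal (1 / √(2 * s))) a.2) =
        {a : EuclideanSpace ℝ (Fin N) × ℝ | a.2 < ‖a.1‖ ^ 2 / (2 * lam)}.indicator
          (fun a => ENNReal.ofReal (1 / √(2 * a.2))) := by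
      funext a; simp [indicator]
    rw [this]
    exact Measurable.indicator (by fun_prop) (measurableSet_lt (by fun_prop) (by fun_prop))
  have hsl : 0 < √lam := Real.sqrt_pos.2 hl
  have hsq : √lam * √lam = lam := Real.mul_self_sqrt hl.le
  have step : ∀ s ∈ Ioi (0 : ℝ),
      ‖Real.exp (-s) * ∫ y, dx i f (z + shift (y, s)) ∂(gaussM N)‖ₑ
      ≤ ENNReal.ofReal (√lam * (Real.exp (-s) * m s)) + ∫⁻ y, h y s ∂(gaussM N) := by
    intro s hs
    have hs : 0 < s := hs
    have hr : 0 < √(2 * s) := Real.sqrt_pos.2 (by linarith)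
    have e1 : ∫ y, dx i f (z + shift (y, s)) ∂(gaussM N)
        = ∫ y, (1 / √(2 * s)) * (y i * f (z + shift (y, s))) ∂(gaussM N) := by
      rw [integral_const_mul]
      have := stein_slice hf z (√(2 * s)) s i
      simp only [shift]
      rw [← this]
      field_simp
    have hE : Real.exp (-s) ≤ 1 := Real.exp_le_one_iff.2 (by linarith)
    calc ‖Real.exp (-s) * ∫ y, dx i f (z + shift (y, s)) ∂(gaussM N)‖ₑ
        = ‖∫ y, Real.exp (-s) * ((1 / √(2 * s)) * (y i * f (z + shift (y, s)))) ∂(gaussM N)‖ₑ := by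
          rw [e1, ← integral_const_mul]
      _ ≤ ∫⁻ y, ‖Real.exp (-s) * ((1 / √(2 * s)) * (y i * f (z + shift (y, s))))‖ₑ ∂(gaussM N) :=
          enorm_integral_le_lintegral_enorm _
      _ ≤ ∫⁻ y, (ENNReal.ofReal (√lam * Real.exp (-s) * f (z + shift (y, s))) + h y s)
            ∂(gaussM N) := by
          refine lintegral_mono fun y => ?_
          set F := f (z + shift (y, s)) with hF
          have hF0 : 0 ≤ F := h0 _
          have hF1 : F ≤ lam := h1 _
          have hy : |y i| ≤ ‖y‖ := PiLp.norm_apply_le y i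
          have b1 : |Real.exp (-s) * ((1 / √(2 * s)) * (y i * F))|
              ≤ Real.exp (-s) * (1 / √(2 * s) * (‖y‖ * F)) := by
            rw [abs_mul, abs_mul, abs_mul, abs_of_nonneg hF0, abs_of_pos (Real.exp_pos _),
              abs_of_pos (by positivity : 0 < 1 / √(2 * s))]
            gcongr
          rw [← ofReal_norm, Real.norm_eq_abs]
          refine (ENNReal.ofReal_le_ofReal b1).trans ?_
          by_cases hc : s < ‖y‖ ^ 2 / (2 * lam)
          · refine le_add_left ?_
            simp only [hh, indicator, mem_Iio, hc, if_true]
            rw [← ENNReal.ofReal_mul (by positivity)]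
            refine ENNReal.ofReal_le_ofReal ?_
            calc Real.exp (-s) * (1 / √(2 * s) * (‖y‖ * F)) ≤ 1 * (1 / √(2 * s) * (‖y‖ * lam)) := by
                  gcongr
              _ = _ := by ring
          · refine le_add_right (ENNReal.ofReal_le_ofReal ?_)
            have h2 : ‖y‖ ≤ √lam * √(2 * s) := by
              rw [← Real.sqrt_mul hl.le]
              refine Real.le_sqrt_of_sq_le ?_
              rw [not_lt, div_le_iff₀ (by positivity)] at hc
              linarith
            calc Real.exp (-s) * (1 / √(2 * s) * (‖y‖ * F))
                ≤ Real.exp (-s) * (1 / √(2 * s) * ((√lam * √(2 * s)) * F)) := by gcongr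
              _ = _ := by field_simp
      _ = ENNReal.ofReal (√lam * (Real.exp (-s) * m s)) + ∫⁻ y, h y s ∂(gaussM N) := by
          rw [lintegral_add_left (by unfold shift; fun_prop)]
          congr 1
          rw [← ofReal_integral_eq_lintegral_ofReal
            ((integrable_shift_slice hf z s).const_mul _) (ae_of_all _ fun y => by
              have := h0 (z + shift (y, s)); simp only [Pi.zero_apply]; positivity),
            integral_const_mul, mul_assoc]
  have hInt : IntegrableOn (fun s => Real.exp (-s) * m s) (Ioi 0) := by
    refine Integrable.mono' ((integrableOn_exp_neg_Ioi 0).mul_const lam) ?_ (ae_of_all _ fun s => ?_)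
    · refine AEStronglyMeasurable.mul (by fun_prop) ?_
      have hc : Continuous (fun p : ℝ × EuclideanSpace ℝ (Fin N) => f (z + shift (p.2, p.1))) := by
        unfold shift
        fun_prop
      exact hc.stronglyMeasurable.integral_prod_right'.aestronglyMeasurable
    · rw [norm_mul, Real.norm_of_nonneg (Real.exp_pos _).le]
      gcongr
      have := norm_integral_le_of_norm_le_const (μ := gaussM N) (C := lam)
        (f := fun y => f (z + shift (y, s))) (ae_of_all _ fun _ => by
          rw [Real.norm_of_nonneg (h0 _)]; exact h1 _)
      simpa using this
  have fin : ‖∫ s in Ioi 0, Real.exp (-s) * ∫ y, dx i f (z + shift (y, s)) ∂(gaussM N)‖ₑ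
      ≤ ENNReal.ofReal (√lam * (pot f z + gaussMom N)) := by
    refine (enorm_integral_le_lintegral_enorm _).trans ?_
    refine (setLIntegral_mono' measurableSet_Ioi step).trans ?_
    rw [lintegral_add_right (g := fun s => ∫⁻ y, h y s ∂(gaussM N)) _
      (Measurable.lintegral_prod_left' hmeas), mul_add,
      ENNReal.ofReal_add (by positivity) (by positivity)]
    refine add_le_add (le_of_eq ?_) ?_
    · rw [pot_eq_iterated hf, ← integral_const_mul,
        ofReal_integral_eq_lintegral_ofReal (hInt.const_mul _) (ae_of_all _ fun s => ?_)]
      have : 0 ≤ m s := integral_nonneg fun _ => h0 _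
      simp only [Pi.zero_apply]; positivity
    · rw [lintegral_lintegral_swap (f := fun s y => h y s) (hmeas.comp measurable_swap).aemeasurable]
      calc ∫⁻ y, (∫⁻ s in Ioi (0 : ℝ), h y s) ∂(gaussM N)
          ≤ ∫⁻ y, ENNReal.ofReal (√lam * ‖y‖ ^ 2) ∂(gaussM N) := by
            refine lintegral_mono fun y => ?_
            simp only [hh]
            rw [lintegral_const_mul' _ _ ENNReal.ofReal_ne_top]
            refine (mul_le_mul_right (lintegral_inv_sqrt (by positivity)) _).trans ?_
            rw [← ENNReal.ofReal_mul (by positivity)]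
            refine ENNReal.ofReal_le_ofReal (le_of_eq ?_)
            have : 2 * (‖y‖ ^ 2 / (2 * lam)) = ‖y‖ ^ 2 / lam := by field_simp
            rw [this, Real.sqrt_div (by positivity), Real.sqrt_sq (norm_nonneg _)]
            field_simp
            nlinarith
        _ = ENNReal.ofReal (√lam * gaussMom N) := by
            rw [← ofReal_integral_eq_lintegral_ofReal (integrable_norm_sq_gaussM.const_mul _)
              (ae_of_all _ fun y => by simp only [Pi.zero_apply]; positivity), integral_const_mul]
            rfl
  rw [← ofReal_norm, Real.norm_eq_abs] at fin
  exact (ENNReal.ofReal_le_ofReal_iff (by positivity)).1 fin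

/-- The squared norm of the spatial gradient. -/
def gsq (f : PSpace N → ℝ) (z : PSpace N) : ℝ := ∑ i, dx i f z ^ 2

lemma gsq_nonneg (f : PSpace N → ℝ) (z : PSpace N) : 0 ≤ gsq f z :=
  Finset.sum_nonneg fun _ _ => sq_nonneg _

lemma contDiff_fderiv_apply {f : PSpace N → ℝ} (hf : ContDiff ℝ ∞ f) (v : PSpace N) :
    ContDiff ℝ ∞ (fun z => fderiv ℝ f z v) :=
  (hf.fderiv_right (by simp)).clm_apply contDiff_const

lemma contDiff_dx {f : PSpace N → ℝ} (hf : ContDiff ℝ ∞ f) (i : Fin N) :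
    ContDiff ℝ ∞ (dx i f) := contDiff_fderiv_apply hf _

lemma contDiff_dt {f : PSpace N → ℝ} (hf : ContDiff ℝ ∞ f) :
    ContDiff ℝ ∞ (dt f) := contDiff_fderiv_apply hf _

lemma contDiff_heatL {f : PSpace N → ℝ} (hf : ContDiff ℝ ∞ f) : ContDiff ℝ ∞ (heatL f) :=
  (contDiff_dt hf).add (ContDiff.sum fun i _ => contDiff_dx (contDiff_dx hf i) i)

lemma contDiff_gsq {f : PSpace N → ℝ} (hf : ContDiff ℝ ∞ f) : ContDiff ℝ ∞ (gsq f) :=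
  ContDiff.sum fun i _ => (contDiff_dx hf i).pow 2

lemma differentiable_of_contDiff {X : Type*} [NormedAddCommGroup X] [NormedSpace ℝ X]
    {f : X → ℝ} (hf : ContDiff ℝ ∞ f) : Differentiable ℝ f := hf.differentiable (by simp)

lemma contDiff_deriv {H : ℝ → ℝ} (hH : ContDiff ℝ ∞ H) : ContDiff ℝ ∞ (deriv H) :=
  (contDiff_infty_iff_deriv.1 hH).2

lemma fderiv_comp_apply {H : ℝ → ℝ} (hH : ContDiff ℝ ∞ H) {f : PSpace N → ℝ}
    (hf : ContDiff ℝ ∞ f) (z v : PSpace N) :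
    fderiv ℝ (fun z => H (f z)) z v = deriv H (f z) * fderiv ℝ f z v := by
  have h1 : HasDerivAt H (deriv H (f z)) (f z) :=
    (differentiable_of_contDiff hH _).hasDerivAt
  have h2 := h1.comp_hasFDerivAt z (differentiable_of_contDiff hf z).hasFDerivAt
  have h3 : HasFDerivAt (fun z => H (f z)) _ z := h2
  rw [h3.fderiv]
  simp

lemma fderiv_mul_apply {f g : PSpace N → ℝ} (hf : ContDiff ℝ ∞ f) (hg : ContDiff ℝ ∞ g)
    (z v : PSpace N) :
    fderiv ℝ (fun z => f z * g z) z v = f z * fderiv ℝ g z v + g z * fderiv ℝ f z v := by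
  rw [fderiv_fun_mul (differentiable_of_contDiff hf z) (differentiable_of_contDiff hg z)]
  simp

lemma fderiv_add_apply {f g : PSpace N → ℝ} (hf : ContDiff ℝ ∞ f) (hg : ContDiff ℝ ∞ g)
    (z v : PSpace N) :
    fderiv ℝ (fun z => f z + g z) z v = fderiv ℝ f z v + fderiv ℝ g z v := by
  rw [fderiv_fun_add (differentiable_of_contDiff hf z) (differentiable_of_contDiff hg z)]
  simp

lemma dx_add {f g : PSpace N → ℝ} (hf : ContDiff ℝ ∞ f) (hg : ContDiff ℝ ∞ g) (i : Fin N) :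
    dx i (fun z => f z + g z) = fun z => dx i f z + dx i g z :=
  funext fun z => fderiv_add_apply hf hg z _

lemma dx_mul {f g : PSpace N → ℝ} (hf : ContDiff ℝ ∞ f) (hg : ContDiff ℝ ∞ g) (i : Fin N) :
    dx i (fun z => f z * g z) = fun z => f z * dx i g z + g z * dx i f z :=
  funext fun z => fderiv_mul_apply hf hg z _

lemma dx_comp {H : ℝ → ℝ} (hH : ContDiff ℝ ∞ H) {f : PSpace N → ℝ}
    (hf : ContDiff ℝ ∞ f) (i : Fin N) :
    dx i (fun z => H (f z)) = fun z => deriv H (f z) * dx i f z :=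
  funext fun z => fderiv_comp_apply hH hf z _

lemma heatL_add {f g : PSpace N → ℝ} (hf : ContDiff ℝ ∞ f) (hg : ContDiff ℝ ∞ g) (z : PSpace N) :
    heatL (fun z => f z + g z) z = heatL f z + heatL g z := by
  have h1 : dt (fun z => f z + g z) z = dt f z + dt g z := fderiv_add_apply hf hg z _
  simp only [heatL, dx_add hf hg, dx_add (contDiff_dx hf _) (contDiff_dx hg _), h1,
    Finset.sum_add_distrib]
  ring

lemma heatL_mul {f g : PSpace N → ℝ} (hf : ContDiff ℝ ∞ f) (hg : ContDiff ℝ ∞ g) (z : PSpace N) :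
    heatL (fun z => f z * g z) z
      = f z * heatL g z + g z * heatL f z + 2 * ∑ i, dx i f z * dx i g z := by
  have h1 : dt (fun z => f z * g z) z = f z * dt g z + g z * dt f z := fderiv_mul_apply hf hg z _
  have h2 : ∀ i, dx i (dx i (fun z => f z * g z)) z
      = f z * dx i (dx i g) z + g z * dx i (dx i f) z + 2 * (dx i f z * dx i g z) := by
    intro i
    rw [dx_mul hf hg, dx_add (hf.mul (contDiff_dx hg i)) (hg.mul (contDiff_dx hf i)),
      dx_mul hf (contDiff_dx hg i), dx_mul hg (contDiff_dx hf i)]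
    ring
  simp only [heatL, h1, h2, Finset.sum_add_distrib, ← Finset.mul_sum]
  ring

lemma heatL_comp {H : ℝ → ℝ} (hH : ContDiff ℝ ∞ H) {f : PSpace N → ℝ}
    (hf : ContDiff ℝ ∞ f) (z : PSpace N) :
    heatL (fun z => H (f z)) z
      = deriv H (f z) * heatL f z + deriv (deriv H) (f z) * gsq f z := by
  have hH' : ContDiff ℝ ∞ (fun z => deriv H (f z)) := (contDiff_deriv hH).comp hf
  have h1 : dt (fun z => H (f z)) z = deriv H (f z) * dt f z := fderiv_comp_apply hH hf z _
  have h2 : ∀ i, dx i (dx i (fun z => H (f z))) z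
      = deriv H (f z) * dx i (dx i f) z + deriv (deriv H) (f z) * dx i f z ^ 2 := by
    intro i
    rw [dx_comp hH hf, dx_mul hH' (contDiff_dx hf i), dx_comp (contDiff_deriv hH) hf]
    ring
  simp only [heatL, gsq, h1, h2, Finset.sum_add_distrib, ← Finset.mul_sum]
  ring

lemma integral_fderiv_eq_zero {F : PSpace N → ℝ} (hF : Differentiable ℝ F) (hi : Integrable F)
    (v : PSpace N) (hv : Integrable (fun z => fderiv ℝ F z v)) : ∫ z, fderiv ℝ F z v = 0 := by
  have := integral_mul_fderiv_eq_neg_fderiv_mul_of_integrable (𝕜 := ℝ) (f := fun _ => 1) (g := F)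
    (v := v) (μ := (volume : Measure (PSpace N))) (by simp) (by simpa using hv) (by simpa using hi)
    (by simp) (fun x _ => hF x)
  simpa using this

lemma integral_heatL_eq_zero {F : PSpace N → ℝ} (hF : ContDiff ℝ ∞ F) (hi : Integrable F)
    (ht : Integrable (dt F)) (hx : ∀ i, Integrable (dx i F))
    (hxx : ∀ i, Integrable (dx i (dx i F))) : ∫ z, heatL F z = 0 := by
  unfold heatL
  rw [integral_add ht (integrable_finsetSum _ fun i _ => hxx i),
    integral_finsetSum _ fun i _ => hxx i]
  have h1 : ∫ z, dt F z = 0 := integral_fderiv_eq_zero (differentiable_of_contDiff hF) hi _ ht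
  have h2 : ∀ i, ∫ z, dx i (dx i F) z = 0 := fun i =>
    integral_fderiv_eq_zero (differentiable_of_contDiff (contDiff_dx hF i)) (hx i) _ (hxx i)
  simp [h1, h2]

lemma integrable_of_hasCompactSupport {f : PSpace N → ℝ} (hf : ContDiff ℝ ∞ f)
    (hc : HasCompactSupport f) : Integrable f := hf.continuous.integrable_of_hasCompactSupport hc

lemma hasCompactSupport_dx {f : PSpace N → ℝ} (hc : HasCompactSupport f) (i : Fin N) :
    HasCompactSupport (dx i f) := hc.fderiv_apply ℝ (eX i)

lemma hasCompactSupport_dt {f : PSpace N → ℝ} (hc : HasCompactSupport f) :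
    HasCompactSupport (dt f) := hc.fderiv_apply ℝ (eT N)

/-- A smooth convex truncation of `s²`. -/
def softAbs (s : ℝ) : ℝ := √(1 + s ^ 2) - 1

lemma contDiff_softAbs : ContDiff ℝ ∞ softAbs := by
  unfold softAbs
  exact ((contDiff_const.add (contDiff_id.pow 2)).sqrt fun s => by simp; positivity).sub
    contDiff_const

lemma deriv_softAbs : deriv softAbs = fun s => s / √(1 + s ^ 2) := by
  funext s
  have h1 : HasDerivAt (fun s : ℝ => 1 + s ^ 2) (2 * s) s := by
    simpa using ((hasDerivAt_id' s).pow 2).const_add 1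
  have h2 := (h1.sqrt (by positivity)).sub_const 1
  have h3 : HasDerivAt softAbs _ s := h2
  rw [h3.deriv]
  field_simp

lemma deriv_deriv_softAbs (s : ℝ) : deriv (deriv softAbs) s = 1 / (√(1 + s ^ 2) * (1 + s ^ 2)) := by
  rw [deriv_softAbs]
  have h1 : HasDerivAt (fun s : ℝ => 1 + s ^ 2) (2 * s) s := by
    simpa using ((hasDerivAt_id' s).pow 2).const_add 1
  have hp : 0 < 1 + s ^ 2 := by positivity
  have hq : 0 < √(1 + s ^ 2) := Real.sqrt_pos.2 hp
  have hs : √(1 + s ^ 2) ^ 2 = 1 + s ^ 2 := Real.sq_sqrt hp.le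
  have h2 := (hasDerivAt_id' s).fun_div (h1.sqrt hp.ne') hq.ne'
  rw [h2.deriv, hs]
  field_simp
  rw [hs]
  ring

lemma softAbs_nonneg (s : ℝ) : 0 ≤ softAbs s := by
  unfold softAbs
  have : 1 ≤ √(1 + s ^ 2) := Real.one_le_sqrt.2 (by nlinarith [sq_nonneg s])
  linarith

lemma softAbs_le (s : ℝ) : softAbs s ≤ |s| := by
  unfold softAbs
  have : √(1 + s ^ 2) ≤ 1 + |s| := by
    refine Real.sqrt_le_iff.2 ⟨by positivity, ?_⟩
    nlinarith [abs_nonneg s, sq_abs s]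
  linarith

lemma abs_deriv_softAbs_le (s : ℝ) : |deriv softAbs s| ≤ 1 := by
  rw [deriv_softAbs]
  have hq : 0 < √(1 + s ^ 2) := Real.sqrt_pos.2 (by positivity)
  rw [abs_div, abs_of_pos hq, div_le_one hq]
  exact Real.abs_le_sqrt (by linarith)

/-- The energy estimate, in weak form. -/
lemma energy {f : PSpace N → ℝ} (hf : ContDiff ℝ ∞ f) (hc : HasCompactSupport f)
    (h0 : ∀ z, 0 ≤ f z) (i : Fin N) {c : ℝ} (hc0 : 0 < c) :
    ENNReal.ofReal (c ^ 2 / 4) * volume {z | pot f z < 1 ∧ c < |dx i (pot f) z|}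
      ≤ ∫⁻ z, ENNReal.ofReal (f z) := by
  have hb : BddSmooth f := .of_hasCompactSupport hf hc
  set V := pot f with hV
  have hVb : BddSmooth V := hb.pot
  have hV0 : ∀ z, 0 ≤ V z := pot_nonneg h0
  have iV : Integrable V := integrable_pot hb (integrable_of_hasCompactSupport hf hc)
  have iVt : Integrable (dt V) := by
    rw [hV, dt_pot hb]
    exact integrable_pot hb.dt (integrable_of_hasCompactSupport hb.dt.smooth
      (hasCompactSupport_dt hc))
  have iVx : ∀ i, Integrable (dx i V) := fun i => by
    rw [hV, dx_pot hb]
    exact integrable_pot (hb.dx i) (integrable_of_hasCompactSupport (hb.dx i).smooth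
      (hasCompactSupport_dx hc i))
  have iVxx : ∀ i, Integrable (dx i (dx i V)) := fun i => by
    rw [hV, dx_pot hb, dx_pot (hb.dx i)]
    exact integrable_pot ((hb.dx i).dx i) (integrable_of_hasCompactSupport ((hb.dx i).dx i).smooth
      (hasCompactSupport_dx (hasCompactSupport_dx hc i) i))
  have cT : Continuous (fun z => deriv softAbs (V z)) :=
    (contDiff_deriv contDiff_softAbs).continuous.comp hVb.continuous
  have cT' : Continuous (fun z => deriv (deriv softAbs) (V z)) :=
    (contDiff_deriv (contDiff_deriv contDiff_softAbs)).continuous.comp hVb.continuous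
  have mulT : ∀ {g : PSpace N → ℝ}, Integrable g →
      Integrable (fun z => deriv softAbs (V z) * g z) := fun {g} hg =>
    hg.bdd_mul (c := 1) cT.aestronglyMeasurable (ae_of_all _ fun z => abs_deriv_softAbs_le _)
  have hT'0 : ∀ s, 0 ≤ deriv (deriv softAbs) s := fun s => by
    rw [deriv_deriv_softAbs]; positivity
  have hT'1 : ∀ s, deriv (deriv softAbs) s ≤ 1 := fun s => by
    rw [deriv_deriv_softAbs]
    have h1 : 1 ≤ √(1 + s ^ 2) := Real.one_le_sqrt.2 (by nlinarith [sq_nonneg s])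
    rw [div_le_one (by positivity)]
    nlinarith [sq_nonneg s]
  have igrad : ∀ i, Integrable (fun z => deriv (deriv softAbs) (V z) * dx i V z ^ 2) := fun i => by
    obtain ⟨D, hD⟩ := (hVb.dx i).exists_norm_le
    have h1 : Integrable (fun z => dx i V z ^ 2) := by
      have := (iVx i).bdd_mul (c := D) (hVb.dx i).continuous.aestronglyMeasurable
        (ae_of_all _ fun z => hD z)
      simpa [sq] using this
    exact h1.bdd_mul (c := 1) cT'.aestronglyMeasurable (ae_of_all _ fun z => by
      rw [Real.norm_of_nonneg (hT'0 _)]; exact hT'1 _)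
  have hcomp := fun z => heatL_comp contDiff_softAbs hVb.smooth z
  have hΦ : ContDiff ℝ ∞ (fun z => softAbs (V z)) := contDiff_softAbs.comp hVb.smooth
  have hzero : ∫ z, heatL (fun z => softAbs (V z)) z = 0 := by
    refine integral_heatL_eq_zero hΦ ?_ ?_ (fun i => ?_) (fun i => ?_)
    · refine iV.mono' hΦ.continuous.aestronglyMeasurable (ae_of_all _ fun z => ?_)
      rw [Real.norm_of_nonneg (softAbs_nonneg _)]
      exact (softAbs_le _).trans (abs_of_nonneg (hV0 z)).le
    · have : dt (fun z => softAbs (V z)) = fun z => deriv softAbs (V z) * dt V z :=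
        funext fun z => fderiv_comp_apply contDiff_softAbs hVb.smooth z _
      rw [this]
      exact mulT iVt
    · rw [dx_comp contDiff_softAbs hVb.smooth]
      exact mulT (iVx i)
    · rw [dx_comp contDiff_softAbs hVb.smooth,
        dx_mul (f := fun z => deriv softAbs (V z))
          ((contDiff_deriv contDiff_softAbs).comp hVb.smooth) (contDiff_dx hVb.smooth i),
        dx_comp (contDiff_deriv contDiff_softAbs) hVb.smooth]
      refine (mulT (iVxx i)).add ((igrad i).congr (ae_of_all _ fun z => ?_))
      simp only []
      ring
  have ifn : Integrable f := integrable_of_hasCompactSupport hf hc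
  have igsq : Integrable (fun z => deriv (deriv softAbs) (V z) * gsq V z) := by
    simp only [gsq, Finset.mul_sum]
    exact integrable_finsetSum _ fun i _ => igrad i
  have hle : ∫ z, deriv (deriv softAbs) (V z) * gsq V z ≤ ∫ z, f z := by
    have e1 : ∀ z, heatL (fun z => softAbs (V z)) z
        = deriv softAbs (V z) * (V z - f z) + deriv (deriv softAbs) (V z) * gsq V z := fun z => by
      rw [hcomp, hV, heatL_pot_eq hb]
    simp_rw [e1] at hzero
    rw [integral_add (mulT (g := fun z => V z - f z) (iV.sub ifn)) igsq] at hzero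
    have : -∫ z, f z ≤ ∫ z, deriv softAbs (V z) * (V z - f z) := by
      rw [← integral_neg]
      refine integral_mono ifn.neg (mulT (g := fun z => V z - f z) (iV.sub ifn)) fun z => ?_
      have h1 := abs_le.1 (abs_deriv_softAbs_le (V z))
      have h2 : 0 ≤ deriv softAbs (V z) := by
        rw [deriv_softAbs]; have := hV0 z; positivity
      have h3 := hV0 z
      have h4 := h0 z
      nlinarith [mul_nonneg h2 h3]
    linarith
  have hsub : {z | V z < 1 ∧ c < |dx i V z|}
      ⊆ {z | ENNReal.ofReal (c ^ 2 / 4)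
          ≤ ENNReal.ofReal (deriv (deriv softAbs) (V z) * gsq V z)} := by
    rintro z ⟨h1, h2⟩
    refine ENNReal.ofReal_le_ofReal ?_
    have h3 : c ^ 2 ≤ gsq V z := by
      calc c ^ 2 ≤ |dx i V z| ^ 2 := by gcongr
        _ = dx i V z ^ 2 := sq_abs _
        _ ≤ gsq V z := Finset.single_le_sum (f := fun i => dx i V z ^ 2)
            (fun _ _ => sq_nonneg _) (Finset.mem_univ i)
    have h4 : 1 / 4 ≤ deriv (deriv softAbs) (V z) := by
      rw [deriv_deriv_softAbs]
      have hv := hV0 z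
      have h5 : 1 + V z ^ 2 ≤ 2 := by nlinarith
      have h6 : √(1 + V z ^ 2) ≤ 2 := Real.sqrt_le_iff.2 ⟨by norm_num, by linarith⟩
      have h7 : 0 < √(1 + V z ^ 2) := by positivity
      refine one_div_le_one_div_of_le (by positivity) ?_
      nlinarith
    nlinarith [sq_nonneg c]
  calc _ ≤ ENNReal.ofReal (c ^ 2 / 4) * volume {z | ENNReal.ofReal (c ^ 2 / 4)
          ≤ ENNReal.ofReal (deriv (deriv softAbs) (V z) * gsq V z)} := by gcongr
    _ ≤ ∫⁻ z, ENNReal.ofReal (deriv (deriv softAbs) (V z) * gsq V z) :=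
        mul_meas_ge_le_lintegral₀ igsq.aestronglyMeasurable.aemeasurable.ennreal_ofReal _
    _ = ENNReal.ofReal (∫ z, deriv (deriv softAbs) (V z) * gsq V z) :=
        (ofReal_integral_eq_lintegral_ofReal igsq (ae_of_all _ fun z =>
          mul_nonneg (hT'0 _) (gsq_nonneg _ _))).symm
    _ ≤ ENNReal.ofReal (∫ z, f z) := ENNReal.ofReal_le_ofReal hle
    _ = _ := ofReal_integral_eq_lintegral_ofReal ifn (ae_of_all _ h0)

lemma gaussMom_nonneg : 0 ≤ gaussMom N := integral_nonneg fun _ => by positivity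

lemma weak_grad {f : PSpace N → ℝ} (hf : ContDiff ℝ ∞ f) (hc : HasCompactSupport f)
    (h0 : ∀ z, 0 ≤ f z) (i : Fin N) {lam : ℝ} (hl : 0 < lam) :
    ENNReal.ofReal (lam / 2) * volume {z | pot f z < 1 ∧
        2 * √2 * (1 + gaussMom N) * √lam < |dx i (pot f) z|}
      ≤ ∫⁻ z in {z | lam < f z}, ENNReal.ofReal (f z) := by
  set χ : PSpace N → ℝ := fun z => Real.smoothTransition (f z / lam - 1) with hχ
  have hχs : ContDiff ℝ ∞ χ := Real.smoothTransition.contDiff.comp ((hf.div_const _).sub contDiff_const)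
  have hχ0 : ∀ z, 0 ≤ χ z := fun z => Real.smoothTransition.nonneg _
  have hχ1 : ∀ z, χ z ≤ 1 := fun z => Real.smoothTransition.le_one _
  set f1 : PSpace N → ℝ := fun z => f z * χ z with hf1
  set f2 : PSpace N → ℝ := fun z => f z * (1 - χ z) with hf2
  have s1 : ContDiff ℝ ∞ f1 := hf.mul hχs
  have s2 : ContDiff ℝ ∞ f2 := hf.mul (contDiff_const.sub hχs)
  have c1 : HasCompactSupport f1 := hc.mul_right
  have c2 : HasCompactSupport f2 := hc.mul_right
  have b1 : BddSmooth f1 := .of_hasCompactSupport s1 c1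
  have b2 : BddSmooth f2 := .of_hasCompactSupport s2 c2
  have p1 : ∀ z, 0 ≤ f1 z := fun z => mul_nonneg (h0 z) (hχ0 z)
  have p2 : ∀ z, 0 ≤ f2 z := fun z => mul_nonneg (h0 z) (by linarith [hχ1 z])
  have le2 : ∀ z, f2 z ≤ 2 * lam := fun z => by
    rcases le_total (f z) (2 * lam) with h | h
    · calc f2 z ≤ f z * 1 := by
            simp only [hf2]; gcongr
            · exact h0 z
            · linarith [hχ0 z]
        _ ≤ _ := by linarith
    · have : χ z = 1 := Real.smoothTransition.one_of_one_le (by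
        have : 2 ≤ f z / lam := by rw [le_div_iff₀ hl]; exact h
        linarith)
      simp only [hf2, this]
      linarith
  have hV : pot f = fun z => pot f1 z + pot f2 z := by
    have : f = fun z => f1 z + f2 z := by funext z; simp only [hf1, hf2]; ring
    conv_lhs => rw [this]
    exact funext fun z => pot_add b1 b2 z
  have hdV : ∀ z, dx i (pot f) z = dx i (pot f1) z + dx i (pot f2) z := fun z => by
    rw [hV]
    exact congrFun (dx_add b1.pot.smooth b2.pot.smooth i) z
  have hM := gaussMom_nonneg (N := N)
  set A := √2 * (1 + gaussMom N) * √lam with hA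
  have hA0 : 0 < A := by positivity
  have hA2 : lam / 2 ≤ A ^ 2 / 4 := by
    have : A ^ 2 = 2 * (1 + gaussMom N) ^ 2 * lam := by
      rw [hA, mul_pow, mul_pow, Real.sq_sqrt (by norm_num), Real.sq_sqrt hl.le]
    rw [this]
    nlinarith [mul_nonneg hM hl.le, mul_nonneg (mul_nonneg hM hM) hl.le]
  have hsub : {z | pot f z < 1 ∧ 2 * √2 * (1 + gaussMom N) * √lam < |dx i (pot f) z|}
      ⊆ {z | pot f1 z < 1 ∧ A < |dx i (pot f1) z|} := by
    rintro z ⟨h1, h2⟩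
    have q1 := pot_nonneg p1 z
    have q2 := pot_nonneg p2 z
    have e : pot f z = pot f1 z + pot f2 z := congrFun hV z
    have h3 := abs_dx_pot_le b2 (by positivity : 0 < 2 * lam) p2 le2 i z
    have h4 : √(2 * lam) * (pot f2 z + gaussMom N) ≤ A := by
      rw [Real.sqrt_mul (by norm_num), hA]
      have : pot f2 z + gaussMom N ≤ 1 + gaussMom N := by linarith
      calc √2 * √lam * (pot f2 z + gaussMom N) ≤ √2 * √lam * (1 + gaussMom N) := by gcongr
        _ = _ := by ring
    refine ⟨by linarith, ?_⟩
    have h5 := abs_add_le (dx i (pot f1) z) (dx i (pot f2) z)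
    rw [← hdV] at h5
    have : 2 * √2 * (1 + gaussMom N) * √lam = 2 * A := by rw [hA]; ring
    linarith
  calc _ ≤ ENNReal.ofReal (A ^ 2 / 4) * volume {z | pot f1 z < 1 ∧ A < |dx i (pot f1) z|} := by
        gcongr
    _ ≤ ∫⁻ z, ENNReal.ofReal (f1 z) := energy s1 c1 p1 i hA0
    _ ≤ ∫⁻ z, {z | lam < f z}.indicator (fun z => ENNReal.ofReal (f z)) z := by
        refine lintegral_mono fun z => ?_
        by_cases h : lam < f z
        · rw [indicator_of_mem (by exact h)]
          refine ENNReal.ofReal_le_ofReal ?_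
          simp only [hf1]
          nlinarith [h0 z, hχ1 z]
        · have : χ z = 0 := Real.smoothTransition.zero_of_nonpos (by
            have : f z / lam ≤ 1 := by rw [div_le_one hl]; exact not_lt.1 h
            linarith)
          simp [hf1, this]
    _ = _ := lintegral_indicator (measurableSet_lt measurable_const hf.continuous.measurable) _

/-- Strong-type gradient bound for the potential, on the set where the potential is below one. -/
lemma grad_Lp (N : ℕ) {p : ℝ} (hp : 1 < p) : ∃ C : ℝ, 0 < C ∧ ∀ f : PSpace N → ℝ, ContDiff ℝ ∞ f →
    HasCompactSupport f → (∀ z, 0 ≤ f z) → ∀ i : Fin N,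
    ∫⁻ z in {z | pot f z < 1}, ENNReal.ofReal (|dx i (pot f) z| ^ (2 * p))
      ≤ ENNReal.ofReal C * ∫⁻ z, ENNReal.ofReal (f z ^ p) := by
  have hM := gaussMom_nonneg (N := N)
  set B := 2 * √2 * (1 + gaussMom N) with hB
  have hB0 : 0 < B := by positivity
  have hp1 : 0 < p - 1 := by linarith
  refine ⟨B ^ (2 * p) * (p * (2 / (p - 1))), by positivity, fun f hf hc h0 i => ?_⟩
  have hb : BddSmooth f := .of_hasCompactSupport hf hc
  have hcd : Continuous (dx i (pot f)) := (hb.pot.dx i).continuous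
  have hms : MeasurableSet {z | pot f z < 1} :=
    measurableSet_lt hb.pot.continuous.measurable measurable_const
  set a : PSpace N → ℝ := fun z => (|dx i (pot f) z| / B) ^ 2 with ha
  have hac : Continuous a := (hcd.abs.div_const _).pow 2
  set μ := (volume : Measure (PSpace N)).restrict {z | pot f z < 1} with hμ
  set ν := (volume : Measure (PSpace N)).withDensity (fun z => ENNReal.ofReal (f z)) with hν
  have e1 : ∀ z, ENNReal.ofReal (|dx i (pot f) z| ^ (2 * p))
      = ENNReal.ofReal (B ^ (2 * p)) * ENNReal.ofReal (a z ^ p) := fun z => by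
    rw [← ENNReal.ofReal_mul (by positivity)]
    congr 1
    rw [ha]
    simp only []
    rw [← Real.rpow_natCast, ← Real.rpow_mul (by positivity), Real.div_rpow (by positivity) hB0.le]
    push_cast
    field_simp
  have e2 : ∫⁻ z, ENNReal.ofReal (a z ^ p) ∂μ
      = ENNReal.ofReal p * ∫⁻ t in Ioi (0 : ℝ), μ {z | t < a z} * ENNReal.ofReal (t ^ (p - 1)) :=
    lintegral_rpow_eq_lintegral_meas_lt_mul μ (ae_of_all _ fun z => by simp only [ha]; positivity)
      hac.measurable.aemeasurable (by linarith)
  have e3 : ∫⁻ z, ENNReal.ofReal (f z ^ (p - 1)) ∂ν = ENNReal.ofReal (p - 1) *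
      ∫⁻ t in Ioi (0 : ℝ), ν {z | t < f z} * ENNReal.ofReal (t ^ (p - 1 - 1)) :=
    lintegral_rpow_eq_lintegral_meas_lt_mul ν (ae_of_all _ h0)
      hf.continuous.measurable.aemeasurable (by linarith)
  have e4 : ∫⁻ z, ENNReal.ofReal (f z ^ (p - 1)) ∂ν = ∫⁻ z, ENNReal.ofReal (f z ^ p) := by
    rw [hν, lintegral_withDensity_eq_lintegral_mul _ hf.continuous.measurable.ennreal_ofReal
      (by have := hf.continuous.measurable; fun_prop)]
    refine lintegral_congr fun z => ?_
    simp only [Pi.mul_apply]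
    rw [← ENNReal.ofReal_mul (h0 z)]
    rcases (h0 z).eq_or_lt with h | h
    · rw [← h, Real.zero_rpow (by linarith : p ≠ 0)]; simp
    · rw [Real.rpow_sub_one h.ne']; congr 1; field_simp
  have e5 : ∀ t ∈ Ioi (0 : ℝ), μ {z | t < a z} * ENNReal.ofReal (t ^ (p - 1))
      ≤ 2 * (ν {z | t < f z} * ENNReal.ofReal (t ^ (p - 1 - 1))) := fun t ht => by
    have ht : 0 < t := ht
    have h1 := weak_grad hf hc h0 i ht
    have h2 : μ {z | t < a z} = volume {z | pot f z < 1 ∧ B * √t < |dx i (pot f) z|} := by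
      rw [hμ, Measure.restrict_apply (measurableSet_lt measurable_const hac.measurable)]
      congr 1
      ext z
      simp only [mem_inter_iff, mem_ofPred_eq, ha]
      rw [and_comm, ← Real.sqrt_lt_sqrt_iff ht.le, Real.sqrt_sq (by positivity), lt_div_iff₀ hB0,
        mul_comm]
    have h3 : ν {z | t < f z} = ∫⁻ z in {z | t < f z}, ENNReal.ofReal (f z) :=
      withDensity_apply _ (measurableSet_lt measurable_const hf.continuous.measurable)
    rw [← h2, ← h3] at h1
    have h4 : ENNReal.ofReal (t ^ (p - 1))
        = 2 * (ENNReal.ofReal (t / 2) * ENNReal.ofReal (t ^ (p - 1 - 1))) := by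
      rw [← ENNReal.ofReal_mul (by positivity), ← ENNReal.ofReal_ofNat, ← ENNReal.ofReal_mul (by norm_num),
        Real.rpow_sub_one ht.ne' (p - 1)]
      congr 1
      field_simp
    rw [h4]
    calc _ = 2 * ((ENNReal.ofReal (t / 2) * μ {z | t < a z}) * ENNReal.ofReal (t ^ (p - 1 - 1))) := by
          ring
      _ ≤ _ := by gcongr
  have e6 : ∫⁻ t in Ioi (0 : ℝ), μ {z | t < a z} * ENNReal.ofReal (t ^ (p - 1))
      ≤ 2 * ∫⁻ t in Ioi (0 : ℝ), ν {z | t < f z} * ENNReal.ofReal (t ^ (p - 1 - 1)) := by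
    rw [← lintegral_const_mul' _ _ (by norm_num)]
    exact setLIntegral_mono' measurableSet_Ioi e5
  simp_rw [e1]
  rw [lintegral_const_mul' _ _ ENNReal.ofReal_ne_top, ENNReal.ofReal_mul (by positivity), mul_assoc]
  gcongr
  have h6 : ENNReal.ofReal (p * (2 / (p - 1))) * ENNReal.ofReal (p - 1) = ENNReal.ofReal p * 2 := by
    have : 0 < p - 1 := by linarith
    rw [← ENNReal.ofReal_mul (by positivity), ← ENNReal.ofReal_ofNat, ← ENNReal.ofReal_mul (by linarith)]
    congr 1
    field_simp
  rw [← e4, e3, ← mul_assoc, h6, e2, mul_assoc]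
  gcongr

lemma expM_le : expM ≤ volume := by
  unfold expM
  calc _ ≤ (volume.restrict (Ioi (0 : ℝ))).withDensity 1 := by
        refine withDensity_mono ?_
        filter_upwards [ae_restrict_mem measurableSet_Ioi] with s hs
        have hs : (0 : ℝ) < s := hs
        simpa using hs.le
    _ ≤ _ := by rw [withDensity_one]; exact Measure.restrict_le_self

lemma expM_Iio_le (σ : ℝ) : expM (Iio σ) ≤ ENNReal.ofReal σ := by
  unfold expM
  rw [withDensity_apply _ measurableSet_Iio, Measure.restrict_restrict measurableSet_Iio]
  calc _ ≤ ∫⁻ s in Iio σ ∩ Ioi 0, 1 := by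
        refine setLIntegral_mono' (measurableSet_Iio.inter measurableSet_Ioi) fun s hs => ?_
        have hs : (0 : ℝ) < s := hs.2
        simpa using hs.le
    _ ≤ _ := by
        rw [setLIntegral_one, inter_comm, Ioi_inter_Iio, Real.volume_Ioo, sub_zero]

lemma potM_lt_le (σ : ℝ) :
    potM N {ξ : EuclideanSpace ℝ (Fin N) × ℝ | ξ.2 < σ} ≤ ENNReal.ofReal σ := by
  have : {ξ : EuclideanSpace ℝ (Fin N) × ℝ | ξ.2 < σ} = univ ×ˢ Iio σ := by ext; simp
  rw [this, potM, Measure.prod_prod, measure_univ, one_mul]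
  exact expM_Iio_le σ

lemma lintegral_rpow_le {α : Type*} [MeasurableSpace α] (μ : Measure α) {p : ℝ} (hp : 1 < p)
    {F : α → ℝ≥0∞} (hF : AEMeasurable F μ) :
    (∫⁻ a, F a ∂μ) ^ p ≤ μ univ ^ (p - 1) * ∫⁻ a, F a ^ p ∂μ := by
  have hpq : p.HolderConjugate (p / (p - 1)) := .conjExponent hp
  have h := ENNReal.lintegral_mul_le_Lp_mul_Lq μ hpq hF (g := 1) aemeasurable_const
  have hp0 : 0 < p := by linarith
  have hp1 : 0 < p - 1 := by linarith
  calc (∫⁻ a, F a ∂μ) ^ p ≤ ((∫⁻ a, F a ^ p ∂μ) ^ (1 / p) * μ univ ^ (1 / (p / (p - 1)))) ^ p := by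
        gcongr
        simpa using h
    _ = _ := by
        rw [ENNReal.mul_rpow_of_nonneg _ _ hp0.le, ← ENNReal.rpow_mul, ← ENNReal.rpow_mul,
          one_div_mul_cancel hp0.ne', ENNReal.rpow_one, mul_comm]
        congr 2
        field_simp

lemma near_Lp {p : ℝ} (hp : 1 < p) {G : PSpace N → ℝ≥0∞} (hG : Measurable G) (σ : ℝ) :
    ∫⁻ z, (∫⁻ ξ in {ξ | ξ.2 < σ}, G (z + shift ξ) ∂(potM N)) ^ p
      ≤ ENNReal.ofReal σ ^ p * ∫⁻ z, G z ^ p := by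
  have hcs := continuous_shift (N := N)
  have hS := potM_lt_le (N := N) σ
  set S : Set (EuclideanSpace ℝ (Fin N) × ℝ) := {ξ | ξ.2 < σ} with hSd
  calc _ ≤ ∫⁻ z, ENNReal.ofReal σ ^ (p - 1) * ∫⁻ ξ in S, G (z + shift ξ) ^ p ∂(potM N) := by
        refine lintegral_mono fun z => ?_
        have hm : Measurable fun ξ => G (z + shift ξ) := hG.comp (by fun_prop)
        refine (lintegral_rpow_le _ hp hm.aemeasurable).trans ?_
        rw [Measure.restrict_apply_univ]
        have : 0 ≤ p - 1 := by linarith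
        gcongr
    _ ≤ ENNReal.ofReal σ ^ (p - 1) * (ENNReal.ofReal σ * ∫⁻ z, G z ^ p) := by
        rw [lintegral_const_mul' _ _ (ENNReal.rpow_ne_top_of_nonneg (by linarith)
          ENNReal.ofReal_ne_top), lintegral_lintegral_shift (hG.pow_const p)]
        gcongr
    _ = _ := by
        rw [← mul_assoc]
        congr 1
        nth_rw 2 [← ENNReal.rpow_one (ENNReal.ofReal σ)]
        rw [← ENNReal.rpow_add_of_nonneg _ _ (by linarith) zero_le_one, sub_add_cancel]

lemma lintegral_slice_le {G : EuclideanSpace ℝ (Fin N) → ℝ≥0∞} (hG : Measurable G)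
    (x : EuclideanSpace ℝ (Fin N)) {c ρ : ℝ} (hρ : 0 < ρ) (hc : ρ ≤ c) :
    ∫⁻ y, G (x + c • y) ∂(gaussM N) ≤ ENNReal.ofReal (gaussC N * (ρ ^ N)⁻¹) * ∫⁻ y, G y := by
  have hc0 : 0 < c := hρ.trans_le hc
  have hm : Measurable fun y => G (x + c • y) := hG.comp (by fun_prop)
  unfold gaussM
  rw [lintegral_withDensity_eq_lintegral_mul _
    (contDiff_gaussD.continuous.measurable.ennreal_ofReal) hm]
  calc _ ≤ ∫⁻ y, ENNReal.ofReal (gaussC N) * G (x + c • y) := by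
        refine lintegral_mono fun y => ?_
        simp only [Pi.mul_apply]
        gcongr
        exact gaussD_le y
    _ = ENNReal.ofReal (gaussC N) * ∫⁻ y, G (x + c • y) :=
        lintegral_const_mul' _ _ ENNReal.ofReal_ne_top
    _ = ENNReal.ofReal (gaussC N) * (ENNReal.ofReal |(c ^ N)⁻¹| * ∫⁻ y, G y) := by
        have h1 : Measurable fun y => G (x + y) := hG.comp (by fun_prop)
        have h2 := lintegral_map (μ := (volume : Measure (EuclideanSpace ℝ (Fin N)))) h1
          (measurable_const_smul c)
        rw [Measure.map_addHaar_smul _ hc0.ne', lintegral_smul_measure, finrank_euclideanSpace_fin,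
          lintegral_add_left_eq_self] at h2
        rw [← h2, smul_eq_mul]
    _ ≤ _ := by
        rw [← mul_assoc, ← ENNReal.ofReal_mul (gaussC_pos N).le, abs_of_pos (by positivity)]
        have := (gaussC_pos N).le
        gcongr

lemma far_le {G : PSpace N → ℝ≥0∞} (hG : Measurable G) {ρ : ℝ} (hρ : 0 < ρ) (z : PSpace N) :
    ∫⁻ ξ in {ξ | ρ ^ 2 ≤ ξ.2}, G (z + shift ξ) ∂(potM N)
      ≤ ENNReal.ofReal (gaussC N * (ρ ^ N)⁻¹) * ∫⁻ z, G z := by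
  have hcs := continuous_shift (N := N)
  have : {ξ : EuclideanSpace ℝ (Fin N) × ℝ | ρ ^ 2 ≤ ξ.2} = univ ×ˢ Ici (ρ ^ 2) := by ext; simp
  have hm : Measurable fun ξ => G (z + shift ξ) := hG.comp (by fun_prop)
  rw [this, potM, ← Measure.prod_restrict, Measure.restrict_univ,
    lintegral_prod_symm _ hm.aemeasurable]
  calc _ ≤ ∫⁻ s in Ici (ρ ^ 2), (ENNReal.ofReal (gaussC N * (ρ ^ N)⁻¹) *
          ∫⁻ y, G (y, z.2 + s)) ∂expM := by
        refine setLIntegral_mono' measurableSet_Ici fun s hs => ?_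
        have hs : ρ ^ 2 ≤ s := hs
        refine le_trans (le_of_eq ?_) (lintegral_slice_le (G := fun y => G (y, z.2 + s))
          (hG.comp (by fun_prop)) z.1 hρ (c := √(2 * s))
          (Real.le_sqrt_of_sq_le (by nlinarith [sq_nonneg ρ])))
        rfl
    _ ≤ ∫⁻ s, ENNReal.ofReal (gaussC N * (ρ ^ N)⁻¹) * ∫⁻ y, G (y, z.2 + s) :=
        lintegral_mono' (Measure.restrict_le_self.trans expM_le) le_rfl
    _ = _ := by
        rw [lintegral_const_mul' _ _ ENNReal.ofReal_ne_top]
        congr 1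
        rw [lintegral_add_left_eq_self (fun t => ∫⁻ y, G (y, t)) z.2]
        exact (lintegral_prod_symm G hG.aemeasurable).symm

lemma ofReal_pot_eq {f : PSpace N → ℝ} (hf : BddSmooth f) (h0 : ∀ z, 0 ≤ f z) (σ : ℝ)
    (z : PSpace N) : ENNReal.ofReal (pot f z)
      = (∫⁻ ξ in {ξ | ξ.2 < σ}, ENNReal.ofReal (f (z + shift ξ)) ∂(potM N))
        + ∫⁻ ξ in {ξ | σ ≤ ξ.2}, ENNReal.ofReal (f (z + shift ξ)) ∂(potM N) := by
  unfold pot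
  rw [ofReal_integral_eq_lintegral_ofReal (hf.integrable_shift z) (ae_of_all _ fun _ => h0 _)]
  have : {ξ : EuclideanSpace ℝ (Fin N) × ℝ | σ ≤ ξ.2} = {ξ | ξ.2 < σ}ᶜ := by ext; simp
  rw [this]
  exact (lintegral_add_compl _ (measurableSet_lt measurable_snd measurable_const)).symm

/-- A small potential is large only on a small set. -/
lemma volume_pot_le {p : ℝ} (hp : 1 < p) {f : PSpace N → ℝ} (hf : BddSmooth f)
    (h0 : ∀ z, 0 ≤ f z) {ρ : ℝ} (hρ : 0 < ρ)
    (hsmall : ENNReal.ofReal (gaussC N * (ρ ^ N)⁻¹) * ∫⁻ z, ENNReal.ofReal (f z ^ p)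
      ≤ ENNReal.ofReal ((1 / 4) ^ p)) :
    volume {z | 1 / 2 < pot f z}
      ≤ ENNReal.ofReal (4 ^ p * ρ ^ (2 * p)) * ∫⁻ z, ENNReal.ofReal (f z ^ p) := by
  have hp0 : 0 < p := by linarith
  have hcs := continuous_shift (N := N)
  have hG : Measurable fun z => ENNReal.ofReal (f z) := hf.continuous.measurable.ennreal_ofReal
  have hGp : ∀ z, ENNReal.ofReal (f z) ^ p = ENNReal.ofReal (f z ^ p) := fun z =>
    ENNReal.ofReal_rpow_of_nonneg (h0 z) hp0.le
  set near : PSpace N → ℝ≥0∞ :=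
    fun z => ∫⁻ ξ in {ξ | ξ.2 < ρ ^ 2}, ENNReal.ofReal (f (z + shift ξ)) ∂(potM N) with hnear
  set far : PSpace N → ℝ≥0∞ :=
    fun z => ∫⁻ ξ in {ξ | ρ ^ 2 ≤ ξ.2}, ENNReal.ofReal (f (z + shift ξ)) ∂(potM N) with hfar
  have hfar4 : ∀ z, far z ≤ ENNReal.ofReal (1 / 4) := fun z => by
    rw [← ENNReal.rpow_le_rpow_iff hp0, ENNReal.ofReal_rpow_of_nonneg (by norm_num) hp0.le]
    refine le_trans ?_ hsmall
    have hm : Measurable fun ξ => ENNReal.ofReal (f (z + shift ξ)) := hG.comp (by fun_prop)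
    refine (lintegral_rpow_le _ hp hm.aemeasurable).trans ?_
    have h1 : ((potM N).restrict {ξ | ρ ^ 2 ≤ ξ.2} univ) ^ (p - 1) ≤ 1 := by
      rw [Measure.restrict_apply_univ]
      exact ENNReal.rpow_le_one prob_le_one (by linarith)
    calc _ ≤ 1 * ∫⁻ ξ in {ξ | ρ ^ 2 ≤ ξ.2}, ENNReal.ofReal (f (z + shift ξ)) ^ p ∂(potM N) := by
          gcongr
      _ ≤ _ := by
          rw [one_mul]
          refine (far_le (hG.pow_const p) hρ z).trans (le_of_eq ?_)
          simp_rw [hGp]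
  have hsub : {z | 1 / 2 < pot f z} ⊆ {z | ENNReal.ofReal ((1 / 4) ^ p) ≤ near z ^ p} := by
    intro z hz
    have hz : 1 / 2 < pot f z := hz
    change ENNReal.ofReal ((1 / 4) ^ p) ≤ near z ^ p
    rw [← ENNReal.ofReal_rpow_of_nonneg (by norm_num) hp0.le]
    gcongr
    by_contra hcon
    have h1 := ofReal_pot_eq hf h0 (ρ ^ 2) z
    have h2 : ENNReal.ofReal (pot f z) ≤ ENNReal.ofReal (1 / 4) + ENNReal.ofReal (1 / 4) := by
      rw [h1]; exact add_le_add (not_le.1 hcon).le (hfar4 z)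
    rw [← ENNReal.ofReal_add (by norm_num) (by norm_num), ENNReal.ofReal_le_ofReal_iff (by norm_num)]
      at h2
    linarith
  have hnm : Measurable near := by
    have : Measurable (Function.uncurry fun (z : PSpace N) ξ => ENNReal.ofReal (f (z + shift ξ))) :=
      hG.comp (by fun_prop)
    exact this.lintegral_prod_right'
  have hch : ENNReal.ofReal ((1 / 4) ^ p) * volume {z | ENNReal.ofReal ((1 / 4) ^ p) ≤ near z ^ p}
      ≤ ENNReal.ofReal (ρ ^ 2) ^ p * ∫⁻ z, ENNReal.ofReal (f z) ^ p :=
    (mul_meas_ge_le_lintegral₀ (hnm.pow_const p).aemeasurable _).trans (near_Lp hp hG _)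
  simp_rw [hGp] at hch
  calc _ ≤ volume {z | ENNReal.ofReal ((1 / 4) ^ p) ≤ near z ^ p} := measure_mono hsub
    _ = ENNReal.ofReal (4 ^ p) * (ENNReal.ofReal ((1 / 4) ^ p) *
          volume {z | ENNReal.ofReal ((1 / 4) ^ p) ≤ near z ^ p}) := by
        rw [← mul_assoc, ← ENNReal.ofReal_mul (by positivity),
          ← Real.mul_rpow (by norm_num) (by norm_num)]
        norm_num
    _ ≤ ENNReal.ofReal (4 ^ p) * (ENNReal.ofReal (ρ ^ 2) ^ p * ∫⁻ z, ENNReal.ofReal (f z ^ p)) := by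
        gcongr
    _ = _ := by
        rw [← mul_assoc, ENNReal.ofReal_rpow_of_nonneg (by positivity) hp0.le,
          ← ENNReal.ofReal_mul (by positivity), ← Real.rpow_natCast, ← Real.rpow_mul hρ.le]
        push_cast
        rfl

lemma hasDerivAt_slice_t {f : PSpace N → ℝ} {z : PSpace N} (hf : DifferentiableAt ℝ f z) :
    HasDerivAt (fun s => f (z.1, s)) (dt f z) z.2 := by
  have h1 : HasDerivAt (fun s : ℝ => ((z.1, s) : PSpace N)) (eT N) z.2 :=
    (hasDerivAt_const z.2 z.1).prodMk (hasDerivAt_id z.2)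
  exact HasFDerivAt.comp_hasDerivAt (l := f) z.2 hf.hasFDerivAt h1

lemma hasLineDerivAt_slice_x {f : PSpace N → ℝ} {z : PSpace N} (hf : DifferentiableAt ℝ f z)
    (i : Fin N) :
    HasLineDerivAt ℝ (fun y => f (y, z.2)) (dx i f z) z.1 (EuclideanSpace.single i 1) := by
  have h1 : HasFDerivAt (fun y : EuclideanSpace ℝ (Fin N) => ((y, z.2) : PSpace N))
      (ContinuousLinearMap.inl ℝ _ _) z.1 := hasFDerivAt_prodMk_left z.1 z.2
  have h2 := HasFDerivAt.comp (g := f) z.1 hf.hasFDerivAt h1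
  exact h2.hasLineDerivAt (EuclideanSpace.single i 1)

lemma tDeriv_eq {f : PSpace N → ℝ} (hf : Differentiable ℝ f) : tDeriv f = dt f :=
  funext fun z => (hasDerivAt_slice_t (hf z)).deriv

lemma xDeriv_eq {f : PSpace N → ℝ} (hf : Differentiable ℝ f) (i : Fin N) : xDeriv i f = dx i f :=
  funext fun z => (hasLineDerivAt_slice_x (hf z) i).lineDeriv

lemma xxDeriv_eq {f : PSpace N → ℝ} (hf : ContDiff ℝ ∞ f) (i j : Fin N) :
    xxDeriv i j f = dx i (dx j f) := by
  have h := xDeriv_eq (differentiable_of_contDiff hf) j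
  funext z
  unfold xxDeriv
  rw [h, xDeriv_eq (differentiable_of_contDiff (contDiff_dx hf j))]

/-- The Schwartz density whose potential is `φ`. -/
def density (φ : SchwartzMap (PSpace N) ℝ) : SchwartzMap (PSpace N) ℝ :=
  φ - LineDeriv.lineDerivOp (eT N) φ
    - ∑ i : Fin N, LineDeriv.lineDerivOp (eX i) (LineDeriv.lineDerivOp (eX i) φ)

lemma lineDerivOp_eT (φ : SchwartzMap (PSpace N) ℝ) :
    ⇑(LineDeriv.lineDerivOp (eT N) φ : SchwartzMap (PSpace N) ℝ) = dt ⇑φ :=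
  funext fun z => SchwartzMap.lineDerivOp_apply_eq_fderiv _ _ z

lemma lineDerivOp_eX (φ : SchwartzMap (PSpace N) ℝ) (i : Fin N) :
    ⇑(LineDeriv.lineDerivOp (eX i) φ : SchwartzMap (PSpace N) ℝ) = dx i ⇑φ :=
  funext fun z => SchwartzMap.lineDerivOp_apply_eq_fderiv _ _ z

lemma density_apply (φ : SchwartzMap (PSpace N) ℝ) (z : PSpace N) :
    density φ z = φ z - heatL φ z := by
  have h : ∀ i, (LineDeriv.lineDerivOp (eX i) (LineDeriv.lineDerivOp (eX i) φ) :
      SchwartzMap (PSpace N) ℝ) z = dx i (dx i φ) z := fun i => by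
    rw [lineDerivOp_eX, lineDerivOp_eX]
  simp only [density, sub_apply, sum_apply, h, lineDerivOp_eT, heatL]
  ring

lemma pot_density (φ : SchwartzMap (PSpace N) ℝ) (z : PSpace N) : pot (density φ) z = φ z := by
  have hφ : BddSmooth (fun z => φ z) := .of_schwartz φ
  have h1 : (fun z => density φ z) = fun z => φ z + -heatL φ z :=
    funext fun z => by rw [density_apply]; ring
  have h2 : pot (fun z => -heatL φ z) z = -pot (heatL φ) z := integral_neg _
  change pot (fun z => density φ z) z = _
  rw [h1, pot_add hφ hφ.heatL.neg, h2, pot_heatL hφ]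
  ring

lemma toReal_eLpNorm_density_le {p : ℝ} (hp : 1 ≤ p) (φ : SchwartzMap (PSpace N) ℝ) :
    (eLpNorm (density φ) (ENNReal.ofReal p) volume).toReal ≤ W21Norm N p (fun z => φ z) := by
  have hp' : 1 ≤ ENNReal.ofReal p := by simpa using hp
  have hs : ContDiff ℝ ∞ (fun z => φ z) := φ.smooth _
  have hxx : ∀ i : Fin N, xxDeriv i i (fun z => φ z) = ⇑(LineDeriv.lineDerivOp (eX i)
      (LineDeriv.lineDerivOp (eX i) φ) : SchwartzMap (PSpace N) ℝ) := fun i => by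
    rw [lineDerivOp_eX, lineDerivOp_eX]; exact xxDeriv_eq hs i i
  have ht : tDeriv (fun z => φ z) = ⇑(LineDeriv.lineDerivOp (eT N) φ : SchwartzMap (PSpace N) ℝ) := by
    rw [lineDerivOp_eT]; exact tDeriv_eq (differentiable_of_contDiff hs)
  have hm : ∀ χ : SchwartzMap (PSpace N) ℝ, MemLp χ (ENNReal.ofReal p) volume := fun χ =>
    χ.memLp _ volume
  have hle : eLpNorm (density φ) (ENNReal.ofReal p) volume ≤
      eLpNorm φ (ENNReal.ofReal p) volume
      + eLpNorm (LineDeriv.lineDerivOp (eT N) φ : SchwartzMap (PSpace N) ℝ) (ENNReal.ofReal p) volume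
      + ∑ i : Fin N, eLpNorm (LineDeriv.lineDerivOp (eX i) (LineDeriv.lineDerivOp (eX i) φ) :
          SchwartzMap (PSpace N) ℝ) (ENNReal.ofReal p) volume := by
    have e : ⇑(density φ) = (⇑φ - ⇑(LineDeriv.lineDerivOp (eT N) φ : SchwartzMap (PSpace N) ℝ))
        - ∑ i : Fin N, ⇑(LineDeriv.lineDerivOp (eX i) (LineDeriv.lineDerivOp (eX i) φ) :
          SchwartzMap (PSpace N) ℝ) := by
      funext z
      simp [density, sum_apply]
    rw [e]
    refine (eLpNorm_sub_le ((hm _).1.sub (hm _).1)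
      (Finset.aestronglyMeasurable_sum _ fun i _ => (hm _).1) hp').trans (add_le_add
        (eLpNorm_sub_le (hm _).1 (hm _).1 hp') (eLpNorm_sum_le (fun i _ => (hm _).1) hp'))
  have hfin : ∀ i ∈ (Finset.univ : Finset (Fin N)), eLpNorm (LineDeriv.lineDerivOp (eX i)
      (LineDeriv.lineDerivOp (eX i) φ) : SchwartzMap (PSpace N) ℝ) (ENNReal.ofReal p) volume ≠ ⊤ :=
    fun i _ => (hm _).2.ne
  have h2 := ENNReal.toReal_mono (ENNReal.add_ne_top.2 ⟨ENNReal.add_ne_top.2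
    ⟨(hm _).2.ne, (hm _).2.ne⟩, ENNReal.sum_ne_top.2 hfin⟩) hle
  rw [ENNReal.toReal_add (ENNReal.add_ne_top.2 ⟨(hm _).2.ne, (hm _).2.ne⟩)
      (ENNReal.sum_ne_top.2 hfin), ENNReal.toReal_add (hm _).2.ne (hm _).2.ne,
    ENNReal.toReal_sum hfin] at h2
  refine h2.trans ?_
  unfold W21Norm
  rw [ht]
  have h3 : ∀ i : Fin N, (eLpNorm (LineDeriv.lineDerivOp (eX i) (LineDeriv.lineDerivOp (eX i) φ) :
      SchwartzMap (PSpace N) ℝ) (ENNReal.ofReal p) volume).toReal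
      ≤ ∑ j, (eLpNorm (xxDeriv i j (fun z => φ z)) (ENNReal.ofReal p) volume).toReal := fun i => by
    rw [← hxx]
    exact Finset.single_le_sum (f := fun j => (eLpNorm (xxDeriv i j (fun z => φ z))
      (ENNReal.ofReal p) volume).toReal) (fun _ _ => ENNReal.toReal_nonneg) (Finset.mem_univ i)
  have h4 := Finset.sum_le_sum fun i (_ : i ∈ Finset.univ) => h3 i
  have h5 : 0 ≤ (eLpNorm (gradNorm fun z => φ z) (ENNReal.ofReal p) volume).toReal :=
    ENNReal.toReal_nonneg
  linarith

lemma lintegral_density_le {p : ℝ} (hp : 1 ≤ p) (φ : SchwartzMap (PSpace N) ℝ) :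
    ∫⁻ z, ENNReal.ofReal (|density φ z| ^ p) ≤ ENNReal.ofReal (W21Norm N p (fun z => φ z) ^ p) := by
  have hp0 : 0 < p := by linarith
  have hm : MemLp (density φ) (ENNReal.ofReal p) volume := (density φ).memLp _ volume
  have h1 := toReal_eLpNorm_density_le hp φ
  have h2 : eLpNorm (density φ) (ENNReal.ofReal p) volume
      ≤ ENNReal.ofReal (W21Norm N p (fun z => φ z)) :=
    (ENNReal.le_ofReal_iff_toReal_le hm.2.ne (ENNReal.toReal_nonneg.trans h1)).2 h1
  rw [eLpNorm_eq_lintegral_rpow_enorm_toReal (by simpa using hp0) ENNReal.ofReal_ne_top,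
    ENNReal.toReal_ofReal hp0.le] at h2
  have h3 := ENNReal.rpow_le_rpow h2 hp0.le
  rw [← ENNReal.rpow_mul, one_div_mul_cancel hp0.ne', ENNReal.rpow_one,
    ENNReal.ofReal_rpow_of_nonneg (ENNReal.toReal_nonneg.trans h1) hp0.le] at h3
  refine le_trans (le_of_eq (lintegral_congr fun z => ?_)) h3
  rw [← ENNReal.ofReal_rpow_of_nonneg (abs_nonneg _) hp0.le, ← Real.norm_eq_abs, ofReal_norm]

/-- A compactly supported nonnegative density whose potential almost dominates `φ`. -/
lemma exists_density (φ : SchwartzMap (PSpace N) ℝ) : ∃ f : PSpace N → ℝ, ContDiff ℝ ∞ f ∧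
    HasCompactSupport f ∧ (∀ z, 0 ≤ f z) ∧ (∀ z, f z ≤ |density φ z|) ∧
    ∀ z, φ z - 1 / 4 ≤ pot f z := by
  set g := density φ with hg
  have hgs : ContDiff ℝ ∞ (fun z => g z) := g.smooth _
  have htend : Tendsto (fun z => g z) (cocompact (PSpace N)) (𝓝 0) := g.toZeroAtInfty.zero_at_infty'
  have hev : {z | |g z| < 1 / 4} ∈ cocompact (PSpace N) := by
    have := htend.abs
    rw [abs_zero] at this
    exact this.eventually_lt_const (by norm_num)
  obtain ⟨r, hr⟩ := Metric.closedBall_compl_subset_of_mem_cocompact hev 0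
  let χ : ContDiffBump (0 : PSpace N) := ⟨max r 1, max r 1 + 1, by positivity, by linarith⟩
  have hχs : ContDiff ℝ ∞ (fun z => χ z) := χ.contDiff
  have hsq : ∀ z, 0 < g z ^ 2 + (1 / 4) ^ 2 := fun z => by positivity
  set h : PSpace N → ℝ := fun z => √(g z ^ 2 + (1 / 4) ^ 2) - 1 / 4 with hh
  have hhs : ContDiff ℝ ∞ h :=
    (((hgs.pow 2).add contDiff_const).sqrt fun z => (hsq z).ne').sub contDiff_const
  have hh0 : ∀ z, 0 ≤ h z := fun z => by
    have : (1 / 4 : ℝ) ≤ √(g z ^ 2 + (1 / 4) ^ 2) := Real.le_sqrt_of_sq_le (by nlinarith [sq_nonneg (g z)])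
    simp only [hh]; linarith
  have hh1 : ∀ z, h z ≤ |g z| := fun z => by
    have : √(g z ^ 2 + (1 / 4) ^ 2) ≤ |g z| + 1 / 4 := Real.sqrt_le_iff.2
      ⟨by positivity, by nlinarith [sq_abs (g z), abs_nonneg (g z)]⟩
    simp only [hh]; linarith
  have hh2 : ∀ z, |g z| - 1 / 4 ≤ h z := fun z => by
    have : |g z| ≤ √(g z ^ 2 + (1 / 4) ^ 2) :=
      Real.le_sqrt_of_sq_le (by rw [sq_abs]; linarith [sq_nonneg (1 / 4 : ℝ)])
    simp only [hh]; linarith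
  have hfs : ContDiff ℝ ∞ (fun z => χ z * h z) := hχs.mul hhs
  have hfc : HasCompactSupport (fun z => χ z * h z) := χ.hasCompactSupport.mul_right
  refine ⟨fun z => χ z * h z, hfs, hfc, fun z => mul_nonneg χ.nonneg (hh0 z), fun z => ?_, fun z => ?_⟩
  · exact (mul_le_of_le_one_left (hh0 z) χ.le_one).trans (hh1 z)
  · have hb : BddSmooth (fun z => χ z * h z) := .of_hasCompactSupport hfs hfc
    have hgb : BddSmooth (fun z => g z) := .of_schwartz g
    have h1 : ∀ z, g z - 1 / 4 ≤ χ z * h z := fun z => by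
      by_cases hz : z ∈ closedBall (0 : PSpace N) r
      · rw [χ.one_of_mem_closedBall (closedBall_subset_closedBall (le_max_left _ _) hz), one_mul]
        linarith [hh2 z, le_abs_self (g z)]
      · have h2 : |g z| < 1 / 4 := hr hz
        have := mul_nonneg (χ.nonneg (x := z)) (hh0 z)
        linarith [le_abs_self (g z)]
    rw [← pot_density φ z]
    unfold pot
    have h3 : ∫ ξ, (g (z + shift ξ) - 1 / 4) ∂(potM N)
        ≤ ∫ ξ, χ (z + shift ξ) * h (z + shift ξ) ∂(potM N) :=
      integral_mono ((hgb.integrable_shift z).sub (integrable_const _)) (hb.integrable_shift z)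
        fun ξ => h1 _
    rw [integral_sub (hgb.integrable_shift z) (integrable_const _)] at h3
    simpa using h3

/-- The truncation applied to potentials: zero below `5/8` and one above `3/4`. -/
def trunc (s : ℝ) : ℝ := Real.smoothTransition (8 * s - 5)

lemma contDiff_trunc : ContDiff ℝ ∞ trunc :=
  Real.smoothTransition.contDiff.comp ((contDiff_const.mul contDiff_id).sub contDiff_const)

lemma trunc_eq_zero {s : ℝ} (hs : s ≤ 5 / 8) : trunc s = 0 :=
  Real.smoothTransition.zero_of_nonpos (by linarith)

lemma trunc_eq_one {s : ℝ} (hs : 3 / 4 ≤ s) : trunc s = 1 :=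
  Real.smoothTransition.one_of_one_le (by linarith)

lemma deriv_eq_zero_of_locally_const {H : ℝ → ℝ} {S : Set ℝ} (hS : IsOpen S) {c : ℝ}
    (h : ∀ s ∈ S, H s = c) {s : ℝ} (hs : s ∈ S) : deriv H s = 0 := by
  have : H =ᶠ[𝓝 s] fun _ => c := by filter_upwards [hS.mem_nhds hs] with t ht using h t ht
  rw [this.deriv_eq, deriv_const]

lemma deriv_trunc_eq_zero {s : ℝ} (hs : s ∈ Iio (5 / 8 : ℝ) ∪ Ioi (3 / 4)) : deriv trunc s = 0 := by
  rcases hs with hs | hs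
  · exact deriv_eq_zero_of_locally_const isOpen_Iio (fun t ht => trunc_eq_zero (le_of_lt ht)) hs
  · exact deriv_eq_zero_of_locally_const isOpen_Ioi (fun t ht => trunc_eq_one (le_of_lt ht)) hs

lemma deriv_deriv_trunc_eq_zero {s : ℝ} (hs : s ∈ Iio (5 / 8 : ℝ) ∪ Ioi (3 / 4)) :
    deriv (deriv trunc) s = 0 :=
  deriv_eq_zero_of_locally_const (isOpen_Iio.union isOpen_Ioi) (fun _ => deriv_trunc_eq_zero) hs

lemma exists_trunc_bound : ∃ K : ℝ, 1 ≤ K ∧ ∀ s, |deriv trunc s| ≤ K ∧ |deriv (deriv trunc) s| ≤ K := by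
  obtain ⟨K1, h1⟩ := (isCompact_Icc (a := (5 / 8 : ℝ)) (b := 3 / 4)).exists_bound_of_continuousOn
    (contDiff_deriv contDiff_trunc).continuous.continuousOn
  obtain ⟨K2, h2⟩ := (isCompact_Icc (a := (5 / 8 : ℝ)) (b := 3 / 4)).exists_bound_of_continuousOn
    (contDiff_deriv (contDiff_deriv contDiff_trunc)).continuous.continuousOn
  refine ⟨max 1 (max K1 K2), le_max_left _ _, fun s => ?_⟩
  by_cases hs : s ∈ Icc (5 / 8 : ℝ) (3 / 4)
  · exact ⟨(h1 s hs).trans ((le_max_left _ _).trans (le_max_right _ _)),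
      (h2 s hs).trans ((le_max_right _ _).trans (le_max_right _ _))⟩
  · have : s ∈ Iio (5 / 8 : ℝ) ∪ Ioi (3 / 4) := by
      simp only [mem_Icc, not_and_or, not_le] at hs
      exact hs
    rw [deriv_trunc_eq_zero this, deriv_deriv_trunc_eq_zero this, abs_zero]
    exact ⟨by positivity, by positivity⟩

lemma add_sum_rpow_le {ι : Type*} (s : Finset ι) {p : ℝ} (hp : 0 < p) {a b : ℝ} (ha : 0 ≤ a)
    (hb : 0 ≤ b) {d : ι → ℝ} (hd : ∀ i ∈ s, 0 ≤ d i) :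
    (a + b + ∑ i ∈ s, d i) ^ p ≤ (s.card + 2 : ℝ) ^ p * (a ^ p + b ^ p + ∑ i ∈ s, d i ^ p) := by
  have hsum : 0 ≤ ∑ i ∈ s, d i ^ p := Finset.sum_nonneg fun i hi => Real.rpow_nonneg (hd i hi) p
  have ha' : 0 ≤ a ^ p := by positivity
  have hb' : 0 ≤ b ^ p := by positivity
  set T := a ^ p + b ^ p + ∑ i ∈ s, d i ^ p with hT
  have key : ∀ {x : ℝ}, 0 ≤ x → x ^ p ≤ T → x ≤ T ^ (1 / p) := fun {x} hx h => by
    have := Real.rpow_le_rpow (by positivity) h (by positivity : 0 ≤ 1 / p)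
    rwa [← Real.rpow_mul hx, mul_one_div_cancel hp.ne', Real.rpow_one] at this
  have h1 : ∑ i ∈ s, d i ≤ s.card * T ^ (1 / p) := by
    rw [← nsmul_eq_mul]
    refine Finset.sum_le_card_nsmul _ _ _ fun i hi => key (hd i hi) ?_
    have : d i ^ p ≤ ∑ i ∈ s, d i ^ p := Finset.single_le_sum (f := fun i => d i ^ p)
      (fun i hi => Real.rpow_nonneg (hd i hi) p) hi
    linarith
  have h2 := key ha (by linarith)
  have h3 := key hb (by linarith)
  calc _ ≤ ((s.card + 2 : ℝ) * T ^ (1 / p)) ^ p := by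
        have := Finset.sum_nonneg hd
        refine Real.rpow_le_rpow (by positivity) ?_ hp.le
        linarith
    _ = _ := by
        rw [Real.mul_rpow (by positivity) (by positivity), ← Real.rpow_mul (by positivity),
          one_div_mul_cancel hp.ne', Real.rpow_one]

/-- Truncated potentials: a smooth cutoff equal to one near the given set with controlled
energy and small support. -/
lemma exists_cutoff (N : ℕ) {p : ℝ} (hp : 1 < p) : ∃ C κ : ℝ, 0 < C ∧ 0 < κ ∧
    ∀ (ρ : ℝ) (φ : SchwartzMap (PSpace N) ℝ) (U : Set (PSpace N)) (c : ℝ), 0 < ρ → ρ ≤ 1 →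
      (∀ z ∈ U, 1 ≤ φ z) → W21Norm N p (fun z => φ z) ^ p ≤ c → c ≤ κ * ρ ^ N →
      ∃ Y : PSpace N → ℝ, ContDiff ℝ ∞ Y ∧ (∀ z, 0 ≤ Y z) ∧ (∀ z, Y z ≤ 1) ∧
        (∀ z ∈ U, Y z = 1) ∧
        ∫⁻ z, ENNReal.ofReal (|heatL Y z| ^ p) ≤ ENNReal.ofReal (C * c) ∧
        (∀ i, ∫⁻ z, ENNReal.ofReal (|dx i Y z| ^ (2 * p)) ≤ ENNReal.ofReal (C * c)) ∧
        volume {z | Y z ≠ 0} ≤ ENNReal.ofReal (C * (ρ ^ (2 * p) * c)) := by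
  have hp0 : 0 < p := by linarith
  obtain ⟨C1, hC1, hgrad⟩ := grad_Lp N hp
  obtain ⟨K, hK1, hK⟩ := exists_trunc_bound
  have hg0 := gaussC_pos N
  set K' : ℝ := (K * (N + 2)) ^ p with hK'
  have hK'0 : 0 < K' := by positivity
  set C := K' * (4 ^ p + 1 + N * C1) + K ^ (2 * p) * C1 + 4 ^ p with hC
  have hCa : K' * (4 ^ p + 1 + N * C1) ≤ C := by
    have : 0 < K ^ (2 * p) * C1 := by positivity
    have : (0 : ℝ) < 4 ^ p := by positivity
    linarith
  have hCb : K ^ (2 * p) * C1 ≤ C := by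
    have : 0 < K' * (4 ^ p + 1 + N * C1) := by positivity
    have : (0 : ℝ) < 4 ^ p := by positivity
    linarith
  have hCc : 4 ^ p ≤ C := by
    have : 0 < K' * (4 ^ p + 1 + N * C1) := by positivity
    have : 0 < K ^ (2 * p) * C1 := by positivity
    linarith
  refine ⟨C, (1 / 4) ^ p / gaussC N, by positivity, by positivity,
    fun ρ φ U c hρ hρ1 hU hc hcκ => ?_⟩
  obtain ⟨f, hf, hfc, hf0, hfg, hfφ⟩ := exists_density φ
  have hb : BddSmooth f := .of_hasCompactSupport hf hfc
  set V := pot f with hV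
  have hVb : BddSmooth V := hb.pot
  set A := ∫⁻ z, ENNReal.ofReal (f z ^ p) with hA
  have hAc : A ≤ ENNReal.ofReal c := by
    calc A ≤ ∫⁻ z, ENNReal.ofReal (|density φ z| ^ p) := by
          refine lintegral_mono fun z => ENNReal.ofReal_le_ofReal ?_
          exact Real.rpow_le_rpow (hf0 z) (hfg z) hp0.le
      _ ≤ _ := (lintegral_density_le hp.le φ).trans (ENNReal.ofReal_le_ofReal hc)
  have hmulA : ∀ {a b : ℝ}, 0 ≤ a → a ≤ b → ENNReal.ofReal a * A ≤ ENNReal.ofReal (b * c) :=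
    fun {a b} ha hab => by
      rw [ENNReal.ofReal_mul (ha.trans hab)]
      gcongr
  have hvol : volume {z | 1 / 2 < V z} ≤ ENNReal.ofReal (4 ^ p * ρ ^ (2 * p)) * A := by
    refine volume_pot_le hp hb hf0 hρ ((hmulA (by positivity) le_rfl).trans ?_)
    refine ENNReal.ofReal_le_ofReal ?_
    calc gaussC N * (ρ ^ N)⁻¹ * c ≤ gaussC N * (ρ ^ N)⁻¹ * ((1 / 4) ^ p / gaussC N * ρ ^ N) := by
          gcongr
      _ = _ := by field_simp
  have hρp : ρ ^ (2 * p) ≤ 1 := Real.rpow_le_one hρ.le hρ1 (by positivity)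
  have hvol1 : volume {z | 1 / 2 < V z} ≤ ENNReal.ofReal (4 ^ p) * A := by
    refine hvol.trans ?_
    gcongr
    exact mul_le_of_le_one_right (by positivity) hρp
  have hcV := hVb.continuous.measurable
  have hdm : ∀ i, Measurable (dx i V) := fun i => (hVb.dx i).continuous.measurable
  have mE : MeasurableSet {z | 1 / 2 < V z} := measurableSet_lt measurable_const hcV
  have mS : MeasurableSet {z | V z < 1} := measurableSet_lt hcV measurable_const
  have hout : ∀ z, ¬(1 / 2 < V z ∧ V z < 1) → V z ∈ Iio (5 / 8 : ℝ) ∪ Ioi (3 / 4) := fun z hz => by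
    rcases le_or_gt (V z) (1 / 2) with h | h
    · left; change V z < 5 / 8; linarith
    · right
      have : 1 ≤ V z := by by_contra h'; exact hz ⟨h, not_le.1 h'⟩
      change 3 / 4 < V z; linarith
  have hdY : ∀ i z, dx i (fun z => trunc (V z)) z = deriv trunc (V z) * dx i V z := fun i z =>
    congrFun (dx_comp contDiff_trunc hVb.smooth i) z
  refine ⟨fun z => trunc (V z), contDiff_trunc.comp hVb.smooth,
    fun z => Real.smoothTransition.nonneg _, fun z => Real.smoothTransition.le_one _,
    fun z hz => trunc_eq_one (by linarith [hU z hz, hfφ z]), ?_, fun i => ?_, ?_⟩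
  · have hpt : ∀ z, ENNReal.ofReal (|heatL (fun z => trunc (V z)) z| ^ p) ≤ ENNReal.ofReal K' *
        ({z | 1 / 2 < V z}.indicator 1 z + ENNReal.ofReal (f z ^ p)
          + ∑ i, {z | V z < 1}.indicator (fun z => ENNReal.ofReal (|dx i V z| ^ (2 * p))) z) := by
      intro z
      rw [heatL_comp contDiff_trunc hVb.smooth z]
      by_cases hz : 1 / 2 < V z ∧ V z < 1
      · have hzE : z ∈ {z | 1 / 2 < V z} := hz.1
        have hzS : z ∈ {z | V z < 1} := hz.2
        simp only [indicator_of_mem hzE, indicator_of_mem hzS, Pi.one_apply]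
        rw [← ENNReal.ofReal_one, ← ENNReal.ofReal_add zero_le_one (Real.rpow_nonneg (hf0 z) p),
          ← ENNReal.ofReal_sum_of_nonneg (fun i _ => by positivity),
          ← ENNReal.ofReal_add (by have := Real.rpow_nonneg (hf0 z) p; positivity)
            (Finset.sum_nonneg fun i _ => by positivity),
          ← ENNReal.ofReal_mul hK'0.le]
        refine ENNReal.ofReal_le_ofReal ?_
        have h1 := add_sum_rpow_le Finset.univ hp0 zero_le_one (hf0 z)
          (d := fun i => dx i V z ^ 2) (fun i _ => sq_nonneg _)
        rw [Real.one_rpow, Finset.card_univ, Fintype.card_fin] at h1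
        have h2 : |deriv trunc (V z) * heatL V z + deriv (deriv trunc) (V z) * gsq V z|
            ≤ K * (1 + f z + gsq V z) := by
          rw [hV, heatL_pot_eq hb, ← hV]
          have q1 := (hK (V z)).1
          have q2 := (hK (V z)).2
          have q3 : |V z - f z| ≤ 1 + f z := by
            rw [abs_le]; constructor <;> linarith [hf0 z, hz.1, hz.2]
          have q4 := gsq_nonneg V z
          calc _ ≤ |deriv trunc (V z)| * |V z - f z| + |deriv (deriv trunc) (V z)| * gsq V z := by
                refine (abs_add_le _ _).trans ?_
                rw [abs_mul, abs_mul, abs_of_nonneg q4]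
            _ ≤ K * (1 + f z) + K * gsq V z := by gcongr
            _ = _ := by ring
        have q4 := gsq_nonneg V z
        have hfz := hf0 z
        calc _ ≤ (K * (1 + f z + gsq V z)) ^ p := by gcongr
          _ = K ^ p * (1 + f z + gsq V z) ^ p := Real.mul_rpow (by positivity) (by positivity)
          _ ≤ K ^ p * ((N + 2 : ℝ) ^ p * (1 + f z ^ p + ∑ i : Fin N, (dx i V z ^ 2) ^ p)) := by
              gcongr
              exact h1
          _ = _ := by
              have h3 : ∀ i, (dx i V z ^ 2) ^ p = |dx i V z| ^ (2 * p) := fun i => by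
                rw [← sq_abs, ← Real.rpow_natCast, ← Real.rpow_mul (abs_nonneg _)]
                norm_num
              rw [hK', Real.mul_rpow (by positivity) (by positivity), mul_assoc]
              simp_rw [h3]
      · rw [deriv_trunc_eq_zero (hout z hz), deriv_deriv_trunc_eq_zero (hout z hz)]
        simp [Real.zero_rpow hp0.ne']
    calc _ ≤ _ := lintegral_mono hpt
      _ = ENNReal.ofReal K' * (volume {z | 1 / 2 < V z} + A
          + ∑ i, ∫⁻ z in {z | V z < 1}, ENNReal.ofReal (|dx i V z| ^ (2 * p))) := by
        have m1 : Measurable ({z | 1 / 2 < V z}.indicator (1 : PSpace N → ℝ≥0∞)) :=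
          measurable_one.indicator mE
        have m2 : Measurable fun z => ENNReal.ofReal (f z ^ p) :=
          (hf.continuous.measurable.pow_const p).ennreal_ofReal
        have m3 : ∀ i, Measurable fun z => ENNReal.ofReal (|dx i V z| ^ (2 * p)) := fun i => by
          have := hdm i
          fun_prop
        have m12 : Measurable fun z => {z | 1 / 2 < V z}.indicator (1 : PSpace N → ℝ≥0∞) z
            + ENNReal.ofReal (f z ^ p) := m1.add m2
        rw [lintegral_const_mul' _ _ ENNReal.ofReal_ne_top, lintegral_add_left m12,
          lintegral_add_left m1, lintegral_indicator_one mE,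
          lintegral_finsetSum _ fun i _ => (m3 i).indicator mS]
        simp_rw [lintegral_indicator mS]
        rfl
      _ ≤ ENNReal.ofReal K' * (ENNReal.ofReal (4 ^ p) * A + A
          + ∑ i : Fin N, ENNReal.ofReal C1 * A) := by
        gcongr with i
        exact hgrad f hf hfc hf0 i
      _ = ENNReal.ofReal (K' * (4 ^ p + 1 + N * C1)) * A := by
        rw [Finset.sum_const, Finset.card_univ, Fintype.card_fin, ENNReal.ofReal_mul hK'0.le,
          ENNReal.ofReal_add (by positivity) (by positivity),
          ENNReal.ofReal_add (by positivity) zero_le_one, ENNReal.ofReal_mul (by positivity),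
          ENNReal.ofReal_one, ENNReal.ofReal_natCast, nsmul_eq_mul]
        ring
      _ ≤ _ := hmulA (by positivity) hCa
  · have hpt : ∀ z, ENNReal.ofReal (|dx i (fun z => trunc (V z)) z| ^ (2 * p))
        ≤ ENNReal.ofReal (K ^ (2 * p)) *
          {z | V z < 1}.indicator (fun z => ENNReal.ofReal (|dx i V z| ^ (2 * p))) z := by
      intro z
      rw [hdY]
      by_cases hz : 1 / 2 < V z ∧ V z < 1
      · have hzS : z ∈ {z | V z < 1} := hz.2
        rw [indicator_of_mem hzS, ← ENNReal.ofReal_mul (by positivity),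
          ← Real.mul_rpow (by positivity) (by positivity), abs_mul]
        have := (hK (V z)).1
        gcongr
      · rw [deriv_trunc_eq_zero (hout z hz)]
        simp [Real.zero_rpow (by positivity : 2 * p ≠ 0)]
    calc _ ≤ _ := lintegral_mono hpt
      _ = ENNReal.ofReal (K ^ (2 * p)) *
          ∫⁻ z in {z | V z < 1}, ENNReal.ofReal (|dx i V z| ^ (2 * p)) := by
        rw [lintegral_const_mul' _ _ ENNReal.ofReal_ne_top, lintegral_indicator mS]
      _ ≤ ENNReal.ofReal (K ^ (2 * p)) * (ENNReal.ofReal C1 * A) := by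
        gcongr
        exact hgrad f hf hfc hf0 i
      _ = ENNReal.ofReal (K ^ (2 * p) * C1) * A := by
        rw [ENNReal.ofReal_mul (by positivity), mul_assoc]
      _ ≤ _ := hmulA (by positivity) hCb
  · calc _ ≤ volume {z | 1 / 2 < V z} := by
          refine measure_mono fun z hz => ?_
          change 1 / 2 < V z
          by_contra h
          exact hz (trunc_eq_zero (by linarith))
      _ ≤ _ := hvol
      _ ≤ _ := by
        rw [← mul_assoc]
        exact hmulA (by positivity) (by gcongr)

lemma W21Norm_nonneg (N : ℕ) (p : ℝ) (φ : PSpace N → ℝ) : 0 ≤ W21Norm N p φ := by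
  unfold W21Norm; positivity

lemma exists_schwartz_one_le {E : Set (PSpace N)} (hE : Bornology.IsBounded E) :
    ∃ φ : SchwartzMap (PSpace N) ℝ, ∃ U, IsOpen U ∧ E ⊆ U ∧ ∀ z ∈ U, 1 ≤ φ z := by
  obtain ⟨r, hr0, hr⟩ := hE.subset_ball_lt 0 (0 : PSpace N)
  let χ : ContDiffBump (0 : PSpace N) := ⟨r, r + 1, hr0, by linarith⟩
  have hs : ContDiff ℝ ∞ (fun z => χ z) := χ.contDiff
  refine ⟨χ.hasCompactSupport.toSchwartzMap hs, ball 0 r, isOpen_ball, hr, fun z hz => ?_⟩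
  exact (χ.one_of_mem_closedBall (ball_subset_closedBall hz)).ge

/-- The values over which the capacity of a compact set is minimised. -/
def capVals (N : ℕ) (p : ℝ) (K : Set (PSpace N)) : Set ℝ :=
  { c | ∃ φ : SchwartzMap (PSpace N) ℝ,
    (∃ U, IsOpen U ∧ K ⊆ U ∧ ∀ z ∈ U, 1 ≤ φ z) ∧ c = W21Norm N p (fun z => φ z) ^ p }

lemma bddBelow_capVals (p : ℝ) (K : Set (PSpace N)) : BddBelow (capVals N p K) :=
  ⟨0, by rintro _ ⟨φ, _, rfl⟩; exact Real.rpow_nonneg (W21Norm_nonneg _ _ _) _⟩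

lemma cap21c_nonneg (p : ℝ) (K : Set (PSpace N)) : 0 ≤ cap21c N p K :=
  Real.sInf_nonneg (by rintro _ ⟨φ, _, rfl⟩; exact Real.rpow_nonneg (W21Norm_nonneg _ _ _) _)

lemma cap21c_le_cap21 {p : ℝ} {D E : Set (PSpace N)} (hE : Bornology.IsBounded E) (hD : D ⊆ E)
    (hDc : IsCompact D) : cap21c N p D ≤ cap21 N p E := by
  obtain ⟨φ, U, hU, hEU, h1⟩ := exists_schwartz_one_le hE
  refine le_csSup ⟨W21Norm N p (fun z => φ z) ^ p, ?_⟩ ⟨D, hD, hDc, rfl⟩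
  rintro _ ⟨D', hD', -, rfl⟩
  exact csInf_le (bddBelow_capVals p D') ⟨φ, ⟨U, hU, hD'.trans hEU, h1⟩, rfl⟩

lemma exists_lt_cap21c_add {p : ℝ} {D : Set (PSpace N)} (hD : Bornology.IsBounded D) {ε : ℝ}
    (hε : 0 < ε) : ∃ φ : SchwartzMap (PSpace N) ℝ, ∃ U, IsOpen U ∧ D ⊆ U ∧ (∀ z ∈ U, 1 ≤ φ z) ∧
      W21Norm N p (fun z => φ z) ^ p ≤ cap21c N p D + ε := by
  obtain ⟨φ, U, hU, hDU, h1⟩ := exists_schwartz_one_le hD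
  have hne : (capVals N p D).Nonempty := ⟨_, φ, ⟨U, hU, hDU, h1⟩, rfl⟩
  obtain ⟨_, ⟨φ, ⟨U, hU, hDU, h1⟩, rfl⟩, hlt⟩ := exists_lt_of_csInf_lt hne
    (show sInf (capVals N p D) < cap21c N p D + ε by
      change cap21c N p D < _; linarith)
  exact ⟨φ, U, hU, hDU, h1, hlt.le⟩

/-- The part of the complement of `O` in the closed lower half cylinder of radius `2ρ`. -/
def lowerCompl (O : Set (PSpace N)) (z₀ : PSpace N) (ρ : ℝ) : Set (PSpace N) :=
  Oᶜ ∩ closedBall z₀.1 (2 * ρ) ×ˢ Icc (z₀.2 - 2 * ρ ^ 2) z₀.2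

lemma isCompact_lowerCompl {O : Set (PSpace N)} (hO : IsOpen O) (z₀ : PSpace N) (ρ : ℝ) :
    IsCompact (lowerCompl O z₀ ρ) :=
  ((isCompact_closedBall _ _).prod isCompact_Icc).inter_left hO.isClosed_compl

lemma isBounded_pQ (ρ : ℝ) (z : PSpace N) : Bornology.IsBounded (pQ N ρ z) :=
  isBounded_ball.prod (isBounded_Ioc _ _)

lemma lowerCompl_subset {O : Set (PSpace N)} (z₀ : PSpace N) {ρ R : ℝ} (hρ : 0 < ρ) (h : 2 * ρ < R) :
    lowerCompl O z₀ ρ ⊆ Oᶜ ∩ pQ N R z₀ := by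
  rintro z ⟨hz, h1, h2, h3⟩
  refine ⟨hz, ?_, ?_, h3⟩
  · exact closedBall_subset_ball h h1
  · nlinarith

lemma exists_capacity_seq {O : Set (PSpace N)} (hO : IsOpen O) (z₀ : PSpace N) (p : ℝ)
    (hfin : ∫⁻ ρ in Ioo (0 : ℝ) 1,
      ENNReal.ofReal (cap21 N p (Oᶜ ∩ pQ N ρ z₀) / ρ ^ (N + 1)) ≠ ⊤) :
    ∃ c : ℕ → ℝ, (∀ i, 0 ≤ c i) ∧ Summable (fun i => c i * (((1 / 2 : ℝ) ^ i) ^ N)⁻¹) ∧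
      ∀ i, ∃ φ : SchwartzMap (PSpace N) ℝ, ∃ U, IsOpen U ∧ lowerCompl O z₀ ((1 / 2) ^ i) ⊆ U ∧
        (∀ z ∈ U, 1 ≤ φ z) ∧ W21Norm N p (fun z => φ z) ^ p ≤ c i := by
  set ρ : ℕ → ℝ := fun i => (1 / 2) ^ i with hρ
  have hρ0 : ∀ i, 0 < ρ i := fun i => by positivity
  set b : ℕ → ℝ := fun i => cap21c N p (lowerCompl O z₀ (ρ i)) with hb
  have hb0 : ∀ i, 0 ≤ b i := fun i => cap21c_nonneg _ _
  have hsb : Summable fun i => b i * (ρ i ^ N)⁻¹ := by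
    set g : ℝ → ℝ≥0∞ := fun R => ENNReal.ofReal (cap21 N p (Oᶜ ∩ pQ N R z₀) / R ^ (N + 1)) with hg
    set I : ℕ → Set ℝ := fun i => Ioo (2 * ρ (i + 2)) (4 * ρ (i + 2)) with hI
    have hdisj : Pairwise (Function.onFun Disjoint I) := by
      refine (pairwise_disjoint_on I).2 fun i j hij => Set.disjoint_left.2 fun R h1 h2 => ?_
      have : ρ (j + 2) ≤ ρ (i + 3) := pow_le_pow_of_le_one (by norm_num) (by norm_num) (by omega)
      have h3 : ρ (i + 3) = ρ (i + 2) / 2 := by simp only [hρ]; ring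
      have := h1.1
      have := h2.2
      linarith
    have hsub : (⋃ i, I i) ⊆ Ioo 0 1 := by
      refine iUnion_subset fun i R hR => ⟨by linarith [hR.1, hρ0 (i + 2)], ?_⟩
      have : ρ (i + 2) ≤ 1 / 4 := by
        have h2 : ρ 2 = 1 / 4 := by norm_num [hρ]
        have h3 : ρ (i + 2) ≤ ρ 2 := pow_le_pow_of_le_one (by norm_num) (by norm_num) (by omega)
        exact h3.trans_eq h2
      linarith [hR.2]
    have h1 : ∑' i, ∫⁻ R in I i, g R ≠ ⊤ := by
      rw [← lintegral_iUnion (fun i => measurableSet_Ioo) hdisj]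
      exact ne_top_of_le_ne_top hfin (lintegral_mono_set hsub)
    have h2 : ∀ i, ENNReal.ofReal ((2 * (4 ^ (N + 1))⁻¹) * (b (i + 2) * (ρ (i + 2) ^ N)⁻¹))
        ≤ ∫⁻ R in I i, g R := fun i => by
      have hr := hρ0 (i + 2)
      calc _ = ENNReal.ofReal (b (i + 2) / (4 * ρ (i + 2)) ^ (N + 1)) * volume (I i) := by
            rw [hI, Real.volume_Ioo, ← ENNReal.ofReal_mul (by have := hb0 (i + 2); positivity)]
            congr 1
            rw [mul_pow]
            field_simp
            ring
        _ = ∫⁻ R in I i, ENNReal.ofReal (b (i + 2) / (4 * ρ (i + 2)) ^ (N + 1)) := by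
            rw [setLIntegral_const]
        _ ≤ _ := by
            refine setLIntegral_mono' measurableSet_Ioo fun R hR => ENNReal.ofReal_le_ofReal ?_
            have hR0 : 0 < R := by linarith [hR.1]
            have h3 : b (i + 2) ≤ cap21 N p (Oᶜ ∩ pQ N R z₀) :=
              cap21c_le_cap21 ((isBounded_pQ R z₀).subset inter_subset_right)
                (lowerCompl_subset z₀ hr hR.1) (isCompact_lowerCompl hO _ _)
            have h4 := hb0 (i + 2)
            have h5 : 0 ≤ cap21 N p (Oᶜ ∩ pQ N R z₀) := h4.trans h3
            have h6 := hR.2.le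
            gcongr
    have h3 : ∑' i, ENNReal.ofReal ((2 * (4 ^ (N + 1))⁻¹) * (b (i + 2) * (ρ (i + 2) ^ N)⁻¹)) ≠ ⊤ :=
      ne_top_of_le_ne_top h1 (ENNReal.tsum_le_tsum h2)
    have h4 := ENNReal.summable_toReal h3
    have h5 : Summable fun i => (2 * ((4 : ℝ) ^ (N + 1))⁻¹) * (b (i + 2) * (ρ (i + 2) ^ N)⁻¹) := by
      refine h4.congr fun i => ENNReal.toReal_ofReal ?_
      have := hb0 (i + 2)
      have := hρ0 (i + 2)
      positivity
    have h6 := (summable_mul_left_iff (by positivity : (2 * ((4 : ℝ) ^ (N + 1))⁻¹) ≠ 0)).1 h5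
    exact (summable_nat_add_iff 2).1 h6
  refine ⟨fun i => b i + (1 / 2) ^ i * ρ i ^ N, fun i => add_nonneg (hb0 i) (by positivity), ?_,
    fun i => exists_lt_cap21c_add (isCompact_lowerCompl hO _ _).isBounded (by positivity)⟩
  refine (hsb.add summable_geometric_two).congr fun i => ?_
  have := hρ0 i
  simp only [hρ]
  field_simp

lemma fderiv_eq_of_hasDerivAt {f : PSpace N → ℝ} (hf : ContDiff ℝ ∞ f) {z v : PSpace N} {d : ℝ}
    (h : HasDerivAt (fun r : ℝ => f (z + r • v)) d 0) : fderiv ℝ f z v = d := by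
  have h1 : HasLineDerivAt ℝ f d z v := h
  rw [← (differentiable_of_contDiff hf z).lineDeriv_eq_fderiv, h1.lineDeriv]

/-- A smooth positive function equal to `τ - s` for `s ≤ 0`. -/
def sTime (τ s : ℝ) : ℝ := τ - s * (1 - Real.smoothTransition (s / τ))

lemma contDiff_sTime (τ : ℝ) : ContDiff ℝ ∞ (sTime τ) := by
  have h : ContDiff ℝ ∞ fun s : ℝ => Real.smoothTransition (s / τ) :=
    Real.smoothTransition.contDiff.comp (contDiff_id.div_const τ)
  unfold sTime
  fun_prop

lemma sTime_of_nonpos {τ s : ℝ} (hτ : 0 < τ) (hs : s ≤ 0) : sTime τ s = τ - s := by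
  simp [sTime, Real.smoothTransition.zero_of_nonpos (div_nonpos_of_nonpos_of_nonneg hs hτ.le)]

lemma sTime_pos {τ : ℝ} (hτ : 0 < τ) (s : ℝ) : 0 < sTime τ s := by
  rcases le_or_gt s 0 with hs | hs
  · rw [sTime_of_nonpos hτ hs]; linarith
  have h0 := Real.smoothTransition.nonneg (s / τ)
  rcases le_or_gt τ s with h | h
  · rw [sTime, Real.smoothTransition.one_of_one_le ((one_le_div hτ).2 h)]; simpa using hτ
  · unfold sTime; nlinarith

/-- Logarithm of the backward heat kernel with pole at distance `τ` in the future of `z₀`. -/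
def logKer (z₀ : PSpace N) (τ : ℝ) (z : PSpace N) : ℝ :=
  -(N / 2) * Real.log (sTime τ (z.2 - z₀.2)) - ‖z.1 - z₀.1‖ ^ 2 / (4 * sTime τ (z.2 - z₀.2))

/-- The backward heat kernel, modified for later times so as to be smooth. -/
def ker (z₀ : PSpace N) (τ : ℝ) (z : PSpace N) : ℝ := Real.exp (logKer z₀ τ z)

section
variable {z₀ z : PSpace N} {τ : ℝ}

lemma contDiff_sTime_sub (z₀ : PSpace N) (τ : ℝ) :
    ContDiff ℝ ∞ fun z : PSpace N => sTime τ (z.2 - z₀.2) :=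
  (contDiff_sTime τ).comp (contDiff_snd.sub contDiff_const)

lemma contDiff_logKer (hτ : 0 < τ) : ContDiff ℝ ∞ (logKer z₀ τ) := by
  have h1 := contDiff_sTime_sub z₀ τ
  have h2 : ContDiff ℝ ∞ fun z : PSpace N => ‖z.1 - z₀.1‖ ^ 2 :=
    (contDiff_fst.sub contDiff_const).norm_sq ℝ
  exact (contDiff_const.mul (h1.log fun z => (sTime_pos hτ _).ne')).sub
    (h2.div (contDiff_const.mul h1) fun z => by have := sTime_pos hτ (z.2 - z₀.2); positivity)

lemma contDiff_ker (hτ : 0 < τ) : ContDiff ℝ ∞ (ker z₀ τ) := Real.contDiff_exp.comp (contDiff_logKer hτ)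

lemma ker_pos (z₀ : PSpace N) (τ : ℝ) (z : PSpace N) : 0 < ker z₀ τ z := Real.exp_pos _

lemma norm_add_single_sq (x : EuclideanSpace ℝ (Fin N)) (i : Fin N) (r : ℝ) :
    ‖x + r • EuclideanSpace.single i (1 : ℝ)‖ ^ 2 = ‖x‖ ^ 2 + 2 * r * x i + r ^ 2 := by
  rw [norm_add_sq_real, inner_smul_right, norm_smul, EuclideanSpace.inner_single_right]
  simp
  ring

lemma dx_logKer (hτ : 0 < τ) (i : Fin N) :
    dx i (logKer z₀ τ) = fun z => -((z.1 i - z₀.1 i) / (2 * sTime τ (z.2 - z₀.2))) := by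
  funext z
  refine fderiv_eq_of_hasDerivAt (contDiff_logKer hτ) ?_
  have h : (fun r : ℝ => logKer z₀ τ (z + r • eX i)) = fun r =>
      -(N / 2) * Real.log (sTime τ (z.2 - z₀.2)) - (‖z.1 - z₀.1‖ ^ 2 + 2 * r * (z.1 i - z₀.1 i) + r ^ 2)
        / (4 * sTime τ (z.2 - z₀.2)) := by
    funext r
    have := norm_add_single_sq (z.1 - z₀.1) i r
    simp only [logKer, eX, Prod.fst_add, Prod.snd_add, Prod.smul_fst, Prod.smul_snd, smul_zero,
      add_zero, add_sub_right_comm, this, PiLp.sub_apply]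
  rw [h]
  have := (sTime_pos hτ (z.2 - z₀.2)).ne'
  have h1 : HasDerivAt (fun r : ℝ => ‖z.1 - z₀.1‖ ^ 2 + 2 * r * (z.1 i - z₀.1 i) + r ^ 2)
      (2 * (z.1 i - z₀.1 i)) 0 :=
    (((((hasDerivAt_id (0 : ℝ)).const_mul 2).mul_const _).const_add _).add
      (hasDerivAt_pow 2 (0 : ℝ))).congr_deriv (by simp)
  refine ((h1.div_const _).const_sub _).congr_deriv ?_
  field_simp
  norm_num
  ring

lemma dx_dx_logKer (hτ : 0 < τ) (i : Fin N) (z : PSpace N) :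
    dx i (dx i (logKer z₀ τ)) z = -(1 / (2 * sTime τ (z.2 - z₀.2))) := by
  refine fderiv_eq_of_hasDerivAt (contDiff_dx (contDiff_logKer hτ) i) ?_
  rw [dx_logKer hτ]
  have h : (fun r : ℝ => -(((z + r • eX i).1 i - z₀.1 i) / (2 * sTime τ ((z + r • eX i).2 - z₀.2))))
      = fun r => -((z.1 i + r - z₀.1 i) / (2 * sTime τ (z.2 - z₀.2))) := by
    funext r
    simp [eX]
  rw [h]
  exact ((((hasDerivAt_id (0 : ℝ)).const_add _).sub_const _).div_const _).neg

lemma dt_logKer (hτ : 0 < τ) (hz : z.2 < z₀.2) :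
    dt (logKer z₀ τ) z = N / (2 * sTime τ (z.2 - z₀.2))
      - ‖z.1 - z₀.1‖ ^ 2 / (4 * sTime τ (z.2 - z₀.2) ^ 2) := by
  refine fderiv_eq_of_hasDerivAt (contDiff_logKer hτ) ?_
  have hS := sTime_pos hτ (z.2 - z₀.2)
  have h0 : HasDerivAt (fun r : ℝ => sTime τ (z.2 + r - z₀.2)) (-1) 0 := by
    have h1 : (fun r : ℝ => sTime τ (z.2 + r - z₀.2)) =ᶠ[𝓝 0] fun r => τ - (z.2 + r - z₀.2) := by
      filter_upwards [gt_mem_nhds (sub_pos.2 hz)] with r hr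
      exact sTime_of_nonpos hτ (by linarith)
    refine HasDerivAt.congr_of_eventuallyEq ?_ h1
    exact (((hasDerivAt_id (0 : ℝ)).const_add _).sub_const _).const_sub _
  have h : (fun r : ℝ => logKer z₀ τ (z + r • eT N)) = fun r =>
      -(N / 2) * Real.log (sTime τ (z.2 + r - z₀.2)) - ‖z.1 - z₀.1‖ ^ 2
        / (4 * sTime τ (z.2 + r - z₀.2)) := by
    funext r
    simp [logKer, eT]
  rw [h]
  have h2 : sTime τ (z.2 + 0 - z₀.2) ≠ 0 := by simpa using hS.ne'
  refine (((h0.log h2).const_mul _).sub ((hasDerivAt_const (0 : ℝ) (‖z.1 - z₀.1‖ ^ 2)).div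
    (h0.const_mul 4) (by simpa using h2))).congr_deriv ?_
  simp only [add_zero]
  field_simp
  ring

lemma heatL_ker (hτ : 0 < τ) (hz : z.2 < z₀.2) : heatL (ker z₀ τ) z = 0 := by
  have h := heatL_comp Real.contDiff_exp (contDiff_logKer (z₀ := z₀) hτ) z
  have h2 : heatL (logKer z₀ τ) z + gsq (logKer z₀ τ) z = 0 := by
    have hS := sTime_pos hτ (z.2 - z₀.2)
    simp only [heatL, gsq, dx_dx_logKer hτ, dt_logKer hτ hz]
    simp only [dx_logKer hτ, EuclideanSpace.norm_sq_eq, Real.norm_eq_abs, sq_abs, PiLp.sub_apply,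
      neg_sq, div_pow, ← Finset.sum_div, Finset.sum_const, Finset.card_univ, Fintype.card_fin,
      nsmul_eq_mul]
    generalize sTime τ (z.2 - z₀.2) = S at hS ⊢
    field_simp
    ring
  have h3 : heatL (ker z₀ τ) z = heatL (fun w => Real.exp (logKer z₀ τ w)) z := rfl
  rw [h3, h]
  simp only [Real.deriv_exp]
  linear_combination Real.exp (logKer z₀ τ z) * h2

lemma dx_ker (hτ : 0 < τ) (i : Fin N) (z : PSpace N) :
    dx i (ker z₀ τ) z = -((z.1 i - z₀.1 i) / (2 * sTime τ (z.2 - z₀.2))) * ker z₀ τ z := by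
  have h := congrFun (dx_comp Real.contDiff_exp (contDiff_logKer (z₀ := z₀) hτ) i) z
  have h3 : dx i (ker z₀ τ) z = dx i (fun w => Real.exp (logKer z₀ τ w)) z := rfl
  rw [h3, h]
  simp only [Real.deriv_exp, dx_logKer hτ, ker]
  ring

end

lemma exists_ker_le (N k : ℕ) : ∃ C, 0 < C ∧ ∀ (z₀ z : PSpace N) (τ ρ : ℝ), 0 < τ → 0 < ρ →
    ρ ^ 2 / 4 ≤ ‖z.1 - z₀.1‖ ^ 2 + sTime τ (z.2 - z₀.2) →
    ker z₀ τ z * (1 + ρ ^ 2 / sTime τ (z.2 - z₀.2)) ^ k ≤ C * (ρ ^ N)⁻¹ := by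
  refine ⟨Real.exp (5 / 16) * (16 ^ (N + k) * (N + k).factorial), by positivity,
    fun z₀ z τ ρ hτ hρ h => ?_⟩
  set S := sTime τ (z.2 - z₀.2) with hSdef
  have hS : 0 < S := sTime_pos hτ _
  set y := ρ ^ 2 / S with hy
  have hy0 : 0 < y := by positivity
  have h1 : logKer z₀ τ z ≤ -(N * Real.log ρ) + N * Real.log (1 + y) + (5 / 16 - (1 + y) / 16) := by
    have e1 : Real.log S = 2 * Real.log ρ - Real.log y := by
      rw [hy, Real.log_div (by positivity) hS.ne', Real.log_pow]; push_cast; ring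
    have e2 : Real.log y ≤ Real.log (1 + y) := Real.log_le_log hy0 (by linarith)
    have e3 : 0 ≤ Real.log (1 + y) := Real.log_nonneg (by linarith)
    have e4 : y / 16 - 1 / 4 ≤ ‖z.1 - z₀.1‖ ^ 2 / (4 * S) := by
      rw [le_div_iff₀ (by positivity)]
      have : (y / 16 - 1 / 4) * (4 * S) = ρ ^ 2 / 4 - S := by rw [hy]; field_simp; ring
      linarith
    have hN : (0 : ℝ) ≤ N := Nat.cast_nonneg N
    simp only [logKer, ← hSdef, e1]
    nlinarith [mul_le_mul_of_nonneg_left e2 hN, mul_nonneg hN e3]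
  have h2 : ker z₀ τ z ≤ (ρ ^ N)⁻¹ * (1 + y) ^ N * (Real.exp (5 / 16) * (Real.exp ((1 + y) / 16))⁻¹) := by
    refine (Real.exp_le_exp.2 h1).trans_eq ?_
    rw [Real.exp_add, Real.exp_add, Real.exp_neg, Real.exp_sub, Real.exp_nat_mul, Real.exp_nat_mul,
      Real.exp_log hρ, Real.exp_log (by linarith)]
    ring
  have h3 := Real.pow_div_factorial_le_exp ((1 + y) / 16) (by positivity) (N + k)
  rw [div_pow, div_div, div_le_iff₀ (by positivity)] at h3
  have h4 : 0 < Real.exp ((1 + y) / 16) := Real.exp_pos _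
  calc ker z₀ τ z * (1 + y) ^ k
      ≤ (ρ ^ N)⁻¹ * (1 + y) ^ N * (Real.exp (5 / 16) * (Real.exp ((1 + y) / 16))⁻¹) * (1 + y) ^ k := by
        gcongr
    _ = (ρ ^ N)⁻¹ * Real.exp (5 / 16) * ((Real.exp ((1 + y) / 16))⁻¹ * (1 + y) ^ (N + k)) := by
        rw [pow_add]; ring
    _ ≤ (ρ ^ N)⁻¹ * Real.exp (5 / 16) * ((Real.exp ((1 + y) / 16))⁻¹ *
          (Real.exp ((1 + y) / 16) * (16 ^ (N + k) * (N + k).factorial))) := by gcongr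
    _ = _ := by rw [inv_mul_cancel_left₀ h4.ne']; ring

lemma exists_le_ker (N : ℕ) : ∃ c, 0 < c ∧ ∀ (z₀ z : PSpace N) (r : ℝ), 0 < r →
    ‖z.1 - z₀.1‖ ≤ r → -r ^ 2 ≤ z.2 - z₀.2 → z.2 ≤ z₀.2 → c * (r ^ N)⁻¹ ≤ ker z₀ (r ^ 2) z := by
  refine ⟨Real.exp (-(N / 2) * Real.log 2 - 1 / 4), Real.exp_pos _, fun z₀ z r hr hx h1 h2 => ?_⟩
  have e : Real.exp (-(N / 2) * Real.log 2 - 1 / 4) * (r ^ N)⁻¹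
      = Real.exp (-(N / 2) * Real.log 2 - 1 / 4 - N * Real.log r) := by
    rw [Real.exp_sub _ (N * Real.log r), Real.exp_nat_mul, Real.exp_log hr]
    exact (div_eq_mul_inv _ _).symm
  rw [e]
  refine Real.exp_le_exp.2 ?_
  unfold logKer
  rw [sTime_of_nonpos (by positivity) (by linarith)]
  set S := r ^ 2 - (z.2 - z₀.2) with hS
  have hr2 : 0 < r ^ 2 := by positivity
  have hS0 : 0 < S := by linarith
  have e1 : Real.log S ≤ Real.log 2 + 2 * Real.log r := by
    have : Real.log (2 * r ^ 2) = Real.log 2 + 2 * Real.log r := by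
      rw [Real.log_mul (by norm_num) hr2.ne', Real.log_pow]; norm_num
    rw [← this]
    exact Real.log_le_log hS0 (by linarith)
  have e2 : ‖z.1 - z₀.1‖ ^ 2 / (4 * S) ≤ 1 / 4 := by
    rw [div_le_iff₀ (by positivity)]
    have : ‖z.1 - z₀.1‖ ^ 2 ≤ r ^ 2 := by gcongr
    linarith
  have hN : (0 : ℝ) ≤ N := Nat.cast_nonneg N
  nlinarith [mul_le_mul_of_nonneg_left e1 hN]

/-- Time cutoff, equal to one before time `-r²` and to zero after time `-r²/2`. -/
def tCut (r s : ℝ) : ℝ := 1 - Real.smoothTransition ((s + r ^ 2) / (r ^ 2 / 2))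

section
variable {r s : ℝ}

lemma contDiff_tCut (r : ℝ) : ContDiff ℝ ∞ (tCut r) :=
  contDiff_const.sub (Real.smoothTransition.contDiff.comp
    ((contDiff_id.add contDiff_const).div_const _))

lemma tCut_nonneg : 0 ≤ tCut r s := sub_nonneg.2 (Real.smoothTransition.le_one _)

lemma tCut_le_one : tCut r s ≤ 1 := sub_le_self _ (Real.smoothTransition.nonneg _)

lemma tCut_eq_zero (hr : 0 < r) (h : -(r ^ 2 / 2) ≤ s) : tCut r s = 0 := by
  have : 1 ≤ (s + r ^ 2) / (r ^ 2 / 2) := (one_le_div (by positivity)).2 (by linarith)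
  rw [tCut, Real.smoothTransition.one_of_one_le this, sub_self]

lemma hasDerivAt_tCut (r s : ℝ) : HasDerivAt (tCut r)
    (-(deriv Real.smoothTransition ((s + r ^ 2) / (r ^ 2 / 2)) / (r ^ 2 / 2))) s := by
  have h1 : HasDerivAt Real.smoothTransition (deriv Real.smoothTransition ((s + r ^ 2) / (r ^ 2 / 2)))
      ((s + r ^ 2) / (r ^ 2 / 2)) :=
    ((Real.smoothTransition.contDiff (n := 1)).differentiable (by norm_num) _).hasDerivAt
  have h2 : HasDerivAt (fun s : ℝ => (s + r ^ 2) / (r ^ 2 / 2)) (1 / (r ^ 2 / 2)) s :=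
    ((hasDerivAt_id s).add_const _).div_const _
  refine ((h1.comp s h2).const_sub 1).congr_deriv ?_
  ring

lemma deriv_tCut_nonpos (r s : ℝ) : deriv (tCut r) s ≤ 0 := by
  rw [(hasDerivAt_tCut r s).deriv]
  have := Real.smoothTransition.monotone.deriv_nonneg (x := (s + r ^ 2) / (r ^ 2 / 2))
  rw [neg_nonpos]
  positivity

end

/-- There is an interval on which the time cutoff decreases steeply, uniformly after scaling. -/
lemma exists_tCut_steep : ∃ a b : ℝ, 0 < a ∧ a < b ∧ b < 1 ∧ ∀ r : ℝ, 0 < r → ∀ s,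
    (s + r ^ 2) / (r ^ 2 / 2) ∈ Ioo a b → (r ^ 2)⁻¹ ≤ -deriv (tCut r) s := by
  have hd : Differentiable ℝ Real.smoothTransition :=
    (Real.smoothTransition.contDiff (n := 1)).differentiable (by norm_num)
  obtain ⟨c, hc, hc1⟩ := exists_deriv_eq_slope Real.smoothTransition (zero_lt_one' ℝ)
    hd.continuous.continuousOn hd.differentiableOn
  have hc2 : deriv Real.smoothTransition c = 1 := by simpa using hc1
  have hcont : Continuous (deriv Real.smoothTransition) :=
    (contDiff_deriv Real.smoothTransition.contDiff).continuous
  have hev : ∀ᶠ x in 𝓝 c, 1 / 2 < deriv Real.smoothTransition x ∧ x ∈ Ioo (0 : ℝ) 1 :=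
    (hcont.continuousAt.eventually (lt_mem_nhds (by rw [hc2]; norm_num))).and
      (Ioo_mem_nhds hc.1 hc.2)
  obtain ⟨ε, hε, hε1⟩ := Metric.eventually_nhds_iff_ball.1 hev
  have hm : ∀ x ∈ Ioo (c - ε / 2) (c + ε / 2), x ∈ ball c ε := fun x hx => by
    rw [Real.ball_eq_Ioo]; exact ⟨by linarith [hx.1], by linarith [hx.2]⟩
  have h1 := (hε1 (c - ε / 2) (by rw [Real.ball_eq_Ioo]; constructor <;> linarith)).2
  have h2 := (hε1 (c + ε / 2) (by rw [Real.ball_eq_Ioo]; constructor <;> linarith)).2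
  refine ⟨c - ε / 2, c + ε / 2, h1.1, by linarith, h2.2, fun r hr s hs => ?_⟩
  rw [(hasDerivAt_tCut r s).deriv, neg_neg, inv_eq_one_div, div_le_div_iff₀ (by positivity) (by positivity)]
  have := (hε1 _ (hm _ hs)).1
  have hr2 : 0 < r ^ 2 := by positivity
  nlinarith

/-- The reference bump function. -/
def refBump (N : ℕ) : ContDiffBump (0 : PSpace N) := ⟨1, 2, one_pos, one_lt_two⟩

/-- Parabolic rescaling of the cylinder of size `ρ` about `z₀` to unit size. -/
def pScale (z₀ : PSpace N) (ρ : ℝ) (z : PSpace N) : PSpace N :=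
  (ρ⁻¹ • (z.1 - z₀.1), (ρ ^ 2)⁻¹ * (z.2 - z₀.2))

/-- A cutoff function of the cylinder of size `ρ` about `z₀`. -/
def boxCut (z₀ : PSpace N) (ρ : ℝ) (z : PSpace N) : ℝ := refBump N (pScale z₀ ρ z)

lemma contDiff_refBump (N : ℕ) : ContDiff ℝ ∞ fun z => refBump N z := (refBump N).contDiff

lemma contDiff_pScale (z₀ : PSpace N) (ρ : ℝ) : ContDiff ℝ ∞ (pScale z₀ ρ) := by
  unfold pScale; fun_prop

lemma contDiff_boxCut (z₀ : PSpace N) (ρ : ℝ) : ContDiff ℝ ∞ (boxCut z₀ ρ) :=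
  (contDiff_refBump N).comp (contDiff_pScale z₀ ρ)

section
variable {z₀ z : PSpace N} {ρ : ℝ}

lemma boxCut_nonneg : 0 ≤ boxCut z₀ ρ z := (refBump N).nonneg

lemma boxCut_le_one : boxCut z₀ ρ z ≤ 1 := (refBump N).le_one

lemma norm_pScale (hρ : 0 < ρ) :
    ‖pScale z₀ ρ z‖ = max (ρ⁻¹ * ‖z.1 - z₀.1‖) ((ρ ^ 2)⁻¹ * |z.2 - z₀.2|) := by
  rw [pScale, Prod.norm_def, norm_smul, norm_mul, Real.norm_eq_abs, Real.norm_eq_abs, Real.norm_eq_abs,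
    abs_of_pos (by positivity), abs_of_pos (by positivity)]

lemma boxCut_eq_one (hρ : 0 < ρ) (h1 : ‖z.1 - z₀.1‖ ≤ ρ) (h2 : |z.2 - z₀.2| ≤ ρ ^ 2) :
    boxCut z₀ ρ z = 1 := by
  refine (refBump N).one_of_mem_closedBall ?_
  rw [mem_closedBall_zero_iff, norm_pScale hρ]
  exact max_le ((inv_mul_le_one₀ hρ).2 h1) ((inv_mul_le_one₀ (by positivity)).2 h2)

lemma lt_of_boxCut_ne_zero (hρ : 0 < ρ) (h : boxCut z₀ ρ z ≠ 0) :
    ‖z.1 - z₀.1‖ < 2 * ρ ∧ |z.2 - z₀.2| < 2 * ρ ^ 2 := by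
  have h1 : pScale z₀ ρ z ∈ ball 0 2 := by
    rw [← show Function.support (refBump N) = ball 0 2 from (refBump N).support_eq]
    exact h
  rw [mem_ball_zero_iff, norm_pScale hρ, max_lt_iff, inv_mul_lt_iff₀ hρ,
    inv_mul_lt_iff₀ (by positivity)] at h1
  exact ⟨by linarith [h1.1], by linarith [h1.2]⟩

lemma dx_boxCut (i : Fin N) :
    dx i (boxCut z₀ ρ) = fun z => ρ⁻¹ * dx i (fun z => refBump N z) (pScale z₀ ρ z) := by
  funext z
  refine fderiv_eq_of_hasDerivAt (contDiff_boxCut z₀ ρ) ?_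
  have h : (fun r : ℝ => boxCut z₀ ρ (z + r • eX i)) = fun r =>
      refBump N (pScale z₀ ρ z + (ρ⁻¹ * r) • eX i) := by
    funext r
    simp only [boxCut, pScale, eX]
    congr 1
    ext1
    · simp only [Prod.fst_add, Prod.smul_fst]; module
    · simp
  rw [h]
  have h1 := (differentiable_of_contDiff (contDiff_refBump N) (pScale z₀ ρ z)).hasFDerivAt.hasLineDerivAt (eX i)
  have h2 : HasDerivAt (fun r : ℝ => ρ⁻¹ * r) ρ⁻¹ 0 := by simpa using (hasDerivAt_id (0 : ℝ)).const_mul ρ⁻¹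
  have h3 : HasDerivAt (fun r : ℝ => refBump N (pScale z₀ ρ z + r • eX i))
      (dx i (fun z => refBump N z) (pScale z₀ ρ z)) (ρ⁻¹ * 0) := by rw [mul_zero]; exact h1
  exact (h3.comp (0 : ℝ) h2).congr_deriv (mul_comm _ _)

lemma dt_boxCut (z : PSpace N) :
    dt (boxCut z₀ ρ) z = (ρ ^ 2)⁻¹ * dt (fun z => refBump N z) (pScale z₀ ρ z) := by
  refine fderiv_eq_of_hasDerivAt (contDiff_boxCut z₀ ρ) ?_
  have h : (fun r : ℝ => boxCut z₀ ρ (z + r • eT N)) = fun r =>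
      refBump N (pScale z₀ ρ z + ((ρ ^ 2)⁻¹ * r) • eT N) := by
    funext r
    simp only [boxCut, pScale, eT]
    congr 1
    ext1
    · simp
    · simp; ring
  rw [h]
  have h1 := (differentiable_of_contDiff (contDiff_refBump N) (pScale z₀ ρ z)).hasFDerivAt.hasLineDerivAt (eT N)
  have h2 : HasDerivAt (fun r : ℝ => (ρ ^ 2)⁻¹ * r) (ρ ^ 2)⁻¹ 0 := by
    simpa using (hasDerivAt_id (0 : ℝ)).const_mul (ρ ^ 2)⁻¹
  have h3 : HasDerivAt (fun r : ℝ => refBump N (pScale z₀ ρ z + r • eT N))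
      (dt (fun z => refBump N z) (pScale z₀ ρ z)) ((ρ ^ 2)⁻¹ * 0) := by rw [mul_zero]; exact h1
  exact (h3.comp (0 : ℝ) h2).congr_deriv (mul_comm _ _)

lemma dx_dx_boxCut (i : Fin N) (z : PSpace N) :
    dx i (dx i (boxCut z₀ ρ)) z
      = (ρ ^ 2)⁻¹ * dx i (dx i (fun z => refBump N z)) (pScale z₀ ρ z) := by
  refine fderiv_eq_of_hasDerivAt (contDiff_dx (contDiff_boxCut z₀ ρ) i) ?_
  rw [dx_boxCut]
  have hd := contDiff_dx (contDiff_refBump N) i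
  have h : (fun r : ℝ => ρ⁻¹ * dx i (fun z => refBump N z) (pScale z₀ ρ (z + r • eX i))) = fun r =>
      ρ⁻¹ * dx i (fun z => refBump N z) (pScale z₀ ρ z + (ρ⁻¹ * r) • eX i) := by
    funext r
    simp only [pScale, eX]
    congr 2
    ext1
    · simp only [Prod.fst_add, Prod.smul_fst]; module
    · simp
  rw [h]
  have h1 := (differentiable_of_contDiff hd (pScale z₀ ρ z)).hasFDerivAt.hasLineDerivAt (eX i)
  have h2 : HasDerivAt (fun r : ℝ => ρ⁻¹ * r) ρ⁻¹ 0 := by simpa using (hasDerivAt_id (0 : ℝ)).const_mul ρ⁻¹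
  have h3 : HasDerivAt (fun r : ℝ => dx i (fun z => refBump N z) (pScale z₀ ρ z + r • eX i))
      (dx i (dx i (fun z => refBump N z)) (pScale z₀ ρ z)) (ρ⁻¹ * 0) := by rw [mul_zero]; exact h1
  refine ((h3.comp (0 : ℝ) h2).const_mul ρ⁻¹).congr_deriv ?_
  rw [sq, mul_inv]; ring

lemma heatL_boxCut (z : PSpace N) :
    heatL (boxCut z₀ ρ) z = (ρ ^ 2)⁻¹ * heatL (fun z => refBump N z) (pScale z₀ ρ z) := by
  simp only [heatL, dt_boxCut, dx_dx_boxCut, ← Finset.mul_sum, ← mul_add]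

end

lemma exists_boxCut_bound (N : ℕ) : ∃ K, 0 < K ∧ ∀ (z₀ z : PSpace N) (ρ : ℝ), 0 < ρ →
    (∀ i, |dx i (boxCut z₀ ρ) z| ≤ K * ρ⁻¹) ∧ |heatL (boxCut z₀ ρ) z| ≤ K * (ρ ^ 2)⁻¹ := by
  have hb : BddSmooth fun z => refBump N z :=
    BddSmooth.of_hasCompactSupport (contDiff_refBump N) (refBump N).hasCompactSupport
  choose A hA using fun i : Fin N => (hb.dx i).exists_norm_le
  obtain ⟨B, hB⟩ := hb.heatL.exists_norm_le
  have hA0 : ∀ i, 0 ≤ A i := fun i => (norm_nonneg _).trans (hA i 0)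
  have hB0 : 0 ≤ B := (norm_nonneg _).trans (hB 0)
  have hS : 0 ≤ ∑ i, A i := Finset.sum_nonneg fun i _ => hA0 i
  refine ⟨∑ i, A i + B + 1, by positivity, fun z₀ z ρ hρ => ⟨fun i => ?_, ?_⟩⟩
  · rw [dx_boxCut, abs_mul, abs_of_pos (by positivity : (0 : ℝ) < ρ⁻¹), mul_comm]
    refine mul_le_mul_of_nonneg_right ((hA i _).trans ?_) (by positivity)
    have := Finset.single_le_sum (fun i _ => hA0 i) (Finset.mem_univ i)
    linarith
  · rw [heatL_boxCut, abs_mul, abs_of_pos (by positivity : (0 : ℝ) < (ρ ^ 2)⁻¹), mul_comm]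
    refine mul_le_mul_of_nonneg_right ((hB _).trans ?_) (by positivity)
    linarith

/-- The partition of unity of dyadic parabolic shells about `z₀`, stopped at scale `J`. -/
def shellCut (z₀ : PSpace N) (J i : ℕ) (z : PSpace N) : ℝ :=
  boxCut z₀ ((1 / 2) ^ i) z + if i < J then -boxCut z₀ ((1 / 2) ^ (i + 1)) z else 0

section
variable {z₀ z : PSpace N} {J i : ℕ}

lemma contDiff_shellCut (z₀ : PSpace N) (J i : ℕ) : ContDiff ℝ ∞ (shellCut z₀ J i) := by
  unfold shellCut
  split_ifs
  · exact (contDiff_boxCut _ _).add (contDiff_boxCut _ _).neg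
  · exact (contDiff_boxCut _ _).add contDiff_const

lemma sum_shellCut {i₀ : ℕ} (h : i₀ ≤ J) (z : PSpace N) :
    ∑ i ∈ Finset.Ico i₀ (J + 1), shellCut z₀ J i z = boxCut z₀ ((1 / 2) ^ i₀) z := by
  rw [Finset.sum_Ico_succ_top h]
  have h1 : ∑ i ∈ Finset.Ico i₀ J, shellCut z₀ J i z
      = ∑ i ∈ Finset.Ico i₀ J, (boxCut z₀ ((1 / 2) ^ i) z - boxCut z₀ ((1 / 2) ^ (i + 1)) z) :=
    Finset.sum_congr rfl fun i hi => by
      rw [shellCut, if_pos (Finset.mem_Ico.1 hi).2]; ring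
  have h2 := Finset.sum_Ico_sub (fun i => -boxCut z₀ ((1 / 2) ^ i) z) h
  simp only [neg_sub_neg] at h2
  rw [h1, h2]
  simp [shellCut]

lemma boxCut_half_le (z₀ z : PSpace N) (i : ℕ) :
    boxCut z₀ ((1 / 2) ^ (i + 1)) z ≤ boxCut z₀ ((1 / 2) ^ i) z := by
  by_cases h : boxCut z₀ ((1 / 2) ^ (i + 1)) z = 0
  · rw [h]; exact boxCut_nonneg
  obtain ⟨h1, h2⟩ := lt_of_boxCut_ne_zero (by positivity) h
  have hp : (0 : ℝ) < (1 / 2) ^ i := by positivity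
  rw [pow_succ (1 / 2 : ℝ) i] at h1 h2
  rw [boxCut_eq_one hp (by linarith) (by nlinarith)]
  exact boxCut_le_one

lemma shellCut_nonneg (z₀ : PSpace N) (J i : ℕ) (z : PSpace N) : 0 ≤ shellCut z₀ J i z := by
  unfold shellCut
  have := boxCut_half_le z₀ z i
  have := boxCut_nonneg (z₀ := z₀) (z := z) (ρ := (1 / 2) ^ i)
  split_ifs <;> linarith

lemma shellCut_le_one (z₀ : PSpace N) (J i : ℕ) (z : PSpace N) : shellCut z₀ J i z ≤ 1 := by
  unfold shellCut
  have := boxCut_le_one (z₀ := z₀) (z := z) (ρ := (1 / 2) ^ i)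
  have := boxCut_nonneg (z₀ := z₀) (z := z) (ρ := (1 / 2) ^ (i + 1))
  split_ifs <;> linarith

lemma isClosed_norm_fst_le (z₀ : PSpace N) (a : ℝ) : IsClosed {z : PSpace N | ‖z.1 - z₀.1‖ ≤ a} :=
  isClosed_le (by fun_prop) continuous_const

lemma isClosed_abs_snd_le (z₀ : PSpace N) (a : ℝ) : IsClosed {z : PSpace N | |z.2 - z₀.2| ≤ a} :=
  isClosed_le (by fun_prop) continuous_const

lemma isClosed_le_norm_fst (z₀ : PSpace N) (a : ℝ) : IsClosed {z : PSpace N | a ≤ ‖z.1 - z₀.1‖} :=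
  isClosed_le continuous_const (by fun_prop)

lemma isClosed_le_abs_snd (z₀ : PSpace N) (a : ℝ) : IsClosed {z : PSpace N | a ≤ |z.2 - z₀.2|} :=
  isClosed_le continuous_const (by fun_prop)

lemma tsupport_boxCut_subset (z₀ : PSpace N) {ρ : ℝ} (hρ : 0 < ρ) :
    tsupport (boxCut z₀ ρ) ⊆ {z | ‖z.1 - z₀.1‖ ≤ 2 * ρ ∧ |z.2 - z₀.2| ≤ 2 * ρ ^ 2} := by
  refine closure_minimal (fun z hz => ?_) ((isClosed_norm_fst_le _ _).inter
    (isClosed_abs_snd_le _ _))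
  have := lt_of_boxCut_ne_zero hρ hz
  exact ⟨this.1.le, this.2.le⟩

lemma tsupport_shellCut_subset (z₀ : PSpace N) (J i : ℕ) :
    tsupport (shellCut z₀ J i) ⊆ {z | (‖z.1 - z₀.1‖ ≤ 2 * (1 / 2) ^ i ∧
      |z.2 - z₀.2| ≤ 2 * ((1 / 2) ^ i) ^ 2) ∧
      (i < J → (1 / 2) ^ i / 2 ≤ ‖z.1 - z₀.1‖ ∨ ((1 / 2) ^ i) ^ 2 / 4 ≤ |z.2 - z₀.2|)} := by
  have hp : (0 : ℝ) < (1 / 2) ^ i := by positivity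
  refine closure_minimal (fun z hz => ?_) (((isClosed_norm_fst_le _ _).inter
    (isClosed_abs_snd_le _ _)).inter ?_)
  · have h1 : boxCut z₀ ((1 / 2) ^ i) z ≠ 0 := fun h0 => hz (by
      have := boxCut_half_le z₀ z i
      have := boxCut_nonneg (z₀ := z₀) (z := z) (ρ := (1 / 2) ^ (i + 1))
      have h3 : boxCut z₀ ((1 / 2) ^ (i + 1)) z = 0 := by linarith
      rw [shellCut, h0, h3]; simp)
    have h2 := lt_of_boxCut_ne_zero hp h1
    refine ⟨⟨h2.1.le, h2.2.le⟩, fun hJ => ?_⟩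
    by_contra! h
    refine hz ?_
    rw [shellCut, if_pos hJ, boxCut_eq_one hp (by linarith) (by nlinarith [h.2]),
      boxCut_eq_one (by positivity) (by rw [pow_succ (1 / 2 : ℝ) i]; linarith)
        (by rw [pow_succ (1 / 2 : ℝ) i]; nlinarith [h.2])]
    norm_num
  · by_cases hJ : i < J
    · simp only [hJ, forall_const]
      exact (isClosed_le_norm_fst _ _).union (isClosed_le_abs_snd _ _)
    · simp only [hJ, false_imp_iff]; exact isClosed_univ

end

lemma dx_neg (f : PSpace N → ℝ) (i : Fin N) (z : PSpace N) : dx i (fun z => -f z) z = -dx i f z := by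
  simp [dx]

lemma heatL_neg (f : PSpace N → ℝ) (z : PSpace N) : heatL (fun z => -f z) z = -heatL f z := by
  have h : ∀ i : Fin N, dx i (fun z => -f z) = fun z => -dx i f z := fun i => funext (dx_neg f i)
  simp only [heatL, h, dx_neg, Finset.sum_neg_distrib]
  simp [dt]
  ring

lemma exists_shellCut_bound (N : ℕ) : ∃ K, 0 < K ∧ ∀ (z₀ z : PSpace N) (J n : ℕ),
    (∀ i, |dx i (shellCut z₀ J n) z| ≤ K * ((1 / 2) ^ n)⁻¹) ∧
      |heatL (shellCut z₀ J n) z| ≤ K * (((1 / 2) ^ n) ^ 2)⁻¹ := by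
  obtain ⟨K, hK, h⟩ := exists_boxCut_bound N
  refine ⟨5 * K, by positivity, fun z₀ z J n => ?_⟩
  set ρ : ℝ := (1 / 2) ^ n with hρ
  have hρ0 : 0 < ρ := by positivity
  obtain ⟨a1, a2⟩ := h z₀ z ρ hρ0
  obtain ⟨b1, b2⟩ := h z₀ z ((1 / 2) ^ (n + 1)) (by positivity)
  have e1 : ((1 / 2 : ℝ) ^ (n + 1))⁻¹ = 2 * ρ⁻¹ := by rw [pow_succ, mul_inv, hρ]; ring
  have e2 : (((1 / 2 : ℝ) ^ (n + 1)) ^ 2)⁻¹ = 4 * (ρ ^ 2)⁻¹ := by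
    rw [pow_succ (1 / 2 : ℝ) n, mul_pow, mul_inv, hρ]; ring
  rw [e1] at b1
  rw [e2] at b2
  by_cases hJ : n < J
  · have hw : shellCut z₀ J n = fun z => boxCut z₀ ρ z + -boxCut z₀ ((1 / 2) ^ (n + 1)) z := by
      funext z; rw [shellCut, if_pos hJ]
    have g1 := contDiff_boxCut z₀ ρ
    have g2 : ContDiff ℝ ∞ fun z => -boxCut z₀ ((1 / 2) ^ (n + 1)) z := (contDiff_boxCut z₀ _).neg
    constructor
    · intro i
      rw [hw, dx_add g1 g2]
      simp only [dx_neg]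
      have h1 := a1 i
      have h2 := b1 i
      have h3 := abs_add_le (dx i (boxCut z₀ ρ) z) (-dx i (boxCut z₀ ((1 / 2) ^ (n + 1))) z)
      rw [abs_neg] at h3
      have : 0 < K * ρ⁻¹ := by positivity
      linarith
    · rw [hw, heatL_add g1 g2, heatL_neg]
      have h3 := abs_add_le (heatL (boxCut z₀ ρ) z) (-heatL (boxCut z₀ ((1 / 2) ^ (n + 1))) z)
      rw [abs_neg] at h3
      linarith
  · have hw : shellCut z₀ J n = boxCut z₀ ρ := by
      funext z; rw [shellCut, if_neg hJ, add_zero]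
    have h1 : 0 < K * ρ⁻¹ := by positivity
    have h2 : 0 < K * (ρ ^ 2)⁻¹ := by positivity
    rw [hw]
    exact ⟨fun i => by linarith [a1 i], by linarith⟩

section
variable {f g : PSpace N → ℝ} {z : PSpace N}

lemma dx_congr (h : f =ᶠ[𝓝 z] g) (i : Fin N) : dx i f =ᶠ[𝓝 z] dx i g := by
  filter_upwards [h.fderiv (𝕜 := ℝ)] with y hy
  rw [dx, dx, hy]

lemma heatL_congr (h : f =ᶠ[𝓝 z] g) : heatL f z = heatL g z := by
  have h2 : ∀ i : Fin N, dx i (dx i f) z = dx i (dx i g) z := fun i =>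
    (dx_congr (dx_congr h i) i).eq_of_nhds
  rw [heatL, heatL, dt, dt, h.fderiv_eq]
  simp only [h2]

lemma dx_eq_zero_of_isMin (h0 : ∀ z, 0 ≤ f z) (hz : f z = 0) (i : Fin N) : dx i f z = 0 := by
  have h : IsLocalMin f z := Filter.Eventually.of_forall fun y => by rw [hz]; exact h0 y
  rw [dx, h.fderiv_eq_zero]; rfl

lemma contDiff_finsetSum {s : Finset ℕ} {b : ℕ → PSpace N → ℝ} (hb : ∀ n, ContDiff ℝ ∞ (b n)) :
    ContDiff ℝ ∞ fun z => ∑ n ∈ s, b n z := ContDiff.sum fun n _ => hb n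

lemma dx_sum (s : Finset ℕ) {b : ℕ → PSpace N → ℝ} (hb : ∀ n, ContDiff ℝ ∞ (b n)) (i : Fin N)
    (z : PSpace N) : dx i (fun z => ∑ n ∈ s, b n z) z = ∑ n ∈ s, dx i (b n) z := by
  induction s using Finset.induction_on with
  | empty => simp [dx]
  | insert n s hn ih =>
    simp only [Finset.sum_insert hn]
    rw [dx_add (hb n) (contDiff_finsetSum hb)]
    simp only [ih]

lemma heatL_sum (s : Finset ℕ) {b : ℕ → PSpace N → ℝ} (hb : ∀ n, ContDiff ℝ ∞ (b n))
    (z : PSpace N) : heatL (fun z => ∑ n ∈ s, b n z) z = ∑ n ∈ s, heatL (b n) z := by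
  induction s using Finset.induction_on with
  | empty =>
    have h : ∀ i : Fin N, dx i (fun _ : PSpace N => (0 : ℝ)) = fun _ => 0 := fun i => by
      funext z; simp [dx]
    simp [heatL, dt, h]
  | insert n s hn ih =>
    simp only [Finset.sum_insert hn]
    rw [heatL_add (hb n) (contDiff_finsetSum hb), ih]

end

/-- The quantity controlling the effect of the heat operator on powers of `b` times a kernel with
logarithmic gradient bounded by `L`. -/
def opT (L : Fin N → ℝ) (b : PSpace N → ℝ) (z : PSpace N) : ℝ :=
  |heatL b z| + gsq b z + ∑ j, L j * |dx j b z|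

section
variable {L : Fin N → ℝ} {f g : PSpace N → ℝ} {z : PSpace N}

lemma opT_nonneg (hL : ∀ j, 0 ≤ L j) (f : PSpace N → ℝ) (z : PSpace N) : 0 ≤ opT L f z :=
  add_nonneg (add_nonneg (abs_nonneg _) (gsq_nonneg _ _))
    (Finset.sum_nonneg fun j _ => mul_nonneg (hL j) (abs_nonneg _))

lemma opT_congr (h : f =ᶠ[𝓝 z] g) : opT L f z = opT L g z := by
  have h2 : ∀ i : Fin N, dx i f z = dx i g z := fun i => (dx_congr h i).eq_of_nhds
  simp only [opT, gsq, heatL_congr h, h2]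

lemma opT_neg (f : PSpace N → ℝ) (z : PSpace N) : opT L (fun z => -f z) z = opT L f z := by
  simp only [opT, gsq, heatL_neg, dx_neg, abs_neg, neg_sq]

lemma opT_add_le (hL : ∀ j, 0 ≤ L j) (hf : ContDiff ℝ ∞ f) (hg : ContDiff ℝ ∞ g) :
    opT L (fun z => f z + g z) z ≤ 2 * (opT L f z + opT L g z) := by
  simp only [opT, gsq, heatL_add hf hg, dx_add hf hg]
  have h1 := abs_add_le (heatL f z) (heatL g z)
  have h2 : ∑ i, (dx i f z + dx i g z) ^ 2 ≤ 2 * ∑ i, dx i f z ^ 2 + 2 * ∑ i, dx i g z ^ 2 := by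
    rw [Finset.mul_sum, Finset.mul_sum, ← Finset.sum_add_distrib]
    exact Finset.sum_le_sum fun i _ => by nlinarith [sq_nonneg (dx i f z - dx i g z)]
  have h3 : ∑ j, L j * |dx j f z + dx j g z| ≤ ∑ j, L j * |dx j f z| + ∑ j, L j * |dx j g z| := by
    rw [← Finset.sum_add_distrib]
    exact Finset.sum_le_sum fun j _ => by
      rw [← mul_add]; exact mul_le_mul_of_nonneg_left (abs_add_le _ _) (hL j)
  have h4 : 0 ≤ ∑ j, L j * |dx j f z| := Finset.sum_nonneg fun j _ => mul_nonneg (hL j) (abs_nonneg _)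
  have h5 : 0 ≤ ∑ j, L j * |dx j g z| := Finset.sum_nonneg fun j _ => mul_nonneg (hL j) (abs_nonneg _)
  linarith [abs_nonneg (heatL f z), abs_nonneg (heatL g z)]

lemma opT_sum_le (hL : ∀ j, 0 ≤ L j) (s : Finset ℕ) {b : ℕ → PSpace N → ℝ}
    (hb : ∀ n, ContDiff ℝ ∞ (b n)) :
    opT L (fun z => ∑ n ∈ s, b n z) z ≤ s.card * ∑ n ∈ s, opT L (b n) z := by
  rcases s.eq_empty_or_nonempty with rfl | hs
  · have h := heatL_sum (N := N) ∅ hb z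
    have h' := fun i => dx_sum (N := N) ∅ hb i z
    simp only [Finset.sum_empty] at h h' ⊢
    simp [opT, gsq, h, h']
  have hc : (1 : ℝ) ≤ s.card := by exact_mod_cast hs.card_pos
  have hn : ∀ n, 0 ≤ ∑ j, L j * |dx j (b n) z| := fun n =>
    Finset.sum_nonneg fun j _ => mul_nonneg (hL j) (abs_nonneg _)
  have h1 : |∑ n ∈ s, heatL (b n) z| ≤ s.card * ∑ n ∈ s, |heatL (b n) z| :=
    (Finset.abs_sum_le_sum_abs _ _).trans
      (le_mul_of_one_le_left (Finset.sum_nonneg fun _ _ => abs_nonneg _) hc)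
  have h2 : ∑ i, (∑ n ∈ s, dx i (b n) z) ^ 2 ≤ s.card * ∑ n ∈ s, gsq (b n) z := by
    simp only [gsq]
    rw [Finset.sum_comm, Finset.mul_sum]
    exact Finset.sum_le_sum fun i _ => sq_sum_le_card_mul_sum_sq
  have h3 : ∑ j, L j * |∑ n ∈ s, dx j (b n) z| ≤ s.card * ∑ n ∈ s, ∑ j, L j * |dx j (b n) z| := by
    refine le_trans ?_ (le_mul_of_one_le_left (Finset.sum_nonneg fun n _ => hn n) hc)
    rw [Finset.sum_comm]
    refine Finset.sum_le_sum fun j _ => ?_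
    rw [← Finset.mul_sum]
    exact mul_le_mul_of_nonneg_left (Finset.abs_sum_le_sum_abs _ _) (hL j)
  simp only [opT, gsq, heatL_sum s hb, dx_sum s hb, Finset.sum_add_distrib, mul_add]
  simp only [gsq] at h2
  linarith

lemma opT_mul_le {w Y : PSpace N → ℝ} (hw : ContDiff ℝ ∞ w) (hY : ContDiff ℝ ∞ Y)
    (hY0 : ∀ z, 0 ≤ Y z) (hY1 : ∀ z, Y z ≤ 1) {K M y : ℝ} (hK : 0 ≤ K)
    (hM : 0 ≤ M) (hy : 0 ≤ y) (hLy : ∀ j, L j ≤ 2 * y * M) (h0 : |w z| ≤ 1)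
    (h1 : ∀ j, |dx j w z| ≤ K * M) (h2 : |heatL w z| ≤ K * M ^ 2) :
    opT L (fun z => w z * Y z) z ≤ (4 + K + 3 * N * K ^ 2 + 4 * N + 2 * N * K) * (1 + y) ^ 2 *
      (|heatL Y z| + (if Y z ≠ 0 then M ^ 2 else 0) + ∑ j, dx j Y z ^ 2) := by
  set I : ℝ := if Y z ≠ 0 then 1 else 0 with hI
  have hI1 : (if Y z ≠ 0 then M ^ 2 else 0) = I * M ^ 2 := by rw [hI]; split_ifs <;> simp
  have hI0 : 0 ≤ I := by rw [hI]; split_ifs <;> simp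
  have hII : I ^ 2 = I := by rw [hI]; split_ifs <;> simp
  have hYI : Y z ≤ I := by
    rw [hI]; split_ifs with h
    · exact hY1 z
    · exact (not_not.1 h).le
  have hdI : ∀ j, dx j Y z = I * dx j Y z := fun j => by
    rw [hI]; split_ifs with h
    · simp
    · simp [dx_eq_zero_of_isMin hY0 (not_not.1 h)]
  have hYz := hY0 z
  set A := |heatL Y z|
  set D := ∑ j, dx j Y z ^ 2 with hD
  have hA0 : 0 ≤ A := abs_nonneg _
  have hD0 : 0 ≤ D := Finset.sum_nonneg fun _ _ => sq_nonneg _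
  have hKM : 0 ≤ K * M := by positivity
  have hdx : ∀ j, |w z * dx j Y z + Y z * dx j w z| ≤ |dx j Y z| + I * (K * M) := fun j => by
    refine (abs_add_le _ _).trans ?_
    rw [abs_mul, abs_mul, abs_of_nonneg hYz]
    exact add_le_add (mul_le_of_le_one_left (abs_nonneg _) h0) (by gcongr; exact h1 j)
  have e1 : |heatL (fun z => w z * Y z) z| ≤ A + I * (K * M ^ 2) + (N * (I * (K * M) ^ 2) + D) := by
    rw [heatL_mul hw hY]
    have g1 : |w z * heatL Y z| ≤ A := by
      rw [abs_mul]; exact mul_le_of_le_one_left (abs_nonneg _) h0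
    have g2 : |Y z * heatL w z| ≤ I * (K * M ^ 2) := by
      rw [abs_mul, abs_of_nonneg hYz]; gcongr
    have g3 : |2 * ∑ i, dx i w z * dx i Y z| ≤ N * (I * (K * M) ^ 2) + D := by
      have : (N : ℝ) * (I * (K * M) ^ 2) + D = ∑ j : Fin N, (I * (K * M) ^ 2 + dx j Y z ^ 2) := by
        rw [Finset.sum_add_distrib]; simp [hD]
      rw [this, Finset.mul_sum]
      refine (Finset.abs_sum_le_sum_abs _ _).trans (Finset.sum_le_sum fun j _ => ?_)
      have k1 : |dx j w z| * |dx j Y z| ≤ K * M * (I * |dx j Y z|) := by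
        have : |dx j Y z| = I * |dx j Y z| := by
          conv_lhs => rw [hdI j, abs_mul, abs_of_nonneg hI0]
        rw [← this]
        exact mul_le_mul_of_nonneg_right (h1 j) (abs_nonneg _)
      rw [abs_mul, abs_mul, abs_two, ← sq_abs (dx j Y z)]
      nlinarith [sq_nonneg (I * (K * M) - |dx j Y z|)]
    have := abs_add_three (w z * heatL Y z) (Y z * heatL w z) (2 * ∑ i, dx i w z * dx i Y z)
    linarith
  have e2 : gsq (fun z => w z * Y z) z ≤ 2 * D + N * (2 * (I * (K * M) ^ 2)) := by
    have : 2 * D + N * (2 * (I * (K * M) ^ 2)) = ∑ j : Fin N, (2 * dx j Y z ^ 2 + 2 * (I * (K * M) ^ 2)) := by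
      rw [Finset.sum_add_distrib, ← Finset.mul_sum]; simp [hD]
    rw [this, gsq]
    refine Finset.sum_le_sum fun j _ => ?_
    rw [dx_mul hw hY, ← sq_abs]
    have h3 := hdx j
    have h4 : |w z * dx j Y z + Y z * dx j w z| ^ 2 ≤ (|dx j Y z| + I * (K * M)) ^ 2 := by gcongr
    refine h4.trans ?_
    rw [← sq_abs (dx j Y z)]
    nlinarith [sq_nonneg (|dx j Y z| - I * (K * M))]
  have e3 : ∑ j, L j * |dx j (fun z => w z * Y z) z|
      ≤ D + N * (I * (2 * y * M) ^ 2 + 2 * y * M * (I * (K * M))) := by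
    have : D + N * (I * (2 * y * M) ^ 2 + 2 * y * M * (I * (K * M)))
        = ∑ j : Fin N, (dx j Y z ^ 2 + (I * (2 * y * M) ^ 2 + 2 * y * M * (I * (K * M)))) := by
      rw [Finset.sum_add_distrib]; simp only [hD, Finset.sum_const, Finset.card_univ,
        Fintype.card_fin, nsmul_eq_mul]
    rw [this]
    refine Finset.sum_le_sum fun j _ => ?_
    rw [dx_mul hw hY]
    have k1 : L j * |w z * dx j Y z + Y z * dx j w z| ≤ 2 * y * M * (|dx j Y z| + I * (K * M)) :=
      mul_le_mul (hLy j) (hdx j) (abs_nonneg _) (by positivity)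
    have k2 : |dx j Y z| = I * |dx j Y z| := by
      conv_lhs => rw [hdI j, abs_mul, abs_of_nonneg hI0]
    have k3 : 2 * y * M * |dx j Y z| ≤ I * (2 * y * M) ^ 2 + |dx j Y z| ^ 2 := by
      rw [k2]
      generalize |dx j Y z| = t
      generalize 2 * y * M = a
      have j1 : a * (I * t) = (I * a) * (I * t) := by linear_combination (-(a * t)) * hII
      have j2 : I * a ^ 2 = (I * a) ^ 2 := by linear_combination (-a ^ 2) * hII
      rw [j1, j2]
      nlinarith [sq_nonneg (I * a - I * t), sq_nonneg (I * a), sq_nonneg (I * t)]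
    rw [sq_abs] at k3
    linarith
  rw [hI1]
  have hN : (0 : ℝ) ≤ N := Nat.cast_nonneg N
  have hy1 : 1 ≤ (1 + y) ^ 2 := by nlinarith
  have hJ : 0 ≤ I * M ^ 2 := by positivity
  have hNK : 0 ≤ N * K := by positivity
  have hNK2 : 0 ≤ N * K ^ 2 := by positivity
  have t0 : opT L (fun z => w z * Y z) z ≤ A + 4 * D
      + (K + 3 * (N * K ^ 2) + N * (4 * y ^ 2) + N * K * (2 * y)) * (I * M ^ 2) := by
    unfold opT; linarith
  refine t0.trans ?_
  set Q := (4 + K + 3 * N * K ^ 2 + 4 * N + 2 * N * K) * (1 + y) ^ 2 with hQ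
  have q0 : 4 ≤ Q := by
    have : 4 ≤ 4 + K + 3 * N * K ^ 2 + 4 * N + 2 * N * K := by linarith
    exact this.trans (le_mul_of_one_le_right (by linarith) hy1)
  have q1 : K + 3 * (N * K ^ 2) + N * (4 * y ^ 2) + N * K * (2 * y) ≤ Q := by
    have r1 : K ≤ K * (1 + y) ^ 2 := le_mul_of_one_le_right hK hy1
    have r2 : N * K ^ 2 ≤ N * K ^ 2 * (1 + y) ^ 2 := le_mul_of_one_le_right hNK2 hy1
    have r3 : N * y ^ 2 ≤ N * (1 + y) ^ 2 := by gcongr; linarith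
    have r4 : N * K * y ≤ N * K * (1 + y) ^ 2 := by gcongr; nlinarith
    rw [hQ]; linarith
  have u1 := mul_le_mul_of_nonneg_right q1 hJ
  have u2 := mul_le_mul_of_nonneg_right q0 hA0
  have u3 := mul_le_mul_of_nonneg_right q0 hD0
  rw [mul_add, mul_add]
  linarith

end

/-- The bound for the logarithmic gradient of `ker`. -/
def kerL (z₀ : PSpace N) (τ : ℝ) (z : PSpace N) (j : Fin N) : ℝ :=
  |z.1 j - z₀.1 j| / sTime τ (z.2 - z₀.2)

lemma kerL_nonneg {τ : ℝ} (hτ : 0 < τ) (z₀ z : PSpace N) (j : Fin N) : 0 ≤ kerL z₀ τ z j :=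
  div_nonneg (abs_nonneg _) (sTime_pos hτ _).le

lemma exists_ker_mul_opT_le (N : ℕ) {p K : ℝ} (hp : 1 < p) (hK : 0 < K) :
    ∃ C, 0 < C ∧ ∀ (z₀ z : PSpace N) (τ ρ : ℝ) (w Y : PSpace N → ℝ), 0 < τ → 0 < ρ →
    ContDiff ℝ ∞ w → ContDiff ℝ ∞ Y → (∀ z, 0 ≤ Y z) → (∀ z, Y z ≤ 1) →
    ‖z.1 - z₀.1‖ ≤ 2 * ρ → ρ ^ 2 / 4 ≤ ‖z.1 - z₀.1‖ ^ 2 + sTime τ (z.2 - z₀.2) →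
    |w z| ≤ 1 → (∀ j, |dx j w z| ≤ K * ρ⁻¹) → |heatL w z| ≤ K * (ρ ^ 2)⁻¹ →
    ker z₀ τ z * opT (kerL z₀ τ z) (fun z => w z * Y z) z ^ p ≤ C * (ρ ^ N)⁻¹ *
      (|heatL Y z| ^ p + (if Y z ≠ 0 then (ρ ^ (2 * p))⁻¹ else 0) + ∑ j, |dx j Y z| ^ (2 * p)) := by
  obtain ⟨C, hC, h⟩ := exists_ker_le N ⌈2 * p⌉₊
  set D : ℝ := 4 + K + 3 * N * K ^ 2 + 4 * N + 2 * N * K with hD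
  have hD0 : 0 < D := by positivity
  have hp0 : 0 < p := by linarith
  refine ⟨C * (D ^ p * (N + 2) ^ p), by positivity,
    fun z₀ z τ ρ w Y hτ hρ hw hY hY0 hY1 hx hS h0 h1 h2 => ?_⟩
  have hSp := sTime_pos hτ (z.2 - z₀.2)
  set S := sTime τ (z.2 - z₀.2) with hSd
  set y := ρ ^ 2 / S with hy
  have hy0 : 0 < y := by positivity
  have hL := kerL_nonneg hτ z₀ z
  have hLy : ∀ j, kerL z₀ τ z j ≤ 2 * y * ρ⁻¹ := fun j => by
    have h3 : |z.1 j - z₀.1 j| ≤ 2 * ρ := by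
      have := PiLp.norm_apply_le (z.1 - z₀.1) j
      exact this.trans hx
    rw [kerL, ← hSd, div_le_iff₀ hSp]
    have : 2 * y * ρ⁻¹ * S = 2 * ρ := by rw [hy]; field_simp
    rwa [this]
  have hM := opT_mul_le hw hY hY0 hY1 hK.le (inv_pos.2 hρ).le hy0.le hLy h0 h1 (by rwa [inv_pow])
  rw [← hD] at hM
  have hT := opT_nonneg hL (fun z => w z * Y z) z
  set E := |heatL Y z| + (if Y z ≠ 0 then ρ⁻¹ ^ 2 else 0) + ∑ j, dx j Y z ^ 2 with hE
  have hI0 : 0 ≤ (if Y z ≠ 0 then ρ⁻¹ ^ 2 else 0) := by split_ifs <;> positivity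
  have hE0 : 0 ≤ E := add_nonneg (add_nonneg (abs_nonneg _) hI0)
    (Finset.sum_nonneg fun _ _ => sq_nonneg _)
  have k1 : opT (kerL z₀ τ z) (fun z => w z * Y z) z ^ p
      ≤ D ^ p * (1 + y) ^ ⌈2 * p⌉₊ * E ^ p := by
    refine (Real.rpow_le_rpow hT hM hp0.le).trans ?_
    rw [Real.mul_rpow (by positivity) hE0, Real.mul_rpow hD0.le (by positivity)]
    gcongr
    rw [← Real.rpow_natCast (1 + y) 2, ← Real.rpow_mul (by positivity), ← Real.rpow_natCast]
    refine Real.rpow_le_rpow_of_exponent_le (by linarith) ?_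
    exact_mod_cast Nat.le_ceil (2 * p)
  have k2 : E ^ p ≤ (N + 2) ^ p * (|heatL Y z| ^ p + (if Y z ≠ 0 then (ρ ^ (2 * p))⁻¹ else 0)
      + ∑ j, |dx j Y z| ^ (2 * p)) := by
    have := add_sum_rpow_le Finset.univ hp0 (abs_nonneg (heatL Y z)) hI0
      (fun j _ => sq_nonneg (dx j Y z))
    rw [Finset.card_univ, Fintype.card_fin] at this
    refine this.trans_eq ?_
    congr 2
    · congr 1
      split_ifs
      · rw [inv_pow, Real.inv_rpow (by positivity), ← Real.rpow_natCast ρ 2, ← Real.rpow_mul hρ.le]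
        norm_num
      · exact Real.zero_rpow hp0.ne'
    · refine Finset.sum_congr rfl fun j _ => ?_
      rw [← sq_abs, ← Real.rpow_natCast |dx j Y z| 2, ← Real.rpow_mul (abs_nonneg _)]
      norm_num
  have k3 := h z₀ z τ ρ hτ hρ hS
  have kp := ker_pos z₀ τ z
  have hR : 0 ≤ |heatL Y z| ^ p + (if Y z ≠ 0 then (ρ ^ (2 * p))⁻¹ else 0)
      + ∑ j, |dx j Y z| ^ (2 * p) := by
    have : 0 ≤ (if Y z ≠ 0 then (ρ ^ (2 * p))⁻¹ else 0) := by split_ifs <;> positivity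
    positivity
  set R := |heatL Y z| ^ p + (if Y z ≠ 0 then (ρ ^ (2 * p))⁻¹ else 0) + ∑ j, |dx j Y z| ^ (2 * p)
  calc ker z₀ τ z * opT (kerL z₀ τ z) (fun z => w z * Y z) z ^ p
      ≤ ker z₀ τ z * (D ^ p * (1 + y) ^ ⌈2 * p⌉₊ * ((N + 2) ^ p * R)) := by gcongr; exact k1.trans (by gcongr)
    _ = (ker z₀ τ z * (1 + y) ^ ⌈2 * p⌉₊) * (D ^ p * (N + 2) ^ p * R) := by ring
    _ ≤ (C * (ρ ^ N)⁻¹) * (D ^ p * (N + 2) ^ p * R) := by gcongr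
    _ = _ := by ring

/-- The pointwise density of the energy of a cutoff function living at scale `ρ`. -/
def cutDens (p ρ : ℝ) (Y : PSpace N → ℝ) (z : PSpace N) : ℝ :=
  |heatL Y z| ^ p + (if Y z ≠ 0 then (ρ ^ (2 * p))⁻¹ else 0) + ∑ j, |dx j Y z| ^ (2 * p)

lemma cutDens_nonneg {p ρ : ℝ} (hρ : 0 < ρ) (Y : PSpace N → ℝ) (z : PSpace N) :
    0 ≤ cutDens p ρ Y z := by
  have : 0 ≤ (if Y z ≠ 0 then (ρ ^ (2 * p))⁻¹ else 0) := by split_ifs <;> positivity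
  unfold cutDens
  positivity

lemma measurable_cutDens {p ρ : ℝ} {Y : PSpace N → ℝ} (hY : ContDiff ℝ ∞ Y) :
    Measurable (cutDens p ρ Y) := by
  have h1 : Measurable fun z => |heatL Y z| ^ p := ((contDiff_heatL hY).continuous.abs.measurable).pow_const p
  have h2 : Measurable fun z => (if Y z ≠ 0 then (ρ ^ (2 * p))⁻¹ else 0) :=
    Measurable.ite (isOpen_ne_fun hY.continuous continuous_const).measurableSet measurable_const
      measurable_const
  have h3 : Measurable fun z => ∑ j, |dx j Y z| ^ (2 * p) := Finset.measurable_fun_sum _ fun j _ =>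
    ((contDiff_dx hY j).continuous.abs.measurable).pow_const _
  exact (h1.add h2).add h3

lemma lintegral_cutDens_le {p ρ a : ℝ} {Y : PSpace N → ℝ} (hY : ContDiff ℝ ∞ Y) (hρ : 0 < ρ)
    (ha : 0 ≤ a) (h1 : ∫⁻ z, ENNReal.ofReal (|heatL Y z| ^ p) ≤ ENNReal.ofReal a)
    (h2 : ∀ j, ∫⁻ z, ENNReal.ofReal (|dx j Y z| ^ (2 * p)) ≤ ENNReal.ofReal a)
    (h3 : volume {z | Y z ≠ 0} ≤ ENNReal.ofReal (ρ ^ (2 * p) * a)) :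
    ∫⁻ z, ENNReal.ofReal (cutDens p ρ Y z) ≤ ENNReal.ofReal ((N + 2) * a) := by
  have m1 : Measurable fun z => ENNReal.ofReal (|heatL Y z| ^ p) :=
    (((contDiff_heatL hY).continuous.abs.measurable).pow_const p).ennreal_ofReal
  have hS : MeasurableSet {z | Y z ≠ 0} := (isOpen_ne_fun hY.continuous continuous_const).measurableSet
  have m2 : Measurable fun z => ENNReal.ofReal (if Y z ≠ 0 then (ρ ^ (2 * p))⁻¹ else 0) :=
    (Measurable.ite hS measurable_const measurable_const).ennreal_ofReal
  have m3 : ∀ j, Measurable fun z => ENNReal.ofReal (|dx j Y z| ^ (2 * p)) := fun j =>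
    (((contDiff_dx hY j).continuous.abs.measurable).pow_const _).ennreal_ofReal
  have e : ∀ z, ENNReal.ofReal (cutDens p ρ Y z) = ENNReal.ofReal (|heatL Y z| ^ p)
      + ENNReal.ofReal (if Y z ≠ 0 then (ρ ^ (2 * p))⁻¹ else 0)
      + ∑ j, ENNReal.ofReal (|dx j Y z| ^ (2 * p)) := fun z => by
    have : 0 ≤ (if Y z ≠ 0 then (ρ ^ (2 * p))⁻¹ else 0) := by split_ifs <;> positivity
    rw [cutDens, ENNReal.ofReal_add (by positivity) (by positivity),
      ENNReal.ofReal_add (by positivity) this, ENNReal.ofReal_sum_of_nonneg fun _ _ => by positivity]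
  have i2 : ∫⁻ z, ENNReal.ofReal (if Y z ≠ 0 then (ρ ^ (2 * p))⁻¹ else 0) ≤ ENNReal.ofReal a := by
    have : (fun z => ENNReal.ofReal (if Y z ≠ 0 then (ρ ^ (2 * p))⁻¹ else 0))
        = indicator {z | Y z ≠ 0} fun _ => ENNReal.ofReal (ρ ^ (2 * p))⁻¹ := by
      funext z
      by_cases h : Y z ≠ 0
      · rw [if_pos h, indicator_of_mem (by exact h)]
      · rw [if_neg h, indicator_of_notMem (by exact h), ENNReal.ofReal_zero]
    rw [this, lintegral_indicator_const hS]
    refine (mul_le_mul_right h3 _).trans_eq ?_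
    rw [← ENNReal.ofReal_mul (by positivity), inv_mul_cancel_left₀ (by positivity)]
  have m12 : Measurable fun z => ENNReal.ofReal (|heatL Y z| ^ p)
      + ENNReal.ofReal (if Y z ≠ 0 then (ρ ^ (2 * p))⁻¹ else 0) := m1.add m2
  simp only [e]
  rw [lintegral_add_left m12, lintegral_add_left m1,
    lintegral_finsetSum _ fun j _ => m3 j]
  calc _ ≤ ENNReal.ofReal a + ENNReal.ofReal a + ∑ j : Fin N, ENNReal.ofReal a :=
        add_le_add (add_le_add h1 i2) (Finset.sum_le_sum fun j _ => h2 j)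
    _ = _ := by
        rw [← ENNReal.ofReal_sum_of_nonneg fun _ _ => ha, ← ENNReal.ofReal_add ha ha,
          ← ENNReal.ofReal_add (by positivity) (Finset.sum_nonneg fun _ _ => ha)]
        congr 1
        simp
        ring

lemma card_le_three {s : Finset ℕ} (h : ∀ m ∈ s, ∀ n ∈ s, m < n → n ≤ m + 2) : s.card ≤ 3 := by
  rcases s.eq_empty_or_nonempty with rfl | hs
  · simp
  have hsub : s ⊆ Finset.Icc (s.min' hs) (s.min' hs + 2) := fun n hn => by
    have h1 := s.min'_le n hn
    rw [Finset.mem_Icc]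
    refine ⟨h1, ?_⟩
    rcases h1.eq_or_lt with h2 | h2
    · omega
    · exact h _ (s.min'_mem hs) n hn h2
  refine (Finset.card_le_card hsub).trans ?_
  rw [Nat.card_Icc]
  omega

lemma opT_const (L : Fin N → ℝ) (a : ℝ) (z : PSpace N) : opT L (fun _ => a) z = 0 := by
  have h : ∀ i : Fin N, dx i (fun _ : PSpace N => a) = fun _ => 0 := fun i => by
    funext z; simp [dx]
  have h' : ∀ i : Fin N, dx i (fun _ : PSpace N => (0 : ℝ)) = fun _ => 0 := fun i => by
    funext z; simp [dx]
  simp [opT, gsq, heatL, dt, h, h']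

lemma cutDens_one {p ρ : ℝ} (hp : 0 < p) (z : PSpace N) :
    cutDens p ρ (fun _ : PSpace N => (1 : ℝ)) z = (ρ ^ (2 * p))⁻¹ := by
  have h : ∀ i : Fin N, dx i (fun _ : PSpace N => (1 : ℝ)) = fun _ => 0 := fun i => by
    funext z; simp [dx]
  have h' : ∀ i : Fin N, dx i (fun _ : PSpace N => (0 : ℝ)) = fun _ => 0 := fun i => by
    funext z; simp [dx]
  have h2 : (2 * p) ≠ 0 := by positivity
  simp [cutDens, heatL, dt, h, h', Real.zero_rpow hp.ne', Real.zero_rpow h2]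

/-- The closed two-sided parabolic box. -/
def pBox (z₀ : PSpace N) (ρ : ℝ) : Set (PSpace N) :=
  closedBall z₀.1 (2 * ρ) ×ˢ Icc (z₀.2 - 2 * ρ ^ 2) (z₀.2 + 2 * ρ ^ 2)

lemma isCompact_pBox (z₀ : PSpace N) (ρ : ℝ) : IsCompact (pBox z₀ ρ) :=
  (isCompact_closedBall _ _).prod isCompact_Icc

lemma mem_pBox {z₀ z : PSpace N} {ρ : ℝ} :
    z ∈ pBox z₀ ρ ↔ ‖z.1 - z₀.1‖ ≤ 2 * ρ ∧ |z.2 - z₀.2| ≤ 2 * ρ ^ 2 := by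
  rw [pBox, mem_prod, mem_closedBall, dist_eq_norm, mem_Icc, abs_le]
  constructor
  · rintro ⟨h1, h2, h3⟩; exact ⟨h1, by linarith, by linarith⟩
  · rintro ⟨h1, h2, h3⟩; exact ⟨h1, by linarith, by linarith⟩

lemma exists_ker_mul_opT_boxCut_le (N : ℕ) {p : ℝ} (hp : 1 < p) : ∃ C, 0 < C ∧
    ∀ (z₀ z : PSpace N) (τ ρ : ℝ), 0 < τ → 0 < ρ → z.2 < z₀.2 →
    ker z₀ τ z * opT (kerL z₀ τ z) (boxCut z₀ ρ) z ^ p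
      ≤ (pBox z₀ ρ).indicator (fun _ => C * (ρ ^ N)⁻¹ * (ρ ^ (2 * p))⁻¹) z := by
  obtain ⟨K, hK, hb⟩ := exists_boxCut_bound N
  obtain ⟨C, hC, h⟩ := exists_ker_mul_opT_le N hp hK
  have hp0 : 0 < p := by linarith
  refine ⟨C, hC, fun z₀ z τ ρ hτ hρ hz => ?_⟩
  by_cases h1 : z ∈ tsupport (boxCut z₀ ρ)
  swap
  · have h2 : boxCut z₀ ρ =ᶠ[𝓝 z] fun _ => 0 := notMem_tsupport_iff_eventuallyEq.1 h1
    rw [opT_congr h2, opT_const, Real.zero_rpow hp0.ne', mul_zero]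
    exact indicator_nonneg (fun _ _ => by positivity) _
  have h2 := tsupport_boxCut_subset z₀ hρ h1
  rw [indicator_of_mem (mem_pBox.2 h2)]
  by_cases h3 : ‖z.1 - z₀.1‖ < ρ ∧ |z.2 - z₀.2| < ρ ^ 2
  · have h4 : boxCut z₀ ρ =ᶠ[𝓝 z] fun _ => 1 := by
      have ho : IsOpen {z : PSpace N | ‖z.1 - z₀.1‖ < ρ ∧ |z.2 - z₀.2| < ρ ^ 2} :=
        (isOpen_lt (f := fun z : PSpace N => ‖z.1 - z₀.1‖) (by fun_prop) continuous_const).inter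
          (isOpen_lt (f := fun z : PSpace N => |z.2 - z₀.2|) (by fun_prop) continuous_const)
      filter_upwards [ho.mem_nhds h3] with y hy
      exact boxCut_eq_one hρ hy.1.le hy.2.le
    rw [opT_congr h4, opT_const, Real.zero_rpow hp0.ne', mul_zero]
    positivity
  obtain ⟨b1, b2⟩ := hb z₀ z ρ hρ
  have hS : ρ ^ 2 / 4 ≤ ‖z.1 - z₀.1‖ ^ 2 + sTime τ (z.2 - z₀.2) := by
    rw [sTime_of_nonpos hτ (by linarith)]
    by_cases h5 : ‖z.1 - z₀.1‖ < ρ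
    · have h6 : ρ ^ 2 ≤ |z.2 - z₀.2| := not_lt.1 fun h7 => h3 ⟨h5, h7⟩
      rw [abs_of_neg (by linarith)] at h6
      nlinarith [sq_nonneg ‖z.1 - z₀.1‖]
    · have : ρ ^ 2 ≤ ‖z.1 - z₀.1‖ ^ 2 := by gcongr; exact not_lt.1 h5
      nlinarith
  have h6 := h z₀ z τ ρ (boxCut z₀ ρ) (fun _ => 1) hτ hρ (contDiff_boxCut _ _) contDiff_const
    (fun _ => zero_le_one) (fun _ => le_rfl) h2.1 hS
    (by rw [abs_of_nonneg boxCut_nonneg]; exact boxCut_le_one) b1 b2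
  have h7 := cutDens_one (N := N) (ρ := ρ) hp0 z
  unfold cutDens at h7
  simp only [mul_one] at h6
  rwa [h7] at h6

lemma exists_ker_mul_opT_shellCut_le (N : ℕ) {p : ℝ} (hp : 1 < p) : ∃ C, 0 < C ∧
    ∀ (z₀ z : PSpace N) (J i : ℕ) (Y : PSpace N → ℝ), i ≤ J → z.2 < z₀.2 →
    ContDiff ℝ ∞ Y → (∀ z, 0 ≤ Y z) → (∀ z, Y z ≤ 1) → z ∈ tsupport (shellCut z₀ J i) →
    ker z₀ (((1 / 2) ^ J) ^ 2) z *
      opT (kerL z₀ (((1 / 2) ^ J) ^ 2) z) (fun z => shellCut z₀ J i z * Y z) z ^ p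
      ≤ C * (((1 / 2) ^ i) ^ N)⁻¹ * cutDens p ((1 / 2) ^ i) Y z := by
  obtain ⟨K, hK, hb⟩ := exists_shellCut_bound N
  obtain ⟨C, hC, h⟩ := exists_ker_mul_opT_le N hp hK
  refine ⟨C, hC, fun z₀ z J i Y hi hz hY hY0 hY1 h1 => ?_⟩
  obtain ⟨b1, b2⟩ := hb z₀ z J i
  obtain ⟨h2, h3⟩ := tsupport_shellCut_subset z₀ J i h1
  refine h z₀ z _ _ _ Y (by positivity) (by positivity) (contDiff_shellCut _ _ _) hY hY0 hY1 h2.1 ?_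
    (by rw [abs_of_nonneg (shellCut_nonneg _ _ _ _)]; exact shellCut_le_one _ _ _ _) b1 b2
  rw [sTime_of_nonpos (by positivity) (by linarith)]
  rw [abs_of_neg (by linarith)] at h3
  have hρ : (0 : ℝ) < (1 / 2) ^ i := by positivity
  have hJ : (0 : ℝ) < ((1 / 2) ^ J) ^ 2 := by positivity
  rcases hi.lt_or_eq with h4 | rfl
  · rcases h3 h4 with h5 | h5
    · have : ((1 / 2 : ℝ) ^ i / 2) ^ 2 ≤ ‖z.1 - z₀.1‖ ^ 2 := by gcongr
      nlinarith
    · nlinarith [sq_nonneg ‖z.1 - z₀.1‖]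
  · nlinarith [sq_nonneg ‖z.1 - z₀.1‖]

lemma le_add_two_of_mem_tsupport_shellCut {z₀ z : PSpace N} {J m n : ℕ} (hmn : m < n) (hn : n ≤ J)
    (hm : z ∈ tsupport (shellCut z₀ J m)) (hn' : z ∈ tsupport (shellCut z₀ J n)) : n ≤ m + 2 := by
  obtain ⟨-, h1⟩ := tsupport_shellCut_subset z₀ J m hm
  obtain ⟨⟨h2, h3⟩, -⟩ := tsupport_shellCut_subset z₀ J n hn'
  by_contra! h
  have h4 : (1 / 2 : ℝ) ^ n ≤ (1 / 2) ^ (m + 3) := pow_le_pow_of_le_one (by norm_num) (by norm_num) h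
  have h5 : (1 / 2 : ℝ) ^ (m + 3) = (1 / 2) ^ m / 8 := by ring
  have h6 : (0 : ℝ) < (1 / 2) ^ m := by positivity
  have h7 : (0 : ℝ) < (1 / 2) ^ n := by positivity
  rcases h1 (hmn.trans_le hn) with h8 | h8
  · linarith
  · have : ((1 / 2 : ℝ) ^ n) ^ 2 ≤ ((1 / 2) ^ m / 8) ^ 2 := by gcongr; linarith
    nlinarith

lemma exists_cutoff_seq {O : Set (PSpace N)} (hO : IsOpen O) (z₀ : PSpace N) {p : ℝ} (hp : 1 < p)
    (hfin : ∫⁻ ρ in Ioo (0 : ℝ) 1,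
      ENNReal.ofReal (cap21 N p (Oᶜ ∩ pQ N ρ z₀) / ρ ^ (N + 1)) ≠ ⊤) (n₀ : ℕ) :
    ∃ i₀ ≥ n₀, ∃ (ε : ℕ → ℝ) (Y : ℕ → PSpace N → ℝ), (∀ i, 0 ≤ ε i) ∧ Summable ε ∧
      (∀ i, ContDiff ℝ ∞ (Y i)) ∧ (∀ i z, 0 ≤ Y i z) ∧ (∀ i z, Y i z ≤ 1) ∧
      ∀ i ≥ i₀, (∃ U, IsOpen U ∧ lowerCompl O z₀ ((1 / 2) ^ i) ⊆ U ∧ ∀ z ∈ U, Y i z = 1) ∧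
        ∫⁻ z, ENNReal.ofReal (cutDens p ((1 / 2) ^ i) (Y i) z)
          ≤ ENNReal.ofReal (ε i * ((1 / 2) ^ i) ^ N) ∧
        volume {z | Y i z ≠ 0} ≤ ENNReal.ofReal (ε i * ((1 / 2) ^ i) ^ (N + 2)) := by
  obtain ⟨c, hc0, hcs, hc⟩ := exists_capacity_seq hO z₀ p hfin
  obtain ⟨C, κ, hC, hκ, hcut⟩ := exists_cutoff N hp
  have hev : ∀ᶠ i in atTop, c i * (((1 / 2 : ℝ) ^ i) ^ N)⁻¹ < κ :=
    hcs.tendsto_atTop_zero.eventually_lt_const hκ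
  obtain ⟨i₁, hi₁⟩ := eventually_atTop.1 hev
  have key : ∀ i, ∃ Y : PSpace N → ℝ, ContDiff ℝ ∞ Y ∧ (∀ z, 0 ≤ Y z) ∧ (∀ z, Y z ≤ 1) ∧
      (max n₀ i₁ ≤ i → (∃ U, IsOpen U ∧ lowerCompl O z₀ ((1 / 2) ^ i) ⊆ U ∧ ∀ z ∈ U, Y z = 1) ∧
        ∫⁻ z, ENNReal.ofReal (cutDens p ((1 / 2) ^ i) Y z)
          ≤ ENNReal.ofReal ((N + 2) * C * (c i * (((1 / 2 : ℝ) ^ i) ^ N)⁻¹) * ((1 / 2) ^ i) ^ N) ∧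
        volume {z | Y z ≠ 0} ≤ ENNReal.ofReal
          ((N + 2) * C * (c i * (((1 / 2 : ℝ) ^ i) ^ N)⁻¹) * ((1 / 2) ^ i) ^ (N + 2))) := by
    intro i
    by_cases hi : max n₀ i₁ ≤ i
    swap
    · exact ⟨fun _ => 0, contDiff_const, fun _ => le_rfl, fun _ => zero_le_one, fun h => absurd h hi⟩
    obtain ⟨φ, U, hU, hsub, hφ, hW⟩ := hc i
    have hρ : (0 : ℝ) < (1 / 2) ^ i := by positivity
    have hρ1 : ((1 : ℝ) / 2) ^ i ≤ 1 := pow_le_one₀ (by norm_num) (by norm_num)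
    have hcκ : c i ≤ κ * ((1 / 2) ^ i) ^ N := by
      have := (hi₁ i (le_trans (le_max_right _ _) hi)).le
      rwa [← div_eq_mul_inv, div_le_iff₀ (by positivity)] at this
    obtain ⟨Y, hY, hY0, hY1, hYU, h1, h2, h3⟩ := hcut _ φ U (c i) hρ hρ1 hφ hW hcκ
    have h3' : volume {z | Y z ≠ 0} ≤ ENNReal.ofReal (((1 / 2) ^ i) ^ (2 * p) * (C * c i)) := by
      convert h3 using 2; ring
    refine ⟨Y, hY, hY0, hY1, fun _ => ⟨⟨U, hU, hsub, hYU⟩, ?_, ?_⟩⟩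
    · refine (lintegral_cutDens_le hY hρ (mul_nonneg hC.le (hc0 i)) h1 h2 h3').trans_eq ?_
      congr 1
      field_simp
    · refine h3'.trans (ENNReal.ofReal_le_ofReal ?_)
      have e1 : (((1 : ℝ) / 2) ^ i) ^ (2 * p) ≤ ((1 / 2) ^ i) ^ 2 := by
        rw [← Real.rpow_natCast (((1 : ℝ) / 2) ^ i) 2]
        exact Real.rpow_le_rpow_of_exponent_ge hρ hρ1 (by push_cast; linarith)
      have e2 : (N + 2) * C * (c i * (((1 / 2 : ℝ) ^ i) ^ N)⁻¹) * ((1 / 2) ^ i) ^ (N + 2)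
          = ((1 / 2) ^ i) ^ 2 * ((N + 2) * (C * c i)) := by
        rw [pow_add (((1 : ℝ) / 2) ^ i)]
        field_simp
      rw [e2]
      have : 0 ≤ C * c i := mul_nonneg hC.le (hc0 i)
      have hN : (0 : ℝ) ≤ N := Nat.cast_nonneg N
      exact mul_le_mul e1 (le_mul_of_one_le_left this (by linarith)) this (by positivity)
  choose Y hY hY0 hY1 hYi using key
  refine ⟨max n₀ i₁, le_max_left _ _, fun i => (N + 2) * C * (c i * (((1 / 2 : ℝ) ^ i) ^ N)⁻¹), Y,
    fun i => ?_, hcs.mul_left _, hY, hY0, hY1, fun i hi => hYi i hi⟩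
  have := hc0 i
  positivity

/-- The cutoff function of the complement of `O` built from the cutoffs `Y i` of the shells. -/
def glued (z₀ : PSpace N) (Y : ℕ → PSpace N → ℝ) (i₀ J : ℕ) (z : PSpace N) : ℝ :=
  boxCut z₀ ((1 / 2) ^ i₀) z + ∑ i ∈ Finset.Ico i₀ (J + 1), -(shellCut z₀ J i z * Y i z)

section
variable {z₀ : PSpace N} {Y : ℕ → PSpace N → ℝ} {i₀ J : ℕ}

lemma contDiff_neg_shellCut_mul (z₀ : PSpace N) (J : ℕ) (hY : ∀ i, ContDiff ℝ ∞ (Y i)) (i : ℕ) :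
    ContDiff ℝ ∞ fun z => -(shellCut z₀ J i z * Y i z) :=
  ((contDiff_shellCut z₀ J i).mul (hY i)).neg

lemma contDiff_glued (z₀ : PSpace N) (i₀ J : ℕ) (hY : ∀ i, ContDiff ℝ ∞ (Y i)) :
    ContDiff ℝ ∞ (glued z₀ Y i₀ J) :=
  (contDiff_boxCut _ _).add (contDiff_finsetSum (contDiff_neg_shellCut_mul z₀ J hY))

lemma glued_eq_sum (Y : ℕ → PSpace N → ℝ) (h : i₀ ≤ J) (z : PSpace N) :
    glued z₀ Y i₀ J z = ∑ i ∈ Finset.Ico i₀ (J + 1), shellCut z₀ J i z * (1 - Y i z) := by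
  rw [glued, ← sum_shellCut h, ← Finset.sum_add_distrib]
  exact Finset.sum_congr rfl fun i _ => by ring

lemma glued_nonneg (hY1 : ∀ i z, Y i z ≤ 1) (h : i₀ ≤ J) (z : PSpace N) :
    0 ≤ glued z₀ Y i₀ J z := by
  rw [glued_eq_sum Y h]
  exact Finset.sum_nonneg fun i _ =>
    mul_nonneg (shellCut_nonneg _ _ _ _) (by linarith [hY1 i z])

lemma glued_le_boxCut (hY0 : ∀ i z, 0 ≤ Y i z) (z : PSpace N) :
    glued z₀ Y i₀ J z ≤ boxCut z₀ ((1 / 2) ^ i₀) z := by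
  have : ∑ i ∈ Finset.Ico i₀ (J + 1), -(shellCut z₀ J i z * Y i z) ≤ 0 :=
    Finset.sum_nonpos fun i _ =>
      neg_nonpos.2 (mul_nonneg (shellCut_nonneg _ _ _ _) (hY0 i z))
  rw [glued]
  linarith

lemma glued_eventuallyEq_zero {O : Set (PSpace N)} (h : i₀ ≤ J)
    (hU : ∀ i ≥ i₀, ∃ U, IsOpen U ∧ lowerCompl O z₀ ((1 / 2) ^ i) ⊆ U ∧ ∀ z ∈ U, Y i z = 1)
    {z : PSpace N} (hz : z ∉ O) (hz' : z.2 ≤ z₀.2) : glued z₀ Y i₀ J =ᶠ[𝓝 z] fun _ => 0 := by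
  have : ∀ᶠ y in 𝓝 z, ∀ i ∈ Finset.Ico i₀ (J + 1), shellCut z₀ J i y * (1 - Y i y) = 0 := by
    rw [eventually_all_finset]
    intro i hi
    by_cases h1 : z ∈ tsupport (shellCut z₀ J i)
    · obtain ⟨U, hUo, hsub, hU1⟩ := hU i (Finset.mem_Ico.1 hi).1
      obtain ⟨h2, -⟩ := tsupport_shellCut_subset z₀ J i h1
      have hzU : z ∈ U := hsub ⟨hz, by rw [mem_closedBall, dist_eq_norm]; exact h2.1,
        by linarith [(abs_le.1 h2.2).1], hz'⟩
      filter_upwards [hUo.mem_nhds hzU] with y hy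
      rw [hU1 y hy, sub_self, mul_zero]
    · filter_upwards [notMem_tsupport_iff_eventuallyEq.1 h1] with y hy
      rw [hy, Pi.zero_apply, zero_mul]
  filter_upwards [this] with y hy
  rw [glued_eq_sum Y h]
  exact Finset.sum_eq_zero hy

lemma glued_eq_one_sub (h : i₀ ≤ J) {z : PSpace N} (h1 : ‖z.1 - z₀.1‖ ≤ (1 / 2) ^ J)
    (h2 : |z.2 - z₀.2| ≤ ((1 / 2) ^ J) ^ 2) : glued z₀ Y i₀ J z = 1 - Y J z := by
  have hb : ∀ i ≤ J, boxCut z₀ ((1 / 2) ^ i) z = 1 := fun i hi => by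
    have h3 : (1 / 2 : ℝ) ^ J ≤ (1 / 2) ^ i :=
      pow_le_pow_of_le_one (by norm_num) (by norm_num) hi
    exact boxCut_eq_one (by positivity) (h1.trans h3) (h2.trans (by gcongr))
  rw [glued_eq_sum Y h, Finset.sum_Ico_succ_top h, Finset.sum_eq_zero, zero_add, shellCut,
    if_neg (lt_irrefl J), hb J le_rfl, add_zero, one_mul]
  intro i hi
  have hi' := (Finset.mem_Ico.1 hi).2
  rw [shellCut, if_pos hi', hb i hi'.le, hb (i + 1) hi', add_neg_cancel, zero_mul]

lemma opT_glued_rpow_le {L : Fin N → ℝ} (hL : ∀ j, 0 ≤ L j) {p : ℝ} (hp : 0 < p)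
    (hY : ∀ i, ContDiff ℝ ∞ (Y i)) (z : PSpace N) :
    ∃ A ⊆ Finset.Ico i₀ (J + 1), (∀ i ∈ A, z ∈ tsupport (shellCut z₀ J i)) ∧
      opT L (glued z₀ Y i₀ J) z ^ p ≤ 30 ^ p * (opT L (boxCut z₀ ((1 / 2) ^ i₀)) z ^ p
        + ∑ i ∈ A, opT L (fun z => shellCut z₀ J i z * Y i z) z ^ p) := by
  classical
  set A := (Finset.Ico i₀ (J + 1)).filter fun i => z ∈ tsupport (shellCut z₀ J i) with hA
  have hAt : ∀ i ∈ A, z ∈ tsupport (shellCut z₀ J i) := fun i hi => (Finset.mem_filter.1 hi).2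
  have hcard : A.card ≤ 3 := card_le_three fun m hm n hn hmn =>
    le_add_two_of_mem_tsupport_shellCut hmn
      (Nat.lt_succ_iff.1 (Finset.mem_Ico.1 (Finset.mem_filter.1 hn).1).2) (hAt m hm) (hAt n hn)
  refine ⟨A, Finset.filter_subset _ _, hAt, ?_⟩
  set b : ℕ → PSpace N → ℝ := fun i z => -(shellCut z₀ J i z * Y i z) with hb
  have hbd : ∀ i, ContDiff ℝ ∞ (b i) := contDiff_neg_shellCut_mul z₀ J hY
  have hcongr : (fun z => ∑ i ∈ Finset.Ico i₀ (J + 1), b i z) =ᶠ[𝓝 z] fun z => ∑ i ∈ A, b i z := by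
    have : ∀ᶠ y in 𝓝 z, ∀ i ∈ Finset.Ico i₀ (J + 1), i ∉ A → b i y = 0 := by
      rw [eventually_all_finset]
      intro i hi
      by_cases h1 : i ∈ A
      · exact Eventually.of_forall fun _ h => absurd h1 h
      · have h2 : z ∉ tsupport (shellCut z₀ J i) := fun h => h1 (Finset.mem_filter.2 ⟨hi, h⟩)
        filter_upwards [notMem_tsupport_iff_eventuallyEq.1 h2] with y hy _
        simp only [hb, hy, Pi.zero_apply, zero_mul, neg_zero]
    filter_upwards [this] with y hy
    exact (Finset.sum_subset (Finset.filter_subset _ _) hy).symm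
  have hS0 : 0 ≤ ∑ i ∈ A, opT L (b i) z := Finset.sum_nonneg fun i _ => opT_nonneg hL _ _
  have hG0 := opT_nonneg hL (boxCut z₀ ((1 / 2) ^ i₀)) z
  have h1 : opT L (glued z₀ Y i₀ J) z
      ≤ 6 * (opT L (boxCut z₀ ((1 / 2) ^ i₀)) z + 0 + ∑ i ∈ A, opT L (b i) z) := by
    have e1 := opT_add_le (z := z) hL (contDiff_boxCut z₀ ((1 / 2) ^ i₀))
      (contDiff_finsetSum (s := Finset.Ico i₀ (J + 1)) hbd)
    have e2 := opT_sum_le (z := z) hL A hbd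
    rw [opT_congr hcongr] at e1
    have e3 : (A.card : ℝ) ≤ 3 := by exact_mod_cast hcard
    have e4 := mul_le_mul_of_nonneg_right e3 hS0
    change opT L (fun z => boxCut z₀ ((1 / 2) ^ i₀) z + ∑ i ∈ Finset.Ico i₀ (J + 1), b i z) z ≤ _
    linarith
  have h2 := add_sum_rpow_le A hp hG0 le_rfl (d := fun i => opT L (b i) z)
    fun i _ => opT_nonneg hL _ _
  rw [Real.zero_rpow hp.ne'] at h2
  have h3 : ((A.card : ℝ) + 2) ^ p ≤ 5 ^ p := by
    have : (A.card : ℝ) ≤ 3 := by exact_mod_cast hcard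
    exact Real.rpow_le_rpow (by positivity) (by linarith) hp.le
  have h4 : 0 ≤ opT L (boxCut z₀ ((1 / 2) ^ i₀)) z ^ p + 0 + ∑ i ∈ A, opT L (b i) z ^ p :=
    add_nonneg (by positivity)
      (Finset.sum_nonneg fun i _ => Real.rpow_nonneg (opT_nonneg hL _ _) _)
  calc opT L (glued z₀ Y i₀ J) z ^ p
      ≤ (6 * (opT L (boxCut z₀ ((1 / 2) ^ i₀)) z + 0 + ∑ i ∈ A, opT L (b i) z)) ^ p :=
        Real.rpow_le_rpow (opT_nonneg hL _ _) h1 hp.le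
    _ = 6 ^ p * (opT L (boxCut z₀ ((1 / 2) ^ i₀)) z + 0 + ∑ i ∈ A, opT L (b i) z) ^ p :=
        Real.mul_rpow (by norm_num) (by positivity)
    _ ≤ 6 ^ p * (5 ^ p * (opT L (boxCut z₀ ((1 / 2) ^ i₀)) z ^ p + 0
          + ∑ i ∈ A, opT L (b i) z ^ p)) := by
        gcongr
        exact h2.trans (mul_le_mul_of_nonneg_right h3 h4)
    _ = _ := by
        rw [← mul_assoc, ← Real.mul_rpow (by norm_num) (by norm_num), add_zero]
        norm_num [hb, opT_neg]
end

lemma lintegral_ker_mul_opT_glued_le (N : ℕ) {p : ℝ} (hp : 1 < p) : ∃ C, 0 < C ∧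
    ∀ (z₀ : PSpace N) (ε : ℕ → ℝ) (Y : ℕ → PSpace N → ℝ) (i₀ J : ℕ), (∀ i, 0 ≤ ε i) → Summable ε →
      (∀ i, ContDiff ℝ ∞ (Y i)) → (∀ i z, 0 ≤ Y i z) → (∀ i z, Y i z ≤ 1) →
      (∀ i ≥ i₀, ∫⁻ z, ENNReal.ofReal (cutDens p ((1 / 2) ^ i) (Y i) z)
          ≤ ENNReal.ofReal (ε i * ((1 / 2) ^ i) ^ N)) →
      ∫⁻ z in {z | z.2 < z₀.2}, ENNReal.ofReal (ker z₀ (((1 / 2) ^ J) ^ 2) z *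
        opT (kerL z₀ (((1 / 2) ^ J) ^ 2) z) (glued z₀ Y i₀ J) z ^ p)
      ≤ ENNReal.ofReal (C * (((((1 / 2) ^ i₀) ^ N)⁻¹ * ((((1 / 2) ^ i₀) ^ (2 * p)))⁻¹)
        * (volume (pBox z₀ ((1 / 2) ^ i₀))).toReal + ∑' i, ε i)) := by
  obtain ⟨C1, hC1, h1⟩ := exists_ker_mul_opT_boxCut_le N hp
  obtain ⟨C2, hC2, h2⟩ := exists_ker_mul_opT_shellCut_le N hp
  have hp0 : 0 < p := by linarith
  refine ⟨30 ^ p * (C1 + C2), by positivity, fun z₀ ε Y i₀ J hε hεs hY hY0 hY1 hYd => ?_⟩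
  set τ : ℝ := ((1 / 2) ^ J) ^ 2 with hτd
  have hτ : 0 < τ := by positivity
  set a : ℝ := (((1 / 2) ^ i₀) ^ N)⁻¹ * ((((1 / 2) ^ i₀) ^ (2 * p)))⁻¹ with ha
  have ha0 : 0 < a := by positivity
  set B := pBox z₀ ((1 / 2) ^ i₀) with hB
  have hBm : MeasurableSet B := (isCompact_pBox _ _).measurableSet
  have hBf : volume B ≠ ⊤ := (isCompact_pBox _ _).measure_lt_top.ne
  have hd : ∀ i z, 0 ≤ cutDens p ((1 / 2) ^ i) (Y i) z := fun i z => cutDens_nonneg (by positivity) _ _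
  have hpt : ∀ z ∈ {z : PSpace N | z.2 < z₀.2},
      ENNReal.ofReal (ker z₀ τ z * opT (kerL z₀ τ z) (glued z₀ Y i₀ J) z ^ p)
      ≤ B.indicator (fun _ => ENNReal.ofReal (30 ^ p * (C1 * a))) z
        + ∑ i ∈ Finset.Ico i₀ (J + 1), ENNReal.ofReal (30 ^ p * C2 * (((1 / 2) ^ i) ^ N)⁻¹) *
          ENNReal.ofReal (cutDens p ((1 / 2) ^ i) (Y i) z) := by
    intro z hz
    obtain ⟨A, hA, hAt, hle⟩ := opT_glued_rpow_le (z₀ := z₀) (i₀ := i₀) (J := J)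
      (kerL_nonneg hτ z₀ z) hp0 hY z
    have e1 : ker z₀ τ z * opT (kerL z₀ τ z) (glued z₀ Y i₀ J) z ^ p
        ≤ 30 ^ p * (B.indicator (fun _ => C1 * a) z
          + ∑ i ∈ Finset.Ico i₀ (J + 1),
            C2 * (((1 / 2) ^ i) ^ N)⁻¹ * cutDens p ((1 / 2) ^ i) (Y i) z) := by
      refine (mul_le_mul_of_nonneg_left hle (ker_pos z₀ τ z).le).trans ?_
      rw [mul_left_comm, mul_add, Finset.mul_sum]
      have e2 := h1 z₀ z τ ((1 / 2) ^ i₀) hτ (by positivity) hz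
      rw [mul_assoc] at e2
      refine mul_le_mul_of_nonneg_left (add_le_add e2 ?_) (by positivity)
      refine (Finset.sum_le_sum fun i hi => h2 z₀ z J i (Y i)
        (Nat.lt_succ_iff.1 (Finset.mem_Ico.1 (hA hi)).2) hz (hY i) (hY0 i) (hY1 i) (hAt i hi)).trans ?_
      exact Finset.sum_le_sum_of_subset_of_nonneg hA fun i _ _ =>
        mul_nonneg (by positivity) (hd i z)
    refine (ENNReal.ofReal_le_ofReal e1).trans ?_
    rw [mul_add, Finset.mul_sum]
    refine ENNReal.ofReal_add_le.trans (add_le_add ?_ ?_)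
    · by_cases hzB : z ∈ B
      · rw [indicator_of_mem hzB, indicator_of_mem hzB]
      · rw [indicator_of_notMem hzB, indicator_of_notMem hzB, mul_zero, ENNReal.ofReal_zero]
    · rw [ENNReal.ofReal_sum_of_nonneg fun i _ =>
        mul_nonneg (by positivity) (mul_nonneg (by positivity) (hd i z))]
      refine Finset.sum_le_sum fun i _ => ?_
      rw [← ENNReal.ofReal_mul (by positivity)]
      exact (congrArg ENNReal.ofReal (by ring)).le
  have hS : MeasurableSet {z : PSpace N | z.2 < z₀.2} :=
    (isOpen_lt continuous_snd continuous_const).measurableSet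
  refine (setLIntegral_mono' hS hpt).trans ((setLIntegral_le_lintegral _ _).trans ?_)
  have hm1 : Measurable fun z => B.indicator (fun _ => ENNReal.ofReal (30 ^ p * (C1 * a))) z :=
    measurable_const.indicator hBm
  have hm2 : ∀ i, Measurable fun z => ENNReal.ofReal (30 ^ p * C2 * (((1 / 2) ^ i) ^ N)⁻¹) *
      ENNReal.ofReal (cutDens p ((1 / 2) ^ i) (Y i) z) := fun i =>
    ((measurable_cutDens (hY i)).ennreal_ofReal).const_mul _
  rw [lintegral_add_left hm1, lintegral_finsetSum _ fun i _ => hm2 i,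
    lintegral_indicator_const hBm]
  have e3 : ∑ i ∈ Finset.Ico i₀ (J + 1), ∫⁻ z, ENNReal.ofReal (30 ^ p * C2 * (((1 / 2) ^ i) ^ N)⁻¹) *
      ENNReal.ofReal (cutDens p ((1 / 2) ^ i) (Y i) z)
      ≤ ∑ i ∈ Finset.Ico i₀ (J + 1), ENNReal.ofReal (30 ^ p * C2 * ε i) := by
    refine Finset.sum_le_sum fun i hi => ?_
    rw [lintegral_const_mul _ (measurable_cutDens (hY i)).ennreal_ofReal]
    refine (mul_le_mul_right (hYd i (Finset.mem_Ico.1 hi).1) _).trans_eq ?_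
    rw [← ENNReal.ofReal_mul (by positivity)]
    congr 1
    field_simp
  have e4 : ∑ i ∈ Finset.Ico i₀ (J + 1), ENNReal.ofReal (30 ^ p * C2 * ε i)
      ≤ ENNReal.ofReal (30 ^ p * C2 * ∑' i, ε i) := by
    rw [← ENNReal.ofReal_sum_of_nonneg fun i _ => mul_nonneg (by positivity) (hε i),
      ← Finset.mul_sum]
    exact ENNReal.ofReal_le_ofReal (mul_le_mul_of_nonneg_left
      (hεs.sum_le_tsum _ fun i _ => hε i) (by positivity))
  have e5 : ENNReal.ofReal (30 ^ p * (C1 * a)) * volume B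
      = ENNReal.ofReal (30 ^ p * (C1 * a) * (volume B).toReal) := by
    rw [ENNReal.ofReal_mul (p := 30 ^ p * (C1 * a)) (by positivity), ENNReal.ofReal_toReal hBf]
  have hT : 0 ≤ ∑' i, ε i := tsum_nonneg hε
  refine (add_le_add e5.le (e3.trans e4)).trans ?_
  rw [← ENNReal.ofReal_add (by positivity) (by positivity)]
  refine ENNReal.ofReal_le_ofReal ?_
  have q1 : 0 ≤ 30 ^ p * (C2 * a) * (volume B).toReal := by positivity
  have q2 : 0 ≤ 30 ^ p * C1 * ∑' i, ε i := by positivity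
  nlinarith

/-- If the Wiener integral converges at `z₀`, then there are cutoff functions vanishing near the
part of the complement of `O` below `z₀` which are almost equal to one near `z₀`, and whose energy
with respect to the backward kernel with pole `z₀` stays bounded. -/
lemma exists_barrier {O : Set (PSpace N)} (hO : IsOpen O) (z₀ : PSpace N) {p : ℝ} (hp : 1 < p)
    (hfin : ∫⁻ ρ in Ioo (0 : ℝ) 1,
      ENNReal.ofReal (cap21 N p (Oᶜ ∩ pQ N ρ z₀) / ρ ^ (N + 1)) ≠ ⊤) (n₀ : ℕ) :
    ∃ i₀ ≥ n₀, ∃ (C : ℝ) (ε : ℕ → ℝ), 0 ≤ C ∧ Tendsto ε atTop (𝓝 0) ∧ ∀ J ≥ i₀,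
      ∃ Z : PSpace N → ℝ, ContDiff ℝ ∞ Z ∧ (∀ z, 0 ≤ Z z) ∧ (∀ z, Z z ≤ 1) ∧
        (∀ z, Z z ≠ 0 → ‖z.1 - z₀.1‖ < 2 * (1 / 2) ^ i₀ ∧ |z.2 - z₀.2| < 2 * ((1 / 2) ^ i₀) ^ 2) ∧
        (∀ z ∉ O, z.2 ≤ z₀.2 → Z =ᶠ[𝓝 z] fun _ => 0) ∧
        volume {z | ‖z.1 - z₀.1‖ ≤ (1 / 2) ^ J ∧ |z.2 - z₀.2| ≤ ((1 / 2) ^ J) ^ 2 ∧ Z z ≠ 1}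
          ≤ ENNReal.ofReal (ε J * ((1 / 2) ^ J) ^ (N + 2)) ∧
        ∫⁻ z in {z | z.2 < z₀.2}, ENNReal.ofReal (ker z₀ (((1 / 2) ^ J) ^ 2) z *
          opT (kerL z₀ (((1 / 2) ^ J) ^ 2) z) Z z ^ p) ≤ ENNReal.ofReal C := by
  obtain ⟨i₀, hi₀, ε, Y, hε, hεs, hY, hY0, hY1, hYi⟩ := exists_cutoff_seq hO z₀ hp hfin n₀
  obtain ⟨C, hC, h⟩ := lintegral_ker_mul_opT_glued_le N hp
  have hT : 0 ≤ ∑' i, ε i := tsum_nonneg hε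
  refine ⟨i₀, hi₀, _, ε, ?_, hεs.tendsto_atTop_zero, fun J hJ => ⟨glued z₀ Y i₀ J,
    contDiff_glued _ _ _ hY, glued_nonneg hY1 hJ, fun z => (glued_le_boxCut hY0 z).trans boxCut_le_one,
    fun z hz => lt_of_boxCut_ne_zero (by positivity) ?_, fun z hz hz' =>
      glued_eventuallyEq_zero hJ (fun i hi => (hYi i hi).1) hz hz', ?_,
    h z₀ ε Y i₀ J hε hεs hY hY0 hY1 fun i hi => (hYi i hi).2.1⟩⟩
  · positivity
  · exact (((glued_nonneg hY1 hJ z).lt_of_ne' hz).trans_le (glued_le_boxCut hY0 z)).ne'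
  · refine (measure_mono ?_).trans (hYi J hJ).2.2
    rintro z ⟨h1, h2, h3⟩
    rw [glued_eq_one_sub hJ h1 h2] at h3
    intro h4
    exact h3 (by rw [h4, sub_zero])

section
variable {O : Set (PSpace N)} {u : PSpace N → ℝ}

lemma continuous_mul_of_tsupport (hO : IsOpen O) {v η : PSpace N → ℝ} (hv : ContinuousOn v O)
    (hη : Continuous η) (hs : tsupport η ⊆ O) : Continuous fun z => v z * η z :=
  continuous_of_tsupport fun _ hz =>
    (hv.continuousAt (hO.mem_nhds (hs (tsupport_mul_subset_right hz)))).mul hη.continuousAt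

lemma integrable_mul_of_tsupport (hO : IsOpen O) {v η : PSpace N → ℝ} (hv : ContinuousOn v O)
    (hη : Continuous η) (hc : HasCompactSupport η) (hs : tsupport η ⊆ O) :
    Integrable fun z => v z * η z :=
  (continuous_mul_of_tsupport hO hv hη hs).integrable_of_hasCompactSupport hc.mul_left

lemma integral_mul_fderiv_eq_neg (hO : IsOpen O) {u u' η : PSpace N → ℝ} {v : PSpace N}
    (hu : ContinuousOn u O) (hu' : ContinuousOn u' O)
    (hd : ∀ z ∈ O, HasLineDerivAt ℝ u (u' z) z v) (hη : ContDiff ℝ ∞ η)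
    (hc : HasCompactSupport η) (hs : tsupport η ⊆ O) :
    ∫ z, u z * fderiv ℝ η z v = -∫ z, u' z * η z := by
  have h1 : tsupport (fun z => fderiv ℝ η z v) ⊆ O := (tsupport_fderiv_apply_subset ℝ v).trans hs
  exact integral_bilinear_hasLineDerivAt_right_eq_neg_left_of_integrable
    (B := ContinuousLinearMap.mul ℝ ℝ) (μ := (volume : Measure (PSpace N)))
    (integrable_mul_of_tsupport hO hu' hη.continuous hc hs)
    (integrable_mul_of_tsupport hO hu (contDiff_fderiv_apply hη v).continuous
      (hc.fderiv_apply ℝ v) h1)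
    (integrable_mul_of_tsupport hO hu hη.continuous hc hs)
    (fun z hz => hd z (hs hz))
    (fun z _ => (differentiable_of_contDiff hη z).hasFDerivAt.hasLineDerivAt v)

lemma hasLineDerivAt_tDeriv (hu : IsC21 O u) {z : PSpace N} (hz : z ∈ O) :
    HasLineDerivAt ℝ u (tDeriv u z) z (eT N) := by
  have h : HasDerivAt (fun s => u (z.1, s)) (tDeriv u z) (z.2 + 0) := by
    rw [add_zero]; exact (hu.diff_t z hz).hasDerivAt
  have h2 := HasDerivAt.comp_const_add z.2 0 h
  have e : (fun r : ℝ => u (z + r • eT N)) = fun r => u (z.1, z.2 + r) := by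
    funext r
    congr 1
    ext1 <;> simp [eT]
  unfold HasLineDerivAt
  rw [e]
  exact h2

lemma hasLineDerivAt_of_slice {v : PSpace N → ℝ} {i : Fin N} {z : PSpace N}
    (h : LineDifferentiableAt ℝ (fun y => v (y, z.2)) z.1 (EuclideanSpace.single i 1)) :
    HasLineDerivAt ℝ v (xDeriv i v z) z (eX i) := by
  have h2 := h.hasLineDerivAt
  have e : (fun r : ℝ => v (z + r • eX i)) = fun r =>
      v (z.1 + r • EuclideanSpace.single i (1 : ℝ), z.2) := by
    funext r
    congr 1
    ext1 <;> simp [eX]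
  unfold HasLineDerivAt at h2 ⊢
  rw [e]
  exact h2

lemma integral_mul_heatL (hO : IsOpen O) (hu : IsC21 O u) {η : PSpace N → ℝ}
    (hη : ContDiff ℝ ∞ η) (hc : HasCompactSupport η) (hs : tsupport η ⊆ O) :
    ∫ z, u z * heatL η z = ∫ z, (lapl u z - tDeriv u z) * η z := by
  have h1 : ∀ v, tsupport (fun z => fderiv ℝ η z v) ⊆ O := fun v =>
    (tsupport_fderiv_apply_subset ℝ v).trans hs
  have ht : ∫ z, u z * dt η z = -∫ z, tDeriv u z * η z :=
    integral_mul_fderiv_eq_neg hO hu.cont hu.cont_t (fun z hz => hasLineDerivAt_tDeriv hu hz) hη hc hs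
  have hx : ∀ i, ∫ z, u z * dx i (dx i η) z = ∫ z, xxDeriv i i u z * η z := fun i => by
    have e1 : ∫ z, u z * dx i (dx i η) z = -∫ z, xDeriv i u z * dx i η z :=
      integral_mul_fderiv_eq_neg hO hu.cont (hu.cont_x i)
        (fun z hz => hasLineDerivAt_of_slice (hu.diff_x i z hz)) (contDiff_dx hη i)
        (hasCompactSupport_dx hc i) (h1 _)
    have e2 : ∫ z, xDeriv i u z * dx i η z = -∫ z, xxDeriv i i u z * η z :=
      integral_mul_fderiv_eq_neg hO (hu.cont_x i) (hu.cont_xx i i)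
        (fun z hz => hasLineDerivAt_of_slice (hu.diff_xx i i z hz)) hη hc hs
    rw [e1, e2, neg_neg]
  have it : Integrable fun z => u z * dt η z :=
    integrable_mul_of_tsupport hO hu.cont (contDiff_dt hη).continuous (hasCompactSupport_dt hc) (h1 _)
  have ix : ∀ i, Integrable fun z => u z * dx i (dx i η) z := fun i =>
    integrable_mul_of_tsupport hO hu.cont (contDiff_dx (contDiff_dx hη i) i).continuous
      (hasCompactSupport_dx (hasCompactSupport_dx hc i) i)
      ((tsupport_fderiv_apply_subset ℝ _).trans (h1 _))
  have jt : Integrable fun z => tDeriv u z * η z :=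
    integrable_mul_of_tsupport hO hu.cont_t hη.continuous hc hs
  have jx : ∀ i, Integrable fun z => xxDeriv i i u z * η z := fun i =>
    integrable_mul_of_tsupport hO (hu.cont_xx i i) hη.continuous hc hs
  simp only [heatL, lapl, mul_add, sub_mul, Finset.mul_sum, Finset.sum_mul]
  rw [integral_add it (integrable_finsetSum _ fun i _ => ix i),
    integral_finsetSum _ fun i _ => ix i,
    integral_sub (integrable_finsetSum _ fun i _ => jx i) jt,
    integral_finsetSum _ fun i _ => jx i, ht]
  simp only [hx]
  ring

lemma integral_mul_heatL_of_solution (hO : IsOpen O) {f : ℝ → ℝ} (hu : IsC21 O u)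
    (heq : ∀ z ∈ O, tDeriv u z - lapl u z + f (u z) = 0) {η : PSpace N → ℝ}
    (hη : ContDiff ℝ ∞ η) (hc : HasCompactSupport η) (hs : tsupport η ⊆ O) :
    ∫ z, u z * heatL η z = ∫ z, f (u z) * η z := by
  rw [integral_mul_heatL hO hu hη hc hs]
  congr 1
  funext z
  by_cases hz : z ∈ O
  · rw [show lapl u z - tDeriv u z = f (u z) by linarith [heq z hz]]
  · rw [image_eq_zero_of_notMem_tsupport fun h => hz (hs h), mul_zero, mul_zero]

lemma continuousOn_comp_of_solution {f : ℝ → ℝ} (hu : IsC21 O u)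
    (heq : ∀ z ∈ O, tDeriv u z - lapl u z + f (u z) = 0) : ContinuousOn (fun z => f (u z)) O := by
  have h : ContinuousOn (fun z => (∑ i, xxDeriv i i u z) - tDeriv u z) O :=
    (continuousOn_finsetSum _ fun i _ => hu.cont_xx i i).sub hu.cont_t
  exact h.congr fun z hz => by have := heq z hz; simp only [lapl] at this; linarith

end

/-- The test function `κ ψ Z ^ m` for the localized energy estimate. -/
def testFn (z₀ : PSpace N) (r : ℝ) (m : ℕ) (Z : PSpace N → ℝ) (z : PSpace N) : ℝ :=
  tCut r (z.2 - z₀.2) * ker z₀ (r ^ 2) z * Z z ^ m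

section
variable {z₀ z : PSpace N} {r : ℝ} {m : ℕ} {Z : PSpace N → ℝ}

lemma contDiff_tCut_sub (z₀ : PSpace N) (r : ℝ) :
    ContDiff ℝ ∞ fun z : PSpace N => tCut r (z.2 - z₀.2) :=
  (contDiff_tCut r).comp (contDiff_snd.sub contDiff_const)

lemma contDiff_testFn (hr : 0 < r) (hZ : ContDiff ℝ ∞ Z) : ContDiff ℝ ∞ (testFn z₀ r m Z) :=
  ((contDiff_tCut_sub z₀ r).mul (contDiff_ker (by positivity))).mul (hZ.pow m)

lemma fderiv_snd_sub (z₀ z v : PSpace N) : fderiv ℝ (fun z : PSpace N => z.2 - z₀.2) z v = v.2 := by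
  rw [fderiv_sub_const, fderiv_snd]
  rfl

lemma dx_snd_sub (z₀ : PSpace N) (i : Fin N) :
    dx i (fun z : PSpace N => z.2 - z₀.2) = fun _ => 0 :=
  funext fun z => (fderiv_snd_sub z₀ z _).trans (by simp [eX])

lemma dx_tCut_sub (z₀ : PSpace N) (r : ℝ) (i : Fin N) :
    dx i (fun z : PSpace N => tCut r (z.2 - z₀.2)) = fun _ => 0 := by
  rw [dx_comp (contDiff_tCut r) (contDiff_snd.sub contDiff_const), dx_snd_sub]
  simp

lemma heatL_tCut_sub (z₀ : PSpace N) (r : ℝ) (z : PSpace N) :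
    heatL (fun z : PSpace N => tCut r (z.2 - z₀.2)) z = deriv (tCut r) (z.2 - z₀.2) := by
  rw [heatL_comp (contDiff_tCut r) (contDiff_snd.sub contDiff_const)]
  have h : dt (fun z : PSpace N => z.2 - z₀.2) z = 1 :=
    (fderiv_snd_sub z₀ z _).trans (by simp [eT])
  have h' : ∀ i : Fin N, dx i (fun _ : PSpace N => (0 : ℝ)) z = 0 := fun i => by simp [dx]
  simp [heatL, gsq, h, dx_snd_sub, h']

lemma abs_heatL_pow_le (hZ : ContDiff ℝ ∞ Z) (hZ0 : ∀ z, 0 ≤ Z z) (hZ1 : ∀ z, Z z ≤ 1) {L : Fin N → ℝ}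
    (hL : ∀ j, 0 ≤ L j) (hm : 2 ≤ m) (z : PSpace N) :
    |heatL (fun z => Z z ^ m) z| + ∑ j, L j * |dx j (fun z => Z z ^ m) z|
      ≤ m ^ 2 * Z z ^ (m - 2) * opT L Z z := by
  have hH : ContDiff ℝ ∞ fun s : ℝ => s ^ m := contDiff_id.pow m
  have d1 : deriv (fun s : ℝ => s ^ m) = fun s : ℝ => (m : ℝ) * s ^ (m - 1) := by
    funext s; simp
  have d2 : deriv (deriv fun s : ℝ => s ^ m) = fun s : ℝ => (m : ℝ) * (((m - 1 : ℕ) : ℝ) * s ^ (m - 2)) := by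
    funext s
    rw [d1, deriv_const_mul_field]
    simp [Nat.sub_sub]
  rw [heatL_comp hH hZ]
  simp only [dx_comp hH hZ]
  rw [d2, d1]
  have hm1 : (1 : ℝ) ≤ m := by exact_mod_cast (by omega : 1 ≤ m)
  have hcast : ((m - 1 : ℕ) : ℝ) ≤ m := by exact_mod_cast Nat.sub_le m 1
  have hP : 0 ≤ Z z ^ (m - 2) := pow_nonneg (hZ0 z) _
  have hP1 : Z z ^ (m - 1) ≤ Z z ^ (m - 2) := pow_le_pow_of_le_one (hZ0 z) (hZ1 z) (by omega)
  have hP0 : 0 ≤ Z z ^ (m - 1) := pow_nonneg (hZ0 z) _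
  set P := Z z ^ (m - 2)
  set P' := Z z ^ (m - 1)
  have hK : m * P' ≤ m ^ 2 * P := by
    rw [sq, mul_assoc]
    refine mul_le_mul_of_nonneg_left (hP1.trans (le_mul_of_one_le_left hP hm1)) (by positivity)
  have e1 : |m * P' * heatL Z z + m * ((m - 1 : ℕ) * P) * gsq Z z|
      ≤ m ^ 2 * P * |heatL Z z| + m ^ 2 * P * gsq Z z := by
    refine (abs_add_le _ _).trans (add_le_add ?_ ?_)
    · rw [abs_mul, abs_of_nonneg (by positivity : 0 ≤ m * P')]
      exact mul_le_mul_of_nonneg_right hK (abs_nonneg _)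
    · have hg := gsq_nonneg Z z
      rw [abs_of_nonneg (by positivity), ← mul_assoc, sq]
      gcongr
  have e2 : ∑ j, L j * |m * P' * dx j Z z| ≤ m ^ 2 * P * ∑ j, L j * |dx j Z z| := by
    rw [Finset.mul_sum]
    refine Finset.sum_le_sum fun j _ => ?_
    rw [abs_mul, abs_of_nonneg (by positivity : 0 ≤ m * P'), mul_left_comm]
    exact mul_le_mul_of_nonneg_right hK (mul_nonneg (hL j) (abs_nonneg _))
  rw [opT]
  linarith

lemma heatL_testFn_le (hr : 0 < r) (hZ : ContDiff ℝ ∞ Z) (hZ0 : ∀ z, 0 ≤ Z z)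
    (hZ1 : ∀ z, Z z ≤ 1) (hm : 2 ≤ m) (hz : z.2 < z₀.2) :
    heatL (testFn z₀ r m Z) z ≤ deriv (tCut r) (z.2 - z₀.2) * ker z₀ (r ^ 2) z * Z z ^ m
      + tCut r (z.2 - z₀.2) * ker z₀ (r ^ 2) z *
        (m ^ 2 * Z z ^ (m - 2) * opT (kerL z₀ (r ^ 2) z) Z z) := by
  have hτ : 0 < r ^ 2 := by positivity
  have hk := contDiff_ker (z₀ := z₀) hτ
  have hc := contDiff_tCut_sub z₀ r
  have hw := hc.mul hk
  have e0 := heatL_mul hw (hZ.pow m) z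
  have e1 : heatL (fun z => tCut r (z.2 - z₀.2) * ker z₀ (r ^ 2) z) z
      = deriv (tCut r) (z.2 - z₀.2) * ker z₀ (r ^ 2) z := by
    rw [heatL_mul hc hk, heatL_ker hτ hz, heatL_tCut_sub]
    simp [dx_tCut_sub]
    ring
  have e2 : ∀ i, dx i (fun z => tCut r (z.2 - z₀.2) * ker z₀ (r ^ 2) z) z
      = -(tCut r (z.2 - z₀.2) * ker z₀ (r ^ 2) z) *
        ((z.1 i - z₀.1 i) / (2 * sTime (r ^ 2) (z.2 - z₀.2))) := fun i => by
    rw [dx_mul hc hk]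
    beta_reduce
    rw [dx_ker hτ, dx_tCut_sub]
    ring
  change heatL (fun z => tCut r (z.2 - z₀.2) * ker z₀ (r ^ 2) z * Z z ^ m) z ≤ _
  rw [e0, e1]
  simp only [e2]
  have hw0 : 0 ≤ tCut r (z.2 - z₀.2) * ker z₀ (r ^ 2) z := mul_nonneg tCut_nonneg (ker_pos _ _ _).le
  set w := tCut r (z.2 - z₀.2) * ker z₀ (r ^ 2) z
  have e3 := abs_heatL_pow_le hZ hZ0 hZ1 (kerL_nonneg hτ z₀ z) hm z
  have hS := sTime_pos hτ (z.2 - z₀.2)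
  have e4 : 2 * ∑ i, -w * ((z.1 i - z₀.1 i) / (2 * sTime (r ^ 2) (z.2 - z₀.2))) *
      dx i (fun z => Z z ^ m) z ≤ w * ∑ j, kerL z₀ (r ^ 2) z j * |dx j (fun z => Z z ^ m) z| := by
    rw [Finset.mul_sum, Finset.mul_sum]
    refine Finset.sum_le_sum fun i _ => ?_
    have e5 : 2 * (-w * ((z.1 i - z₀.1 i) / (2 * sTime (r ^ 2) (z.2 - z₀.2))) *
      dx i (fun z => Z z ^ m) z) = w * ((-(z.1 i - z₀.1 i) * dx i (fun z => Z z ^ m) z)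
        / sTime (r ^ 2) (z.2 - z₀.2)) := by
      field_simp
    rw [e5, kerL, div_mul_eq_mul_div, ← abs_mul]
    gcongr
    exact (le_abs_self _).trans_eq (by rw [neg_mul, abs_neg])
  have e6 := mul_le_mul_of_nonneg_left e3 hw0
  have e7 := mul_le_mul_of_nonneg_left (le_abs_self (heatL (fun z => Z z ^ m) z)) hw0
  rw [mul_add] at e6
  linarith [mul_comm (Z z ^ m) (deriv (tCut r) (z.2 - z₀.2) * ker z₀ (r ^ 2) z)]

lemma tsupport_testFn_subset (hr : 0 < r) (hm : m ≠ 0) : tsupport (testFn z₀ r m Z) ⊆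
    tsupport Z ∩ {z | z.2 - z₀.2 ≤ -(r ^ 2 / 2)} := by
  refine closure_minimal (fun z hz => ⟨subset_tsupport _ fun h => hz ?_, ?_⟩)
    ((isClosed_tsupport _).inter (isClosed_le (by fun_prop) continuous_const))
  · rw [testFn, h, zero_pow hm, mul_zero]
  · by_contra h
    exact hz (by rw [testFn, tCut_eq_zero hr (not_le.1 h).le, zero_mul, zero_mul])

lemma mem_tsupport_testFn (hZ : Z z = 1) (h : deriv (tCut r) (z.2 - z₀.2) ≠ 0) :
    z ∈ tsupport (testFn z₀ r m Z) := by
  refine subset_tsupport _ fun h0 => h ?_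
  rw [testFn, hZ, one_pow, mul_one, mul_eq_zero, or_iff_left (ker_pos _ _ _).ne'] at h0
  exact IsLocalMin.deriv_eq_zero (Eventually.of_forall fun s => by
    rw [h0]; exact tCut_nonneg)

end

lemma young_pow {p q u B s : ℝ} {m : ℕ} (hq : 1 < q) (hp : p = q / (q - 1)) (hu : 0 ≤ u)
    (hB : 0 ≤ B) (hs : 0 ≤ s) (hs1 : s ≤ 1) (hm : 2 * p ≤ m) :
    u * (m ^ 2 * s ^ (m - 2) * B) ≤ u ^ q * s ^ m + ((m : ℝ) ^ 2) ^ p * B ^ p := by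
  have hq1 : 0 < q - 1 := by linarith
  have hp1 : 1 < p := by rw [hp, one_lt_div hq1]; linarith
  have hm2 : 2 ≤ m := by
    have : (2 : ℝ) ≤ m := by linarith
    exact_mod_cast this
  have hc : q.HolderConjugate p := by rw [hp]; exact Real.HolderConjugate.conjExponent hq
  have h := Real.young_inequality_of_nonneg (a := u * s ^ (m - 2)) (b := m ^ 2 * B) (by positivity)
    (by positivity) hc
  have h1 : (u * s ^ (m - 2)) ^ q ≤ u ^ q * s ^ m := by
    rw [Real.mul_rpow hu (by positivity), ← Real.rpow_natCast, ← Real.rpow_mul hs,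
      ← Real.rpow_natCast s m]
    refine mul_le_mul_of_nonneg_left (Real.rpow_le_rpow_of_exponent_ge' hs hs1 (by positivity) ?_)
      (by positivity)
    rw [hp, ← mul_div_assoc, div_le_iff₀ hq1] at hm
    push_cast [hm2]
    linarith
  have h2 : (m ^ 2 * B) ^ p = ((m : ℝ) ^ 2) ^ p * B ^ p := Real.mul_rpow (by positivity) hB
  have h3 : (u * s ^ (m - 2)) ^ q / q ≤ (u * s ^ (m - 2)) ^ q :=
    div_le_self (by positivity) hq.le
  have h4 : (m ^ 2 * B) ^ p / p ≤ (m ^ 2 * B) ^ p := div_le_self (by positivity) hp1.le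
  calc u * (m ^ 2 * s ^ (m - 2) * B) = u * s ^ (m - 2) * (m ^ 2 * B) := by ring
    _ ≤ _ := by linarith

lemma tsupport_heatL_subset (η : PSpace N → ℝ) : tsupport (heatL η) ⊆ tsupport η := by
  refine closure_minimal (fun z hz => ?_) (isClosed_tsupport _)
  by_contra h
  refine hz ((heatL_congr (notMem_tsupport_iff_eventuallyEq.1 h)).trans ?_)
  have hx : ∀ i : Fin N, dx i (0 : PSpace N → ℝ) = 0 := fun i => funext fun z => by simp [dx]
  simp [heatL, dt, hx]

lemma continuous_kerL {τ : ℝ} (hτ : 0 < τ) (z₀ : PSpace N) (j : Fin N) :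
    Continuous fun z => kerL z₀ τ z j := by
  unfold kerL
  refine Continuous.div ?_ (contDiff_sTime_sub z₀ τ).continuous fun z => (sTime_pos hτ _).ne'
  have h : Continuous fun z : PSpace N => z.1 j := by fun_prop
  exact (h.sub continuous_const).abs

lemma continuous_opT {τ : ℝ} (hτ : 0 < τ) (z₀ : PSpace N) {Z : PSpace N → ℝ}
    (hZ : ContDiff ℝ ∞ Z) : Continuous fun z => opT (kerL z₀ τ z) Z z :=
  ((contDiff_heatL hZ).continuous.abs.add (contDiff_gsq hZ).continuous).add
    (continuous_finsetSum _ fun j _ =>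
      (continuous_kerL hτ z₀ j).mul (contDiff_dx hZ j).continuous.abs)

/-- Testing the equation against `κ ψ Z ^ m` bounds the solution where `κ` is steep. -/
lemma energy_le {O : Set (PSpace N)} (hO : IsOpen O) {u : PSpace N → ℝ} {q p : ℝ}
    (hu : IsC21 O u) (heq : ∀ z ∈ O, tDeriv u z - lapl u z + u z ^ q = 0) (hq : 1 < q)
    (hp : p = q / (q - 1)) {m : ℕ} (hm : 2 * p ≤ m) {z₀ : PSpace N} {r C A : ℝ} (hr : 0 < r)
    {Z : PSpace N → ℝ} (hZ : ContDiff ℝ ∞ Z) (hZ0 : ∀ z, 0 ≤ Z z) (hZ1 : ∀ z, Z z ≤ 1)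
    (hc : HasCompactSupport Z) (hs : ∀ z ∈ tsupport Z, z.2 < z₀.2 → z ∈ O)
    (hu0 : ∀ z ∈ tsupport Z, z.2 < z₀.2 → 0 ≤ u z) (hC : 0 ≤ C)
    (hH : ∫⁻ z in {z | z.2 < z₀.2}, ENNReal.ofReal (ker z₀ (r ^ 2) z *
      opT (kerL z₀ (r ^ 2) z) Z z ^ p) ≤ ENNReal.ofReal C)
    {E : Set (PSpace N)} (hE : MeasurableSet E) (hEf : volume E ≠ ⊤)
    (hEt : E ⊆ tsupport (testFn z₀ r m Z))
    (hA : ∀ z ∈ E, A ≤ u z * (-deriv (tCut r) (z.2 - z₀.2) * ker z₀ (r ^ 2) z * Z z ^ m)) :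
    A * (volume E).toReal ≤ ((m : ℝ) ^ 2) ^ p * C := by
  have hτ : 0 < r ^ 2 := by positivity
  have hq1 : 0 < q - 1 := by linarith
  have hp1 : 1 < p := by rw [hp, one_lt_div hq1]; linarith
  have hm2 : 2 ≤ m := by
    have : (2 : ℝ) ≤ m := by linarith
    exact_mod_cast this
  set η := testFn z₀ r m Z with hη
  set H : PSpace N → ℝ := fun z => ker z₀ (r ^ 2) z * opT (kerL z₀ (r ^ 2) z) Z z ^ p with hHd
  have hηc : ContDiff ℝ ∞ η := contDiff_testFn hr hZ
  have hsub : ∀ z ∈ tsupport η, z ∈ tsupport Z ∧ z.2 < z₀.2 := fun z hz => by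
    obtain ⟨h1, h2⟩ := tsupport_testFn_subset hr (by omega) hz
    rw [mem_ofPred_eq] at h2
    exact ⟨h1, by nlinarith⟩
  have hηO : tsupport η ⊆ O := fun z hz => hs z (hsub z hz).1 (hsub z hz).2
  have hηcs : HasCompactSupport η :=
    hc.of_isClosed_subset (isClosed_tsupport _) fun z hz => (hsub z hz).1
  have hLO := (tsupport_heatL_subset η).trans hηO
  have hLcs : HasCompactSupport (heatL η) :=
    hηcs.of_isClosed_subset (isClosed_tsupport _) (tsupport_heatL_subset η)
  have hi1 := integrable_mul_of_tsupport hO (continuousOn_comp_of_solution (f := fun s => s ^ q) hu heq)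
    hηc.continuous hηcs hηO
  have hi2 := integrable_mul_of_tsupport hO hu.cont (contDiff_heatL hηc).continuous hLcs hLO
  have hInt := integral_mul_heatL_of_solution (f := fun s => s ^ q) hO hu heq hηc hηcs hηO
  have hB0 : ∀ z, 0 ≤ opT (kerL z₀ (r ^ 2) z) Z z := fun z => opT_nonneg (kerL_nonneg hτ z₀ z) Z z
  have hH0 : ∀ z, 0 ≤ H z := fun z => mul_nonneg (ker_pos _ _ _).le (Real.rpow_nonneg (hB0 z) _)
  have hHc : Continuous H := (contDiff_ker hτ).continuous.mul
    ((continuous_opT hτ z₀ hZ).rpow_const fun _ => Or.inr (by linarith))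
  have hTm : MeasurableSet {z : PSpace N | z.2 < z₀.2} :=
    (isOpen_lt continuous_snd continuous_const).measurableSet
  have hHi : IntegrableOn H {z | z.2 < z₀.2} :=
    ⟨hHc.aestronglyMeasurable, by
      rw [hasFiniteIntegral_iff_ofReal (Eventually.of_forall hH0)]
      exact hH.trans_lt ENNReal.ofReal_lt_top⟩
  have hHC : ∫ z in {z | z.2 < z₀.2}, H z ≤ C := by
    rw [integral_eq_lintegral_of_nonneg_ae (Eventually.of_forall hH0) hHc.aestronglyMeasurable]
    exact ENNReal.toReal_le_of_le_ofReal hC hH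
  have key : ∀ z, E.indicator (fun _ => A) z ≤ (u z ^ q * η z - u z * heatL η z)
      + ((m : ℝ) ^ 2) ^ p * {z | z.2 < z₀.2}.indicator H z := fun z => by
    by_cases hz : z ∈ tsupport η
    · obtain ⟨hzZ, hzt⟩ := hsub z hz
      have hu1 := hu0 z hzZ hzt
      have h1 := heatL_testFn_le (z₀ := z₀) hr hZ hZ0 hZ1 hm2 hzt
      have h2 := young_pow hq hp hu1 (hB0 z) (hZ0 z) (hZ1 z) hm
      have hk := (ker_pos z₀ (r ^ 2) z).le
      have h3 := mul_le_mul_of_nonneg_left h1 hu1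
      have hw : 0 ≤ tCut r (z.2 - z₀.2) * ker z₀ (r ^ 2) z := mul_nonneg tCut_nonneg hk
      have h4 := mul_le_mul_of_nonneg_left h2 hw
      have h5 : tCut r (z.2 - z₀.2) * ker z₀ (r ^ 2) z *
          (((m : ℝ) ^ 2) ^ p * opT (kerL z₀ (r ^ 2) z) Z z ^ p) ≤ ((m : ℝ) ^ 2) ^ p * H z := by
        have := mul_le_mul_of_nonneg_right (tCut_le_one (r := r) (s := z.2 - z₀.2))
          (mul_nonneg (Real.rpow_nonneg (sq_nonneg (m : ℝ)) p) (hH0 z))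
        calc _ = tCut r (z.2 - z₀.2) * (((m : ℝ) ^ 2) ^ p * H z) := by rw [hHd]; ring
          _ ≤ _ := by linarith
      have h6 : E.indicator (fun _ => A) z
          ≤ u z * (-deriv (tCut r) (z.2 - z₀.2) * ker z₀ (r ^ 2) z * Z z ^ m) := by
        by_cases hzE : z ∈ E
        · rw [indicator_of_mem hzE]
          exact hA z hzE
        · rw [indicator_of_notMem hzE]
          exact mul_nonneg hu1 (mul_nonneg (mul_nonneg (neg_nonneg.2 (deriv_tCut_nonpos _ _)) hk)
            (pow_nonneg (hZ0 z) _))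
      have hzH : {z : PSpace N | z.2 < z₀.2}.indicator H z = H z :=
        indicator_of_mem (s := {z : PSpace N | z.2 < z₀.2}) hzt H
      rw [hzH, hη]
      have e : testFn z₀ r m Z z = tCut r (z.2 - z₀.2) * ker z₀ (r ^ 2) z * Z z ^ m := rfl
      rw [e]
      linarith
    · rw [indicator_of_notMem fun h => hz (hEt h), image_eq_zero_of_notMem_tsupport hz,
        image_eq_zero_of_notMem_tsupport fun h => hz (tsupport_heatL_subset η h)]
      have := indicator_nonneg (s := {z : PSpace N | z.2 < z₀.2}) (f := H) (fun z _ => hH0 z) z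
      have h' := Real.rpow_nonneg (sq_nonneg (m : ℝ)) p
      rw [mul_zero, mul_zero, sub_zero, zero_add]
      positivity
  have hi3 := (hHi.integrable_indicator hTm).const_mul (((m : ℝ) ^ 2) ^ p)
  have hi12 : Integrable fun z => u z ^ q * η z - u z * heatL η z := hi1.sub hi2
  have hmono := integral_mono ((integrable_indicator_iff hE).2 (integrableOn_const hEf))
    (hi12.add hi3) key
  have e1 : ∫ z, E.indicator (fun _ => A) z = A * (volume E).toReal := by
    rw [integral_indicator hE, setIntegral_const, smul_eq_mul, mul_comm, measureReal_def]
  have e2 : ∫ z, (u z ^ q * η z - u z * heatL η z) = 0 := by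
    rw [integral_sub hi1 hi2, hInt, sub_self]
  rw [e1] at hmono
  refine hmono.trans ?_
  rw [integral_add' hi12 hi3, e2, zero_add, integral_const_mul, integral_indicator hTm]
  exact mul_le_mul_of_nonneg_left hHC (Real.rpow_nonneg (sq_nonneg _) _)

lemma volume_ball_prod_Ioo (x : EuclideanSpace ℝ (Fin N)) {r c d : ℝ} (hr : 0 < r) :
    volume (ball x r ×ˢ Ioo c d : Set (PSpace N))
      = ENNReal.ofReal ((volume (ball (0 : EuclideanSpace ℝ (Fin N)) 1)).toReal * r ^ N * (d - c)) := by
  rw [Measure.volume_eq_prod, Measure.prod_prod, Real.volume_Ioo, Measure.addHaar_ball_of_pos _ _ hr,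
    finrank_euclideanSpace_fin, ENNReal.ofReal_mul (by positivity),
    ENNReal.ofReal_mul (by positivity), ENNReal.ofReal_toReal measure_ball_lt_top.ne,
    mul_comm (volume _)]

/-- A large solution cannot exist if the capacitary Wiener integral converges at a point of the
parabolic boundary. -/
lemma wiener_integral_eq_top {O : Set (PSpace N)} {q : ℝ} (hq : 1 < q) (hO : IsOpen O)
    {u : PSpace N → ℝ} (hu : IsLargeSolution O (fun s => s ^ q) u) {z₀ : PSpace N}
    (hz₀ : z₀ ∈ pBoundary N O) :
    ∫⁻ ρ in Ioo (0 : ℝ) 1,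
      ENNReal.ofReal (cap21 N (q / (q - 1)) (Oᶜ ∩ pQ N ρ z₀) / ρ ^ (N + 1)) = ⊤ := by
  by_contra hfin
  obtain ⟨huc, heq, hub⟩ := hu
  have hq1 : 0 < q - 1 := by linarith
  obtain ⟨p, hp⟩ : ∃ p, p = q / (q - 1) := ⟨_, rfl⟩
  have hp1 : 1 < p := by rw [hp, one_lt_div hq1]; linarith
  rw [← hp] at hfin
  have hpow : Tendsto (fun n : ℕ => (1 / 2 : ℝ) ^ n) atTop (𝓝 0) :=
    tendsto_pow_atTop_nhds_zero_of_lt_one (by norm_num) (by norm_num)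
  obtain ⟨δ, hδ, hu0⟩ := hub z₀ hz₀ 0
  obtain ⟨n₀, hn₀⟩ := (hpow.eventually (gt_mem_nhds (half_pos hδ))).exists
  obtain ⟨i₀, hi₀, C, ε, hC, hε, hbar⟩ := exists_barrier hO z₀ hp1 hfin n₀
  obtain ⟨m, hm⟩ := exists_nat_ge (2 * p)
  obtain ⟨c, hc, hker⟩ := exists_le_ker N
  obtain ⟨a, b, ha, hab, hb, hsteep⟩ := exists_tCut_steep
  set ω₀ := (volume (ball (0 : EuclideanSpace ℝ (Fin N)) 1)).toReal with hω₀
  have hω : 0 < ω₀ := ENNReal.toReal_pos (measure_ball_pos _ _ one_pos).ne' measure_ball_lt_top.ne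
  set v := ω₀ * ((b - a) / 2) with hv
  have hv0 : 0 < v := mul_pos hω (by linarith)
  set K := ((m : ℝ) ^ 2) ^ p * C with hK
  have hK0 : 0 ≤ K := mul_nonneg (Real.rpow_nonneg (sq_nonneg _) _) hC
  set M := (K + 1) / (c * (v / 2)) with hM
  have hM0 : 0 < M := by positivity
  obtain ⟨δ', hδ', huM⟩ := hub z₀ hz₀ M
  obtain ⟨J, hJδ, hJε, hJ⟩ := ((hpow.eventually (gt_mem_nhds hδ')).and
    ((hε.eventually (gt_mem_nhds (half_pos hv0))).and (eventually_ge_atTop i₀))).exists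
  obtain ⟨Z, hZ, hZ0, hZ1, hZs, hZO, hbad, hH⟩ := hbar J hJ
  set r := (1 / 2 : ℝ) ^ J with hr
  have hr0 : 0 < r := by positivity
  have hi : (1 / 2 : ℝ) ^ i₀ < δ / 2 :=
    (pow_le_pow_of_le_one (by norm_num) (by norm_num) hi₀).trans_lt hn₀
  have hi' : 0 < (1 / 2 : ℝ) ^ i₀ := by positivity
  have hbox : tsupport Z ⊆ pBox z₀ ((1 / 2) ^ i₀) :=
    closure_minimal (fun z hz => mem_pBox.2 ⟨(hZs z hz).1.le, (hZs z hz).2.le⟩)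
      (isCompact_pBox _ _).isClosed
  have hs : ∀ z ∈ tsupport Z, z.2 < z₀.2 → z ∈ O := fun z hz hzt => by
    by_contra h
    exact notMem_tsupport_iff_eventuallyEq.2 (hZO z h hzt.le) hz
  have hu0' : ∀ z ∈ tsupport Z, z.2 < z₀.2 → 0 ≤ u z := fun z hz hzt => by
    obtain ⟨h1, h2⟩ := mem_pBox.1 (hbox hz)
    refine hu0 z ⟨hs z hz hzt, ⟨?_, ?_, hzt.le⟩⟩
    · rw [mem_ball, dist_eq_norm]; linarith
    · nlinarith [(abs_le.1 h2).1]
  set E₀ : Set (PSpace N) := ball z₀.1 r ×ˢ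
    Ioo (z₀.2 - r ^ 2 + a * (r ^ 2 / 2)) (z₀.2 - r ^ 2 + b * (r ^ 2 / 2)) with hE₀
  have hr2 : 0 < r ^ 2 := by positivity
  have hE₀t : ∀ z ∈ E₀, ‖z.1 - z₀.1‖ < r ∧ -r ^ 2 < z.2 - z₀.2 ∧ z.2 < z₀.2 ∧
      (z.2 - z₀.2 + r ^ 2) / (r ^ 2 / 2) ∈ Ioo a b := fun z hz => by
    obtain ⟨h1, h2, h3⟩ := hz
    have h4 := mul_pos ha (half_pos hr2)
    have h5 := mul_lt_mul_of_pos_right hb (half_pos hr2)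
    refine ⟨mem_ball_iff_norm.1 h1, by linarith, by linarith, ?_, ?_⟩
    · rw [lt_div_iff₀ (by positivity)]; linarith
    · rw [div_lt_iff₀ (by positivity)]; linarith
  have hvol : volume E₀ = ENNReal.ofReal (v * r ^ (N + 2)) := by
    rw [hE₀, volume_ball_prod_Ioo _ hr0]
    congr 1
    rw [hv]
    ring
  set E := E₀ ∩ {z | Z z = 1} with hE
  have hEm : MeasurableSet E :=
    (measurableSet_ball.prod measurableSet_Ioo).inter
      (isClosed_eq hZ.continuous continuous_const).measurableSet
  have hEf : volume E ≠ ⊤ :=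
    ((measure_mono inter_subset_left).trans_lt (hvol ▸ ENNReal.ofReal_lt_top)).ne
  have hEt : E ⊆ tsupport (testFn z₀ r m Z) := fun z hz => by
    refine mem_tsupport_testFn hz.2 fun h => ?_
    have := hsteep r hr0 _ (hE₀t z hz.1).2.2.2
    rw [h, neg_zero] at this
    exact absurd this (not_le.2 (by positivity))
  have hA : ∀ z ∈ E, M * c * (r ^ N)⁻¹ * (r ^ 2)⁻¹
      ≤ u z * (-deriv (tCut r) (z.2 - z₀.2) * ker z₀ (r ^ 2) z * Z z ^ m) := fun z hz => by
    obtain ⟨h1, h2, h3, h4⟩ := hE₀t z hz.1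
    have hz1 : Z z = 1 := hz.2
    have hzO : z ∈ O := hs z (subset_tsupport _ (by rw [Function.mem_support, hz1]; exact one_ne_zero)) h3
    have hzM : M ≤ u z := by
      refine huM z ⟨hzO, ⟨mem_ball_iff_norm.2 (h1.trans hJδ), ?_, h3.le⟩⟩
      nlinarith
    have h5 := hsteep r hr0 _ h4
    have h6 := hker z₀ z r hr0 h1.le h2.le h3.le
    have h7 := mul_le_mul h5 h6 (by positivity) ((by positivity : 0 ≤ (r ^ 2)⁻¹).trans h5)
    have h8 := mul_le_mul hzM h7 (by positivity) (hM0.le.trans hzM)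
    rw [hz1, one_pow, mul_one]
    exact le_of_eq_of_le (by ring) h8
  have hen := energy_le hO huc heq hq hp hm hr0 hZ hZ0 hZ1
    ((isCompact_pBox _ _).of_isClosed_subset (isClosed_tsupport _) hbox) hs hu0' hC hH hEm hEf hEt hA
  have hcov : ENNReal.ofReal (v * r ^ (N + 2))
      ≤ volume E + ENNReal.ofReal (v / 2 * r ^ (N + 2)) := by
    rw [← hvol]
    refine (measure_mono fun z hz => ?_).trans ((measure_union_le E _).trans
      (add_le_add_right (hbad.trans (ENNReal.ofReal_le_ofReal
        (mul_le_mul_of_nonneg_right hJε.le (by positivity)))) _))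
    by_cases h : Z z = 1
    · exact Or.inl ⟨hz, h⟩
    · obtain ⟨h1, h2, h3, -⟩ := hE₀t z hz
      exact Or.inr ⟨h1.le, abs_le.2 ⟨h2.le, by linarith⟩, h⟩
  have hlow : v / 2 * r ^ (N + 2) ≤ (volume E).toReal := by
    have h := ENNReal.toReal_mono (ENNReal.add_ne_top.2 ⟨hEf, ENNReal.ofReal_ne_top⟩) hcov
    rw [ENNReal.toReal_add hEf ENNReal.ofReal_ne_top, ENNReal.toReal_ofReal (by positivity),
      ENNReal.toReal_ofReal (by positivity)] at h
    linarith
  have hfinal := mul_le_mul_of_nonneg_left hlow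
    (by positivity : 0 ≤ M * c * (r ^ N)⁻¹ * (r ^ 2)⁻¹)
  have e : M * c * (r ^ N)⁻¹ * (r ^ 2)⁻¹ * (v / 2 * r ^ (N + 2)) = K + 1 := by
    rw [hM, pow_add]
    field_simp
  linarith

end HeatPot
end
end

/-- **Theorem 1.1 (ii).** Wiener-type necessary condition for existence of a large
solution of `∂_t u - Δu + u^q = 0` in a bounded open set `O ⊆ ℝ^{N+1}`. -/
theorem large_solution_implies_capacity_wiener_test
    (N : ℕ) (hN : 2 ≤ N) (q : ℝ) (hq : ((N : ℝ) + 2) / N ≤ q)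
    (O : Set (PSpace N)) (hO : IsOpen O) (hOb : Bornology.IsBounded O)
    (hL : ∃ u : PSpace N → ℝ, IsLargeSolution O (fun s => s ^ q) u) :
    ∀ z ∈ pBoundary N O,
      ∫⁻ ρ in Ioo (0 : ℝ) 1,
        ENNReal.ofReal (cap21 N (q / (q - 1)) (Oᶜ ∩ pQ N ρ z) / ρ ^ (N + 1)) = ⊤ := by
  obtain ⟨u, hu⟩ := hL
  have hN0 : (0 : ℝ) < N := by exact_mod_cast (by omega : 0 < N)
  have hq1 : 1 < q := lt_of_lt_of_le ((one_lt_div hN0).2 (by linarith)) hq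
  exact fun z hz => HeatPot.wiener_integral_eq_top hq1 hO hu hz
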